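/- Rank-one orthogonal-Gaussian mismatched MSE: in the case r = k = 1 with true power α > 0, inferred power β > 0, true SNR λ* > 0 and inferred SNR λ > 0, the mismatched matrix-MSE converges as n → ∞ to: (1/√λ − 1/(λβ))² + α² if λ*α² ≤ 1 and λβ² > 1; g^Gau(α, β, λ*, λ) + α² if λ*α² > 1 and λ*λα²β² > 1; and α² otherwise, where g^Gau(α, β, λ*, λ) = α²(−2√(λ*/λ) + λ*/λ) + 2/√(λ*λ) + 1/(λ²β²) + (2α/(λβ))(1 − √(λ*/λ)) − 2/(λ*λβα). -/

import Mathlib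

open MeasureTheory Matrix ProbabilityTheory Filter

noncomputable section

instance matMS (m n : ℕ) : MeasurableSpace (Matrix (Fin m) (Fin n) ℝ) := borel _
instance matBorel (m n : ℕ) : BorelSpace (Matrix (Fin m) (Fin n) ℝ) := ⟨rfl⟩

/-- The Gaussian Orthogonal Ensemble: the law of the random symmetric `n × n` matrix with
independent entries `w i j ~ N(0,1)` for `i < j` and `w i i ~ N(0,2)`. -/
def goe (n : ℕ) : Measure (Matrix (Fin n) (Fin n) ℝ) :=
  (Measure.pi fun p : Fin n × Fin n =>
      gaussianReal 0 (if p.1 = p.2 then 2 else 1)).map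
    (fun w => Matrix.of fun i j => if i ≤ j then w (i, j) else w (j, i))

/-- The standard Gaussian measure on `ℝ^n`. -/
def vecGauss (n : ℕ) : Measure (Fin n → ℝ) := Measure.pi fun _ : Fin n => gaussianReal 0 1

/-- Squared Frobenius norm. -/
def frob2 {n : ℕ} (A : Matrix (Fin n) (Fin n) ℝ) : ℝ := ∑ i, ∑ j, (A i j) ^ 2

/-- Rank-one observation `Y = √(λ⋆α²/n) s sᵀ + W`. -/
def obsY1 {n : ℕ} (ls a : ℝ) (s : Fin n → ℝ) (W : Matrix (Fin n) (Fin n) ℝ) :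
    Matrix (Fin n) (Fin n) ℝ :=
  Real.sqrt (ls * a ^ 2 / n) • Matrix.vecMulVec s s + W

/-- The rank-one mismatched Gibbs weight `exp(−¼‖√(λβ²/n) x xᵀ − Y‖_F²)`. -/
def weight1 {n : ℕ} (l b : ℝ) (x : Fin n → ℝ) (Y : Matrix (Fin n) (Fin n) ℝ) : ℝ :=
  Real.exp (-(1 / 4) * frob2 (Real.sqrt (l * b ^ 2 / n) • Matrix.vecMulVec x x - Y))

/-- Rank-one partition function. -/
def partitionZ1 (n : ℕ) (l b : ℝ) (Y : Matrix (Fin n) (Fin n) ℝ) : ℝ :=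
  ∫ x, weight1 l b x Y ∂ vecGauss n

/-- Rank-one mismatched Bayes estimator `M_mis(Y) = ⟨β x xᵀ⟩`. -/
def mmis1 (n : ℕ) (l b : ℝ) (Y : Matrix (Fin n) (Fin n) ℝ) : Matrix (Fin n) (Fin n) ℝ :=
  Matrix.of fun i j =>
    (∫ x, weight1 l b x Y * (b * x i * x j) ∂ vecGauss n) / partitionZ1 n l b Y

/-- Rank-one mismatched matrix-MSE `MSE_n = n⁻² E_{s,W}‖α s sᵀ − M_mis(Y)‖_F²`. -/
def mse1 (ls l a b : ℝ) (n : ℕ) : ℝ :=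
  (1 / (n : ℝ) ^ 2) *
    ∫ p, frob2 (a • Matrix.vecMulVec p.1 p.1 - mmis1 n l b (obsY1 ls a p.1 p.2))
      ∂ (vecGauss n).prod (goe n)

/-- The inference-term summand `g^Gau`. -/
def gGau (a b ls l : ℝ) : ℝ :=
  a ^ 2 * (-2 * Real.sqrt (ls / l) + ls / l) + 2 / Real.sqrt (ls * l) + 1 / (l ^ 2 * b ^ 2)
    + (2 * a / (l * b)) * (1 - Real.sqrt (ls / l)) - 2 / (ls * l * b * a)

namespace RankOne

/-- A measurable size function, bounded below by one. -/
class HasSize (α : Type*) [MeasurableSpace α] where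
  size : α → ℝ
  one_le : ∀ a, 1 ≤ size a
  meas : Measurable size

open HasSize

instance instSizePi {ι : Type*} [Fintype ι] : HasSize (ι → ℝ) where
  size x := 1 + ∑ i, x i ^ 2
  one_le x := by
    have : 0 ≤ ∑ i, x i ^ 2 := Finset.sum_nonneg fun i _ => sq_nonneg _
    linarith
  meas := by fun_prop

instance instSizeProd {α β : Type*} [MeasurableSpace α] [MeasurableSpace β] [HasSize α]
    [HasSize β] : HasSize (α × β) where
  size p := size p.1 * size p.2
  one_le p := one_le_mul_of_one_le_of_one_le (one_le p.1) (one_le p.2)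
  meas := ((meas (α := α)).comp measurable_fst).mul ((meas (α := β)).comp measurable_snd)

theorem size_pi {ι : Type*} [Fintype ι] (x : ι → ℝ) : size x = 1 + ∑ i, x i ^ 2 := rfl

theorem size_prod {α β : Type*} [MeasurableSpace α] [MeasurableSpace β] [HasSize α]
    [HasSize β] (p : α × β) : size p = size p.1 * size p.2 := rfl

/-- Measurable functions of polynomial growth. -/
@[fun_prop]
def PG {α : Type*} [MeasurableSpace α] [HasSize α] (f : α → ℝ) : Prop :=
  Measurable f ∧ ∃ C : ℝ, ∃ k : ℕ, 0 ≤ C ∧ ∀ a, |f a| ≤ C * size a ^ k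

section
variable {α β : Type*} [MeasurableSpace α] [MeasurableSpace β] [HasSize α] [HasSize β]

theorem PG.measurable {f : α → ℝ} (hf : PG f) : Measurable f := hf.1

theorem size_pos (a : α) : 0 < size a := lt_of_lt_of_le one_pos (one_le a)

@[fun_prop]
theorem PG.const (c : ℝ) : PG (fun _ : α => c) :=
  ⟨measurable_const, |c|, 0, abs_nonneg c, fun a => by simp⟩

@[fun_prop]
theorem PG.size_self : PG (fun a : α => size a) :=
  ⟨meas, 1, 1, zero_le_one, fun a => by
    simp [abs_of_pos (size_pos a)]⟩

@[fun_prop]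
theorem PG.add {f g : α → ℝ} (hf : PG f) (hg : PG g) : PG (fun a => f a + g a) := by
  obtain ⟨hm, C, k, hC, h⟩ := hf
  obtain ⟨hm', C', k', hC', h'⟩ := hg
  refine ⟨hm.add hm', C + C', k + k', by positivity, fun a => ?_⟩
  have h1 : HasSize.size a ^ k ≤ HasSize.size a ^ (k + k') :=
    pow_le_pow_right₀ (one_le a) (by omega)
  have h2 : HasSize.size a ^ k' ≤ HasSize.size a ^ (k + k') :=
    pow_le_pow_right₀ (one_le a) (by omega)
  calc |f a + g a| ≤ |f a| + |g a| := abs_add_le _ _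
    _ ≤ C * HasSize.size a ^ k + C' * HasSize.size a ^ k' := add_le_add (h a) (h' a)
    _ ≤ C * HasSize.size a ^ (k + k') + C' * HasSize.size a ^ (k + k') := by gcongr
    _ = _ := by ring

@[fun_prop]
theorem PG.mul {f g : α → ℝ} (hf : PG f) (hg : PG g) : PG (fun a => f a * g a) := by
  obtain ⟨hm, C, k, hC, h⟩ := hf
  obtain ⟨hm', C', k', hC', h'⟩ := hg
  refine ⟨hm.mul hm', C * C', k + k', by positivity, fun a => ?_⟩
  have := size_pos a
  calc |f a * g a| = |f a| * |g a| := abs_mul _ _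
    _ ≤ (C * HasSize.size a ^ k) * (C' * HasSize.size a ^ k') := by
        gcongr
        · exact h a
        · exact h' a
    _ = _ := by ring

@[fun_prop]
theorem PG.neg {f : α → ℝ} (hf : PG f) : PG (fun a => -f a) := by
  have := (PG.const (-1)).mul hf
  simpa using this

@[fun_prop]
theorem PG.sub {f g : α → ℝ} (hf : PG f) (hg : PG g) : PG (fun a => f a - g a) := by
  have := hf.add hg.neg
  simpa [sub_eq_add_neg] using this

@[fun_prop]
theorem PG.div_const {f : α → ℝ} (hf : PG f) (c : ℝ) : PG (fun a => f a / c) := by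
  have := hf.mul (PG.const c⁻¹)
  simpa [div_eq_mul_inv] using this

@[fun_prop]
theorem PG.pow {f : α → ℝ} (hf : PG f) (m : ℕ) : PG (fun a => f a ^ m) := by
  induction m with
  | zero => simpa using PG.const (α := α) 1
  | succ m ih => simpa [pow_succ] using ih.mul hf

@[fun_prop]
theorem PG.abs {f : α → ℝ} (hf : PG f) : PG (fun a => |f a|) := by
  obtain ⟨hm, C, k, hC, h⟩ := hf
  exact ⟨hm.abs, C, k, hC, fun a => by simpa using h a⟩

@[fun_prop]
theorem PG.sum {κ : Type*} (s : Finset κ) {f : κ → α → ℝ} (hf : ∀ i, PG (f i)) :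
    PG (fun a => ∑ i ∈ s, f i a) := by
  classical
  induction s using Finset.induction_on with
  | empty => simpa using PG.const (α := α) 0
  | insert i s hi ih => simpa [Finset.sum_insert hi] using (hf i).add ih

@[fun_prop]
theorem PG.coord {ι : Type*} [Fintype ι] (i : ι) : PG (fun x : ι → ℝ => x i) := by
  refine ⟨measurable_pi_apply i, 1, 1, zero_le_one, fun x => ?_⟩
  have h : x i ^ 2 ≤ ∑ j, x j ^ 2 :=
    Finset.single_le_sum (f := fun j => x j ^ 2) (fun j _ => sq_nonneg _) (Finset.mem_univ i)
  rw [size_pi, one_mul, pow_one, abs_le]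
  constructor <;> nlinarith [sq_nonneg (x i - 1), sq_nonneg (x i + 1)]

theorem PG.fst {f : α → ℝ} (hf : PG f) : PG (fun p : α × β => f p.1) := by
  obtain ⟨hm, C, k, hC, h⟩ := hf
  refine ⟨hm.comp measurable_fst, C, k, hC, fun p => (h p.1).trans ?_⟩
  have := size_pos p.1
  rw [size_prod]
  gcongr
  exact le_mul_of_one_le_right this.le (one_le _)

theorem PG.snd {f : β → ℝ} (hf : PG f) : PG (fun p : α × β => f p.2) := by
  obtain ⟨hm, C, k, hC, h⟩ := hf
  refine ⟨hm.comp measurable_snd, C, k, hC, fun p => (h p.2).trans ?_⟩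
  have := size_pos p.2
  rw [size_prod]
  gcongr
  exact le_mul_of_one_le_left this.le (one_le _)

/-- Sections of polynomially growing functions. -/
theorem PG.section_right {f : α × β → ℝ} (hf : PG f) (a : α) : PG (fun b => f (a, b)) := by
  obtain ⟨hm, C, k, hC, h⟩ := hf
  have := size_pos a
  refine ⟨hm.comp measurable_prodMk_left, C * HasSize.size a ^ k, k, by positivity, fun b =>
    (h _).trans (le_of_eq ?_)⟩
  rw [size_prod]; ring

theorem PG.of_le {f g : α → ℝ} (hm : Measurable f) (hg : PG g) (h : ∀ a, |f a| ≤ g a) : PG f := by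
  obtain ⟨-, C, k, hC, h'⟩ := hg
  exact ⟨hm, C, k, hC, fun a => (h a).trans ((le_abs_self _).trans (h' a))⟩

@[fun_prop]
theorem PG.coord_fst {ι : Type*} [Fintype ι] (i : ι) : PG (fun p : (ι → ℝ) × β => p.1 i) :=
  (PG.coord i).fst

@[fun_prop]
theorem PG.coord_snd {ι : Type*} [Fintype ι] (i : ι) : PG (fun p : β × (ι → ℝ) => p.2 i) :=
  (PG.coord i).snd

@[fun_prop]
theorem PG.coord_fst_fst {ι : Type*} [Fintype ι] {γ : Type*} [MeasurableSpace γ] [HasSize γ]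
    (i : ι) : PG (fun p : ((ι → ℝ) × β) × γ => p.1.1 i) :=
  (PG.coord_fst i).fst

@[fun_prop]
theorem PG.coord_fst_snd {ι : Type*} [Fintype ι] {γ : Type*} [MeasurableSpace γ] [HasSize γ]
    (i : ι) : PG (fun p : (β × (ι → ℝ)) × γ => p.1.2 i) :=
  (PG.coord_snd i).fst

end

section

/-- Squared Euclidean norm. -/
def nsq {ι : Type*} [Fintype ι] (x : ι → ℝ) : ℝ := ∑ i, x i ^ 2

/-- Euclidean inner product. -/
def ip {ι : Type*} [Fintype ι] (x y : ι → ℝ) : ℝ := ∑ i, x i * y i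

section
variable {ι : Type*} [Fintype ι]

theorem nsq_nonneg (x : ι → ℝ) : 0 ≤ nsq x := Finset.sum_nonneg fun _ _ => sq_nonneg _

theorem ip_self (x : ι → ℝ) : ip x x = nsq x := by simp [ip, nsq, pow_two]

theorem ip_comm (x y : ι → ℝ) : ip x y = ip y x := by simp [ip, mul_comm]

theorem ip_sq_le (x y : ι → ℝ) : ip x y ^ 2 ≤ nsq x * nsq y :=
  Finset.sum_mul_sq_le_sq_mul_sq _ _ _

theorem size_eq_nsq (x : ι → ℝ) : size x = 1 + nsq x := rfl

theorem integrable_exp_neg_nsq {η : ℝ} (hη : 0 < η) :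
    Integrable (fun x : ι → ℝ => Real.exp (-η * nsq x)) := by
  have := Integrable.fintype_prod (𝕜 := ℝ) (μ := fun _ : ι => (volume : Measure ℝ))
    (f := fun _ y => Real.exp (-η * y ^ 2)) (fun _ => integrable_exp_neg_mul_sq hη)
  refine this.congr (ae_of_all _ fun x => ?_)
  simp [nsq, Finset.mul_sum, ← Real.exp_sum]

theorem pow_mul_exp_le (k : ℕ) {η : ℝ} (hη : 0 < η) :
    ∃ C, 0 ≤ C ∧ ∀ r, 0 ≤ r → (1 + r) ^ k * Real.exp (-η * r) ≤ C := by
  refine ⟨k.factorial / η ^ k * Real.exp η, by positivity, fun r hr => ?_⟩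
  have h := Real.pow_div_factorial_le_exp (η * (1 + r)) (by positivity) k
  rw [div_le_iff₀ (by positivity), mul_pow] at h
  have e : Real.exp (-η * r) = Real.exp η * (Real.exp (η * (1 + r)))⁻¹ := by
    rw [← Real.exp_neg, ← Real.exp_add]; ring_nf
  rw [e]
  have h2 : (1 + r) ^ k ≤ k.factorial / η ^ k * Real.exp (η * (1 + r)) := by
    rw [div_mul_eq_mul_div, le_div_iff₀ (by positivity)]
    linarith
  calc (1 + r) ^ k * (Real.exp η * (Real.exp (η * (1 + r)))⁻¹)
      ≤ (k.factorial / η ^ k * Real.exp (η * (1 + r))) *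
        (Real.exp η * (Real.exp (η * (1 + r)))⁻¹) := by gcongr
    _ = _ := by field_simp

theorem PG.integrable_mul_exp {f : (ι → ℝ) → ℝ} (hf : PG f) {η : ℝ} (hη : 0 < η) :
    Integrable (fun x : ι → ℝ => f x * Real.exp (-η * nsq x)) := by
  obtain ⟨hm, C, k, hC, h⟩ := hf
  obtain ⟨C', hC', h'⟩ := pow_mul_exp_le k (half_pos hη)
  refine ((integrable_exp_neg_nsq (ι := ι) (half_pos hη)).const_mul (C * C')).mono'
    (by unfold nsq; fun_prop) (ae_of_all _ fun x => ?_)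
  rw [norm_mul, Real.norm_eq_abs, Real.norm_eq_abs, abs_of_pos (Real.exp_pos _)]
  have e : Real.exp (-η * nsq x) = Real.exp (-(η / 2) * nsq x) * Real.exp (-(η / 2) * nsq x) := by
    rw [← Real.exp_add]; ring_nf
  calc |f x| * Real.exp (-η * nsq x) ≤ C * size x ^ k * Real.exp (-η * nsq x) := by
        gcongr; exact h x
    _ = C * ((1 + nsq x) ^ k * Real.exp (-(η / 2) * nsq x)) * Real.exp (-(η / 2) * nsq x) := by
        rw [e, size_eq_nsq]; ring
    _ ≤ C * C' * Real.exp (-(η / 2) * nsq x) := by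
        gcongr
        exact h' _ (nsq_nonneg x)

/-- Confining potentials. -/
def Good (U : (ι → ℝ) → ℝ) : Prop :=
  Measurable U ∧ ∃ C η : ℝ, 0 < η ∧ ∀ x, U x ≤ C - η * nsq x

theorem Good.integrable_mul {U f : (ι → ℝ) → ℝ} (hU : Good U) (hf : PG f) :
    Integrable (fun x => f x * Real.exp (U x)) := by
  obtain ⟨hm, C, η, hη, h⟩ := hU
  have hfm := hf.measurable
  refine ((hf.abs.integrable_mul_exp hη).const_mul (Real.exp C)).mono' (by fun_prop)
    (ae_of_all _ fun x => ?_)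
  rw [norm_mul, Real.norm_eq_abs, Real.norm_eq_abs, abs_of_pos (Real.exp_pos _)]
  calc |f x| * Real.exp (U x) ≤ |f x| * Real.exp (C - η * nsq x) := by gcongr; exact h x
    _ = _ := by rw [sub_eq_add_neg, Real.exp_add]; ring_nf

theorem Good.integrable_exp {U : (ι → ℝ) → ℝ} (hU : Good U) :
    Integrable (fun x => Real.exp (U x)) := by
  simpa using hU.integrable_mul (PG.const 1)

/-- Partition function of a potential. -/
def Zf (U : (ι → ℝ) → ℝ) : ℝ := ∫ x, Real.exp (U x)

/-- Gibbs average. -/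
def av (U f : (ι → ℝ) → ℝ) : ℝ := (∫ x, f x * Real.exp (U x)) / Zf U

theorem Good.Zf_pos {U : (ι → ℝ) → ℝ} (hU : Good U) : 0 < Zf U :=
  integral_exp_pos hU.integrable_exp

theorem av_add {U f g : (ι → ℝ) → ℝ} (hU : Good U) (hf : PG f) (hg : PG g) :
    av U (fun x => f x + g x) = av U f + av U g := by
  unfold av
  rw [← add_div, ← integral_add (hU.integrable_mul hf) (hU.integrable_mul hg)]
  simp only [add_mul]

theorem av_const_mul {U : (ι → ℝ) → ℝ} (c : ℝ) (f : (ι → ℝ) → ℝ) :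
    av U (fun x => c * f x) = c * av U f := by
  unfold av
  simp_rw [mul_assoc]
  rw [integral_const_mul, mul_div_assoc]

theorem av_mul_const {U : (ι → ℝ) → ℝ} (c : ℝ) (f : (ι → ℝ) → ℝ) :
    av U (fun x => f x * c) = av U f * c := by
  simp_rw [mul_comm _ c]; exact av_const_mul c f

theorem av_neg {U : (ι → ℝ) → ℝ} (f : (ι → ℝ) → ℝ) : av U (fun x => -f x) = -av U f := by
  simpa using av_const_mul (U := U) (-1) f

theorem av_sub {U f g : (ι → ℝ) → ℝ} (hU : Good U) (hf : PG f) (hg : PG g) :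
    av U (fun x => f x - g x) = av U f - av U g := by
  simp_rw [sub_eq_add_neg]
  rw [av_add hU hf hg.neg, av_neg]

theorem av_const {U : (ι → ℝ) → ℝ} (hU : Good U) (c : ℝ) : av U (fun _ => c) = c := by
  unfold av
  rw [integral_const_mul]
  exact mul_div_cancel_right₀ c hU.Zf_pos.ne'

theorem av_sum {U : (ι → ℝ) → ℝ} (hU : Good U) {κ : Type*} (s : Finset κ)
    {f : κ → (ι → ℝ) → ℝ} (hf : ∀ i, PG (f i)) :
    av U (fun x => ∑ i ∈ s, f i x) = ∑ i ∈ s, av U (f i) := by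
  classical
  induction s using Finset.induction_on with
  | empty => simp [av]
  | insert i s hi ih =>
    simp only [Finset.sum_insert hi]
    rw [av_add hU (hf i) (by fun_prop), ih]

theorem av_mono {U f g : (ι → ℝ) → ℝ} (hU : Good U) (hf : PG f) (hg : PG g) (h : ∀ x, f x ≤ g x) :
    av U f ≤ av U g := by
  unfold av
  have := hU.Zf_pos
  gcongr
  · exact hU.integrable_mul hf
  · exact hU.integrable_mul hg
  · intro x
    have := h x
    dsimp only
    gcongr

theorem av_nonneg {U f : (ι → ℝ) → ℝ} (h : ∀ x, 0 ≤ f x) : 0 ≤ av U f :=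
  div_nonneg (integral_nonneg fun x => mul_nonneg (h x) (Real.exp_pos _).le)
    (integral_nonneg fun _ => (Real.exp_pos _).le)

theorem av_abs_le {U f : (ι → ℝ) → ℝ} (hU : Good U) (hf : PG f) :
    |av U f| ≤ av U (fun x => |f x|) := by
  rw [abs_le]
  constructor
  · rw [← av_neg]; exact av_mono hU (by fun_prop) hf fun x => neg_abs_le _
  · exact av_mono hU hf (by fun_prop) fun x => le_abs_self _

theorem av_sq_le {U f : (ι → ℝ) → ℝ} (hU : Good U) (hf : PG f) :
    av U f ^ 2 ≤ av U (fun x => f x ^ 2) := by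
  have h : 0 ≤ av U (fun x => (f x - av U f) ^ 2) := av_nonneg fun x => sq_nonneg _
  have e : (fun x => (f x - av U f) ^ 2) =
      fun x => f x ^ 2 + (-(2 * av U f) * f x + av U f ^ 2) := by ext x; ring
  rw [e, av_add hU (by fun_prop) (by fun_prop), av_add hU (by fun_prop) (by fun_prop),
    av_const_mul, av_const hU] at h
  nlinarith

/-- Gibbs variational inequality. -/
theorem log_Zf_ge {U V : (ι → ℝ) → ℝ} (hU : Good U) (hV : Good V)
    (hd : PG (fun x => V x - U x)) :
    Real.log (Zf U) + av U (fun x => V x - U x) ≤ Real.log (Zf V) := by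
  set m := av U (fun x => V x - U x) with hm
  have hZ := hU.Zf_pos
  have h1 : ∫ x, Real.exp m * ((1 - m + (V x - U x)) * Real.exp (U x)) ≤ Zf V := by
    refine integral_mono ((hU.integrable_mul (by fun_prop)).const_mul _) hV.integrable_exp
      fun x => ?_
    have h2 := Real.add_one_le_exp (V x - U x - m)
    have h3 : Real.exp (V x) = Real.exp m * (Real.exp (V x - U x - m) * Real.exp (U x)) := by
      rw [← Real.exp_add, ← Real.exp_add]; ring_nf
    rw [h3]
    gcongr
    linarith
  have h2 : av U (fun x => 1 - m + (V x - U x)) = 1 := by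
    rw [av_add hU (by fun_prop) hd, av_const hU, ← hm]; ring
  unfold av at h2
  rw [div_eq_one_iff_eq hZ.ne'] at h2
  rw [integral_const_mul, h2] at h1
  rw [← Real.log_exp m, ← Real.log_mul hZ.ne' (Real.exp_pos _).ne']
  exact Real.log_le_log (by positivity) (by linarith)

theorem Zf_affine (V : (ι → ℝ) → ℝ) {κ : ℝ} (hκ : 0 < κ) (m : ι → ℝ) :
    Zf V = κ ^ Fintype.card ι * Zf (fun x => V (κ • (x + m))) := by
  unfold Zf
  have h1 := integral_add_right_eq_self (μ := (volume : Measure (ι → ℝ)))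
    (fun x => Real.exp (V (κ • x))) m
  rw [h1]
  have h2 := Measure.integral_comp_smul (volume : Measure (ι → ℝ)) (fun x => Real.exp (V x)) κ
  rw [h2, Module.finrank_fintype_fun_eq_card, abs_of_pos (by positivity), smul_eq_mul,
    mul_inv_cancel_left₀ (by positivity)]

/-- Gibbs variational inequality along an affine change of variables. -/
theorem log_Zf_ge_affine {U V : (ι → ℝ) → ℝ} (hU : Good U) {κ : ℝ} (hκ : 0 < κ) (m : ι → ℝ)
    (hV : Good (fun x => V (κ • (x + m))))
    (hd : PG (fun x => V (κ • (x + m)) - U x)) :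
    Real.log (Zf U) + Fintype.card ι * Real.log κ + av U (fun x => V (κ • (x + m)) - U x) ≤
      Real.log (Zf V) := by
  rw [Zf_affine V hκ m, Real.log_mul (by positivity) hV.Zf_pos.ne', Real.log_pow]
  linarith [log_Zf_ge hU hV hd]

end

end

section

/-- Index set of the Gaussian disorder: matrix entries and a side field. -/
abbrev Ix (n : ℕ) := (Fin n × Fin n) ⊕ Fin n

abbrev Vec (n : ℕ) := Fin n → ℝ

/-- Disorder: planted vector and Gaussian noise. -/
abbrev Om (n : ℕ) := Vec n × (Ix n → ℝ)

/-- Parameters of the potential. -/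
structure Par where
  (b a e f τ d : ℝ)

variable {n : ℕ}

def cf (n : ℕ) (i j : Fin n) : ℝ :=
  if i < j then 1 / Real.sqrt n else if i = j then 1 / Real.sqrt (2 * n) else 0

/-- Quadratic form of the noise matrix. -/
def xw (J : Ix n → ℝ) (x : Vec n) : ℝ :=
  ∑ p : Fin n × Fin n, J (Sum.inl p) * (cf n p.1 p.2 * x p.1 * x p.2)

/-- Side field. -/
def gx (J : Ix n → ℝ) (x : Vec n) : ℝ := ∑ i, J (Sum.inr i) * x i

/-- The potential. -/
def pot (θ : Par) (ω : Om n) (x : Vec n) : ℝ :=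
  θ.b * xw ω.2 x + θ.a / (2 * n) * ip ω.1 x ^ 2 + θ.e * gx ω.2 x + θ.f * ip ω.1 x
    - θ.τ / 2 * nsq x - θ.d / (4 * n) * nsq x ^ 2

theorem cf_sq_add (hn : n ≠ 0) (i j : Fin n) : cf n i j ^ 2 + cf n j i ^ 2 = 1 / n := by
  have h : (0 : ℝ) < n := by positivity
  unfold cf
  rcases lt_trichotomy i j with h1 | h1 | h1
  · simp [h1, h1.not_gt, h1.ne']
  · subst h1
    simp only [lt_irrefl, if_false, if_true, div_pow, one_pow]
    rw [Real.sq_sqrt (by positivity)]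
    field_simp
    norm_num
  · simp [h1, h1.not_gt, h1.ne']

theorem sum_cf_sq (hn : n ≠ 0) (u : Fin n → ℝ) :
    ∑ p : Fin n × Fin n, cf n p.1 p.2 ^ 2 * (u p.1 * u p.2) = (∑ i, u i) ^ 2 / (2 * n) := by
  rw [Fintype.sum_prod_type]
  dsimp only
  have h1 : ∑ i, ∑ j, cf n i j ^ 2 * (u i * u j) = ∑ i, ∑ j, cf n j i ^ 2 * (u i * u j) := by
    rw [Finset.sum_comm]
    exact Finset.sum_congr rfl fun i _ => Finset.sum_congr rfl fun j _ => by ring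
  have h2 : ∑ i, ∑ j, cf n i j ^ 2 * (u i * u j) + ∑ i, ∑ j, cf n j i ^ 2 * (u i * u j) =
      (∑ i, u i) ^ 2 / n := by
    rw [pow_two, Finset.sum_mul_sum, Finset.sum_div, ← Finset.sum_add_distrib]
    refine Finset.sum_congr rfl fun i _ => ?_
    rw [Finset.sum_div, ← Finset.sum_add_distrib]
    refine Finset.sum_congr rfl fun j _ => ?_
    rw [← add_mul, cf_sq_add hn]; ring
  have h3 : (0 : ℝ) < n := by positivity
  rw [← h1, eq_div_iff h3.ne'] at h2
  rw [eq_div_iff (by positivity)]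
  linarith

/-- Covariance of the matrix noise. -/
theorem sum_kernel (hn : n ≠ 0) (x y : Vec n) :
    ∑ p : Fin n × Fin n, (cf n p.1 p.2 * x p.1 * x p.2) * (cf n p.1 p.2 * y p.1 * y p.2) =
      ip x y ^ 2 / (2 * n) := by
  rw [ip, ← sum_cf_sq hn]
  exact Finset.sum_congr rfl fun p _ => by ring

theorem xw_sq_le (hn : n ≠ 0) (J : Ix n → ℝ) (x : Vec n) :
    xw J x ^ 2 ≤ nsq J * (nsq x ^ 2 / (2 * n)) := by
  have h := Finset.sum_mul_sq_le_sq_mul_sq (Finset.univ : Finset (Fin n × Fin n))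
    (fun p => J (Sum.inl p)) (fun p => cf n p.1 p.2 * x p.1 * x p.2)
  have h2 := sum_kernel hn x x
  simp only [← pow_two, ip_self] at h2
  rw [h2] at h
  refine h.trans ?_
  gcongr
  rw [nsq, Fintype.sum_sum_type]
  exact le_add_of_nonneg_right (Finset.sum_nonneg fun i _ => sq_nonneg _)

theorem gx_sq_le (J : Ix n → ℝ) (x : Vec n) : gx J x ^ 2 ≤ nsq J * nsq x := by
  refine (Finset.sum_mul_sq_le_sq_mul_sq (Finset.univ : Finset (Fin n)) _ _).trans ?_
  refine mul_le_mul_of_nonneg_right ?_ (nsq_nonneg x)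
  rw [nsq, Fintype.sum_sum_type]
  exact le_add_of_nonneg_left (Finset.sum_nonneg fun _ _ => sq_nonneg _)

/-- Admissible parameters for a given planted vector. -/
structure Adm (n : ℕ) (K η : ℝ) (θ : Par) (s : Vec n) : Prop where
  n0 : n ≠ 0
  η0 : 0 < η
  b : |θ.b| ≤ K
  a : |θ.a| ≤ K
  e : |θ.e| ≤ K
  f : |θ.f| ≤ K
  τ : |θ.τ| ≤ K
  d : |θ.d| ≤ K
  a0 : 0 ≤ θ.a
  d0 : 0 ≤ θ.d
  bd : θ.b ^ 2 ≤ K * θ.d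
  conf : θ.a * (nsq s / n) ≤ θ.τ - η + θ.d * K * (1 + nsq s / n)

theorem le_add_of_sq_le {x A B : ℝ} (hA : 0 ≤ A) (hB : 0 ≤ B) (h : x ^ 2 ≤ 4 * A * B) :
    x ≤ A + B := by
  nlinarith [sq_nonneg (A - B), abs_le_of_sq_le_sq' (a := x) (b := A + B)
    (by nlinarith [sq_nonneg (A - B)]) (by positivity)]

theorem pot_le (K η : ℝ) (n : ℕ) : ∃ C, 0 ≤ C ∧ ∀ θ (ω : Om n), Adm n K η θ ω.1 →
    ∀ x, pot θ ω x + η / 8 * nsq x ≤ C * size ω ^ 2 - η / 4 * nsq x := by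
  refine ⟨|K| + n * |K| ^ 3 / 2 + 8 * K ^ 2 / |η|, by positivity, ?_⟩
  rintro θ ⟨s, J⟩ h x
  have hn0 := h.n0
  have hn : (1 : ℝ) ≤ n := by exact_mod_cast Nat.one_le_iff_ne_zero.2 h.n0
  have hη := h.η0
  have hK : 0 ≤ K := (abs_nonneg _).trans h.b
  have hd0 := h.d0
  have hdK := (abs_le.1 h.d).2
  rw [abs_of_nonneg hK, abs_of_pos hη]
  have hr := nsq_nonneg x
  have hs := nsq_nonneg s
  have hJ := nsq_nonneg J
  set r := nsq x
  set σ := nsq s / n with hσ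
  have hσ0 : 0 ≤ σ := by positivity
  have hσs : σ ≤ nsq s := div_le_self hs hn
  have h1 : θ.b * xw J x ≤ θ.d * r ^ 2 / (8 * n) + K * nsq J := by
    refine le_add_of_sq_le (by positivity) (by positivity) ?_
    calc (θ.b * xw J x) ^ 2 = θ.b ^ 2 * xw J x ^ 2 := by ring
      _ ≤ (K * θ.d) * (nsq J * (r ^ 2 / (2 * n))) := by
        gcongr
        · exact h.bd
        · exact xw_sq_le h.n0 J x
      _ = _ := by field_simp; ring
  have h2 : θ.d * K * (1 + σ) * r / 2 ≤
      θ.d * r ^ 2 / (8 * n) + θ.d * (K ^ 2 * (1 + σ) ^ 2 * n / 2) := by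
    refine le_add_of_sq_le (by positivity) (by positivity) (le_of_eq ?_)
    field_simp; ring
  have h2' : θ.d * (K ^ 2 * (1 + σ) ^ 2 * n / 2) ≤ K * (K ^ 2 * (1 + nsq s) ^ 2 * n / 2) := by
    gcongr
  have h3 : θ.e * gx J x ≤ η / 16 * r + 4 * K ^ 2 / η * nsq J := by
    refine le_add_of_sq_le (by positivity) (by positivity) ?_
    calc (θ.e * gx J x) ^ 2 = |θ.e| ^ 2 * gx J x ^ 2 := by rw [sq_abs]; ring
      _ ≤ K ^ 2 * (nsq J * r) := by
        gcongr
        · exact h.e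
        · exact gx_sq_le J x
      _ = _ := by field_simp; norm_num
  have h4 : θ.f * ip s x ≤ η / 16 * r + 4 * K ^ 2 / η * nsq s := by
    refine le_add_of_sq_le (by positivity) (by positivity) ?_
    calc (θ.f * ip s x) ^ 2 = |θ.f| ^ 2 * ip s x ^ 2 := by rw [sq_abs]; ring
      _ ≤ K ^ 2 * (nsq s * r) := by
        gcongr
        · exact h.f
        · exact ip_sq_le s x
      _ = _ := by field_simp; norm_num
  have h5 : θ.a / (2 * n) * ip s x ^ 2 ≤ (θ.τ - η + θ.d * K * (1 + σ)) * r / 2 := by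
    have ha := h.a0
    calc θ.a / (2 * n) * ip s x ^ 2 ≤ θ.a / (2 * n) * (nsq s * r) := by
          gcongr; exact ip_sq_le s x
      _ = θ.a * σ * r / 2 := by rw [hσ]; field_simp
      _ ≤ _ := by gcongr; exact h.conf
  have e1 : (1 + nsq s) ≤ size (s, J) := by
    rw [size_prod, size_eq_nsq, size_eq_nsq]
    nlinarith
  have e2 : nsq J ≤ size (s, J) := by
    rw [size_prod, size_eq_nsq, size_eq_nsq]
    nlinarith
  have hS : (1 : ℝ) ≤ size (s, J) := one_le _
  set S := size (s, J)
  have e3 : S ≤ S ^ 2 := by nlinarith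
  have e4 : (1 + nsq s) ^ 2 ≤ S ^ 2 := by gcongr
  have g1 : K * nsq J ≤ K * S ^ 2 := by gcongr; linarith
  have g2 : K * (K ^ 2 * (1 + nsq s) ^ 2 * n / 2) ≤ K * (K ^ 2 * S ^ 2 * n / 2) := by gcongr
  have g3 : 4 * K ^ 2 / η * nsq J ≤ 4 * K ^ 2 / η * S ^ 2 := by gcongr; linarith
  have g4 : 4 * K ^ 2 / η * nsq s ≤ 4 * K ^ 2 / η * S ^ 2 := by gcongr; linarith
  unfold pot
  have e5 : θ.d / (4 * n) * r ^ 2 = θ.d * r ^ 2 / (8 * n) + θ.d * r ^ 2 / (8 * n) := by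
    ring
  have e6 : (K + n * K ^ 3 / 2 + 8 * K ^ 2 / η) * S ^ 2 =
    K * S ^ 2 + K * (K ^ 2 * S ^ 2 * n / 2) + 4 * K ^ 2 / η * S ^ 2 + 4 * K ^ 2 / η * S ^ 2 := by
    ring
  change θ.b * xw J x + θ.a / (2 * n) * ip s x ^ 2 + θ.e * gx J x + θ.f * ip s x
    - θ.τ / 2 * r - θ.d / (4 * n) * r ^ 2 + η / 8 * r ≤ _
  rw [e5, e6]
  nlinarith

theorem PG.pot_joint (θ : Par) : PG (fun p : Om n × Vec n => pot θ p.1 p.2) := by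
  unfold RankOne.pot xw gx ip nsq
  fun_prop

@[fun_prop]
theorem PG.pot_vec (θ : Par) (ω : Om n) : PG (RankOne.pot θ ω) := (PG.pot_joint θ).section_right ω

theorem Adm.good {K η : ℝ} {θ : Par} {ω : Om n} (h : Adm n K η θ ω.1) : Good (pot θ ω) := by
  obtain ⟨C, hC, h'⟩ := pot_le K η n
  have := h.η0
  exact ⟨(PG.pot_vec θ ω).1, C * size ω ^ 2, η / 4, by positivity, fun x => by
    have h1 := h' θ ω h x
    have := mul_nonneg this.le (nsq_nonneg x)
    linarith⟩

end

section

variable {n : ℕ}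

theorem good_neg_nsq : Good (fun x : Vec n => -(1 / 2) * nsq x) :=
  ⟨by unfold nsq; fun_prop, 0, 1 / 2, by norm_num, fun x => by ring_nf; rfl⟩

/-- Dominating function for all potentials with bounded parameters. -/
def dom (n : ℕ) (p : Om n × Vec n) : ℝ :=
  |xw p.1.2 p.2| + 1 / (2 * n) * ip p.1.1 p.2 ^ 2 + |gx p.1.2 p.2| + |ip p.1.1 p.2| + nsq p.2
    + 1 / (4 * n) * nsq p.2 ^ 2

theorem PG.dom : PG (dom n) := by
  unfold RankOne.dom xw gx ip nsq
  fun_prop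

theorem abs_pot_sub_le {K η : ℝ} {θ : Par} {ω : Om n} (h : Adm n K η θ ω.1) (x : Vec n) :
    |pot θ ω x - -(1 / 2) * nsq x| ≤ (K + 1) * dom n (ω, x) := by
  have hr := nsq_nonneg x
  have hK : 0 ≤ K := (abs_nonneg _).trans h.b
  have key : ∀ c y : ℝ, |c| ≤ K → |c * y| ≤ K * |y| := fun c y hc => by rw [abs_mul]; gcongr
  have h1 := key _ (xw ω.2 x) h.b
  have h2 := key _ (1 / (2 * n) * ip ω.1 x ^ 2) h.a
  have h3 := key _ (gx ω.2 x) h.e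
  have h4 := key _ (ip ω.1 x) h.f
  have h5 := key _ (nsq x) h.τ
  have h6 := key _ (1 / (4 * n) * nsq x ^ 2) h.d
  have p1 : (0 : ℝ) ≤ 1 / (2 * n) * ip ω.1 x ^ 2 := by positivity
  have p2 : (0 : ℝ) ≤ 1 / (4 * n) * nsq x ^ 2 := by positivity
  rw [abs_of_nonneg p1] at h2
  rw [abs_of_nonneg p2] at h6
  rw [abs_of_nonneg hr] at h5
  have e2 : θ.a / (2 * n) * ip ω.1 x ^ 2 = θ.a * (1 / (2 * n) * ip ω.1 x ^ 2) := by ring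
  have e6 : θ.d / (4 * n) * nsq x ^ 2 = θ.d * (1 / (4 * n) * nsq x ^ 2) := by ring
  unfold dom pot
  rw [e2, e6]
  have q1 := abs_nonneg (xw ω.2 x)
  have q3 := abs_nonneg (gx ω.2 x)
  have q4 := abs_nonneg (ip ω.1 x)
  rw [abs_le] at *
  dsimp only
  have hKr : 0 ≤ K * nsq x := by positivity
  constructor <;> nlinarith

theorem abs_log_Zf_le (K η : ℝ) (n : ℕ) : ∃ C, ∃ k : ℕ, 0 ≤ C ∧ ∀ θ (ω : Om n), Adm n K η θ ω.1 →
    |Real.log (Zf (pot θ ω))| ≤ C * size ω ^ k := by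
  obtain ⟨C, hC, hle⟩ := pot_le K η n
  obtain ⟨-, D, k, hD, hdom⟩ := PG.dom (n := n)
  set I := ∫ x : Vec n, Real.exp (-(η / 4) * nsq x)
  set Z0 := Zf (fun x : Vec n => -(1 / 2) * nsq x)
  set A := av (fun x : Vec n => -(1 / 2) * nsq x) (fun x => size x ^ k)
  have hA : 0 ≤ A := av_nonneg fun x => pow_nonneg (size_pos x).le _
  refine ⟨C + |Real.log I| + |Real.log Z0| + (|K| + 1) * D * A, 2 + k, by positivity,
    fun θ ω h => ?_⟩
  have hS := one_le ω
  have hη := h.η0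
  have s1 : (1 : ℝ) ≤ size ω ^ (2 + k) := one_le_pow₀ hS
  have s2 : size ω ^ 2 ≤ size ω ^ (2 + k) := pow_le_pow_right₀ hS (by omega)
  have s3 : size ω ^ k ≤ size ω ^ (2 + k) := pow_le_pow_right₀ hS (by omega)
  have hK : 0 ≤ K := (abs_nonneg _).trans h.b
  rw [abs_of_nonneg hK]
  have hInt : Integrable (fun x : Vec n => Real.exp (-(η / 4) * nsq x)) :=
    integrable_exp_neg_nsq (by positivity)
  have hI : 0 < I := integral_exp_pos hInt
  have up : Zf (pot θ ω) ≤ Real.exp (C * size ω ^ 2) * I := by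
    unfold Zf
    rw [← integral_const_mul]
    refine integral_mono h.good.integrable_exp (hInt.const_mul _) fun x => ?_
    dsimp only
    rw [← Real.exp_add]
    gcongr
    have h1 := hle θ ω h x
    have h2 := mul_nonneg hη.le (nsq_nonneg x)
    linarith
  have up' : Real.log (Zf (pot θ ω)) ≤ C * size ω ^ 2 + Real.log I := by
    rw [← Real.log_exp (C * size ω ^ 2), ← Real.log_mul (Real.exp_pos _).ne' hI.ne']
    exact Real.log_le_log h.good.Zf_pos up
  have hd : PG (fun x => pot θ ω x - -(1 / 2) * nsq x) := by unfold nsq; fun_prop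
  have lo := log_Zf_ge good_neg_nsq h.good hd
  have lo2 : |av (fun x : Vec n => -(1 / 2) * nsq x) (fun x => pot θ ω x - -(1 / 2) * nsq x)| ≤
      (K + 1) * D * size ω ^ k * A := by
    refine (av_abs_le good_neg_nsq hd).trans ?_
    rw [← av_const_mul]
    refine av_mono good_neg_nsq (by fun_prop) (by fun_prop) fun x => ?_
    refine (abs_pot_sub_le h x).trans ?_
    have h1 := (le_abs_self _).trans (hdom (ω, x))
    rw [size_prod, mul_pow] at h1
    calc (K + 1) * dom n (ω, x) ≤ (K + 1) * (D * (size ω ^ k * size x ^ k)) := by gcongr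
      _ = _ := by ring
  have f1 : C * size ω ^ 2 ≤ C * size ω ^ (2 + k) := by gcongr
  have f2 : |Real.log I| ≤ |Real.log I| * size ω ^ (2 + k) :=
    le_mul_of_one_le_right (abs_nonneg _) s1
  have f3 : |Real.log Z0| ≤ |Real.log Z0| * size ω ^ (2 + k) :=
    le_mul_of_one_le_right (abs_nonneg _) s1
  have f4 : (K + 1) * D * size ω ^ k * A ≤ (K + 1) * D * size ω ^ (2 + k) * A := by gcongr
  have f5 : 0 ≤ (K + 1) * D * size ω ^ (2 + k) * A := by
    have := size_pos ω
    positivity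
  have f6 : 0 ≤ C * size ω ^ (2 + k) := by
    have := size_pos ω
    positivity
  have g1 := abs_le.1 lo2
  have g2 := abs_le.1 (le_refl |Real.log I|)
  have g3 := abs_le.1 (le_refl |Real.log Z0|)
  rw [abs_le]
  constructor <;> nlinarith

theorem pow_le_exp_split (m : ℕ) {z L : ℝ} (hz : 0 ≤ z) (hL : 0 ≤ L) :
    z ^ m ≤ (2 * L) ^ m + m.factorial * 2 ^ m * Real.exp (z - L) := by
  rcases le_total z (2 * L) with h | h
  · have h1 : z ^ m ≤ (2 * L) ^ m := by gcongr
    have h2 : 0 ≤ m.factorial * 2 ^ m * Real.exp (z - L) := by positivity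
    linarith
  · have h1 := Real.pow_div_factorial_le_exp (z / 2) (by positivity) m
    rw [div_le_iff₀ (by positivity), div_pow, div_le_iff₀ (by positivity)] at h1
    have h2 : Real.exp (z / 2) ≤ Real.exp (z - L) := by gcongr; linarith
    have h3 : 0 ≤ (2 * L) ^ m := by positivity
    have h4 : Real.exp (z / 2) * m.factorial * 2 ^ m ≤ Real.exp (z - L) * m.factorial * 2 ^ m := by
      gcongr
    linarith

theorem av_size_pow_le (K η : ℝ) (n m : ℕ) : ∃ C, ∃ k : ℕ, 0 ≤ C ∧ ∀ θ (ω : Om n),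
    Adm n K η θ ω.1 → av (pot θ ω) (fun x => size x ^ m) ≤ C * size ω ^ k := by
  obtain ⟨C, hC, hle⟩ := pot_le K η n
  obtain ⟨D, k, hD, hlog⟩ := abs_log_Zf_le K η n
  set I := ∫ x : Vec n, Real.exp (-(η / 4) * nsq x)
  set B := C + |Real.log I| + D + η / 8 with hB
  refine ⟨(8 / |η|) ^ m * ((2 * |B|) ^ m + m.factorial * 2 ^ m), (2 + k) * m, by positivity,
    fun θ ω h => ?_⟩
  have hη := h.η0
  rw [abs_of_pos hη]
  have hS := one_le ω
  have hS0 := size_pos ω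
  have s1 : (1 : ℝ) ≤ size ω ^ (2 + k) := one_le_pow₀ hS
  have s2 : size ω ^ 2 ≤ size ω ^ (2 + k) := pow_le_pow_right₀ hS (by omega)
  have s3 : size ω ^ k ≤ size ω ^ (2 + k) := pow_le_pow_right₀ hS (by omega)
  have hB0 : 0 ≤ B := by positivity
  rw [abs_of_nonneg hB0]
  set L := B * size ω ^ (2 + k) with hL
  have hL0 : 0 ≤ L := by positivity
  have hInt : Integrable (fun x : Vec n => Real.exp (-(η / 4) * nsq x)) :=
    integrable_exp_neg_nsq (by positivity)
  have hI : 0 < I := integral_exp_pos hInt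
  have hZ := h.good.Zf_pos
  have hlogZ := (abs_le.1 (hlog θ ω h)).1
  have hexp : Real.exp (C * size ω ^ 2 + η / 8 - L) * I ≤ Zf (pot θ ω) := by
    rw [← Real.exp_log hZ, ← Real.exp_log hI, ← Real.exp_add]
    gcongr
    have f1 : C * size ω ^ 2 ≤ C * size ω ^ (2 + k) := by gcongr
    have f2 : Real.log I ≤ |Real.log I| * size ω ^ (2 + k) :=
      (le_abs_self _).trans (le_mul_of_one_le_right (abs_nonneg _) s1)
    have f3 : D * size ω ^ k ≤ D * size ω ^ (2 + k) := by gcongr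
    have f4 : η / 8 ≤ η / 8 * size ω ^ (2 + k) := le_mul_of_one_le_right (by positivity) s1
    rw [hL, hB]
    linarith
  have hpw : ∀ x : Vec n, size x ^ m * Real.exp (pot θ ω x) ≤
      (8 / η) ^ m * ((2 * L) ^ m * Real.exp (pot θ ω x) +
        m.factorial * 2 ^ m * (Real.exp (C * size ω ^ 2 + η / 8 - L) *
          Real.exp (-(η / 4) * nsq x))) := by
    intro x
    have hr := nsq_nonneg x
    have h1 := pow_le_exp_split m (z := η / 8 * size x) (L := L)
      (by have := size_pos x; positivity) hL0
    have h2 : size x ^ m = (8 / η) ^ m * (η / 8 * size x) ^ m := by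
      rw [← mul_pow]; congr 1; field_simp
    rw [h2, mul_assoc]
    gcongr
    calc (η / 8 * size x) ^ m * Real.exp (pot θ ω x)
        ≤ ((2 * L) ^ m + m.factorial * 2 ^ m * Real.exp (η / 8 * size x - L)) *
          Real.exp (pot θ ω x) := by gcongr
      _ = (2 * L) ^ m * Real.exp (pot θ ω x) + m.factorial * 2 ^ m *
          Real.exp (η / 8 * size x - L + pot θ ω x) := by rw [Real.exp_add]; ring
      _ ≤ _ := by
        rw [← Real.exp_add]
        gcongr (2 * L) ^ m * _ + _ * Real.exp ?_
        have := hle θ ω h x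
        rw [size_eq_nsq]
        linarith
  have hgood := h.good
  have hav : av (pot θ ω) (fun x => size x ^ m) ≤
      (8 / η) ^ m * ((2 * L) ^ m + m.factorial * 2 ^ m) := by
    unfold av
    rw [div_le_iff₀ hZ]
    refine (integral_mono (hgood.integrable_mul (by fun_prop))
      (((hgood.integrable_exp.const_mul _).add ((hInt.const_mul _).const_mul _)).const_mul _)
      hpw).trans ?_
    simp only [integral_const_mul]
    rw [integral_add' (hgood.integrable_exp.const_mul _) ((hInt.const_mul _).const_mul _)]
    simp only [integral_const_mul]
    rw [mul_assoc ((8 / η) ^ m), add_mul ((2 * L) ^ m)]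
    have hc : (0 : ℝ) ≤ (8 / η) ^ m := by positivity
    have hc' : (0 : ℝ) ≤ m.factorial * 2 ^ m := by positivity
    exact mul_le_mul_of_nonneg_left
      (add_le_add le_rfl (mul_le_mul_of_nonneg_left hexp hc')) hc
  refine hav.trans ?_
  have t1 : (1 : ℝ) ≤ size ω ^ ((2 + k) * m) := one_le_pow₀ hS
  rw [mul_assoc]
  gcongr
  clear_value B
  rw [hL, add_mul]
  have e : (2 * (B * size ω ^ (2 + k))) ^ m = (2 * B) ^ m * size ω ^ ((2 + k) * m) := by
    rw [pow_mul, ← mul_pow]; ring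
  rw [e]
  exact add_le_add le_rfl (le_mul_of_one_le_right (by positivity) t1)

theorem abs_av_le (K η : ℝ) {f : Om n × Vec n → ℝ} (hf : PG f) : ∃ C, ∃ k : ℕ, 0 ≤ C ∧
    ∀ θ (ω : Om n), Adm n K η θ ω.1 → |av (pot θ ω) (fun x => f (ω, x))| ≤ C * size ω ^ k := by
  have hf' := hf
  obtain ⟨-, C, k, hC, hfle⟩ := hf
  obtain ⟨D, j, hD, h⟩ := av_size_pow_le K η n k
  refine ⟨C * D, k + j, by positivity, fun θ ω hA => ?_⟩
  have hfx : PG (fun x => f (ω, x)) := hf'.section_right ω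
  have hS := size_pos ω
  refine (av_abs_le hA.good hfx).trans ?_
  calc av (pot θ ω) (fun x => |f (ω, x)|)
      ≤ av (pot θ ω) (fun x => C * size ω ^ k * size x ^ k) := by
        refine av_mono hA.good hfx.abs (by fun_prop) fun x => ?_
        have := hfle (ω, x)
        rw [size_prod, mul_pow] at this
        linarith
    _ = C * size ω ^ k * av (pot θ ω) (fun x => size x ^ k) := av_const_mul _ _
    _ ≤ C * size ω ^ k * (D * size ω ^ j) := by gcongr; exact h θ ω hA
    _ = _ := by ring

theorem measurable_Zf (θ : Par) : Measurable (fun ω : Om n => Zf (pot θ ω)) := by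
  have h := (PG.pot_joint (n := n) θ).1
  have : StronglyMeasurable (fun p : Om n × Vec n => Real.exp (pot θ p.1 p.2)) :=
    (Real.measurable_exp.comp h).stronglyMeasurable
  exact this.integral_prod_right.measurable

theorem measurable_av (θ : Par) {f : Om n × Vec n → ℝ} (hf : Measurable f) :
    Measurable (fun ω : Om n => av (pot θ ω) (fun x => f (ω, x))) := by
  have h := (PG.pot_joint (n := n) θ).1
  have : StronglyMeasurable (fun p : Om n × Vec n => f p * Real.exp (pot θ p.1 p.2)) :=
    (hf.mul (Real.measurable_exp.comp h)).stronglyMeasurable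
  exact this.integral_prod_right.measurable.div (measurable_Zf θ)

theorem PG.av_fix {θ : Par} {K η : ℝ} {s : Vec n} (h : Adm n K η θ s) {f : Om n × Vec n → ℝ}
    (hf : PG f) : PG (fun J : Ix n → ℝ => RankOne.av (pot θ (s, J)) (fun x => f ((s, J), x))) := by
  obtain ⟨C, k, hC, h'⟩ := abs_av_le K η hf
  have hS := size_pos s
  refine ⟨(measurable_av θ hf.1).comp measurable_prodMk_left, C * size s ^ k, k, by positivity,
    fun J => (h' θ (s, J) h).trans (le_of_eq ?_)⟩
  rw [size_prod]; ring

end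

section

section
variable {ι : Type*} [Fintype ι]

/-- Standard Gaussian measure on `ι → ℝ`. -/
def gam (ι : Type*) [Fintype ι] : Measure (ι → ℝ) := Measure.pi fun _ => gaussianReal 0 1

instance : IsProbabilityMeasure (gam ι) := by unfold gam; infer_instance

/-- Normalizing constant of the standard Gaussian density. -/
def gnorm (ι : Type*) [Fintype ι] : ℝ := (√(2 * Real.pi))⁻¹ ^ Fintype.card ι

theorem gnorm_pos : 0 < gnorm ι := by unfold gnorm; positivity

theorem gnorm_mul_exp (x : ι → ℝ) :
    gnorm ι * Real.exp (-(1 / 2) * nsq x) = ∏ i, gaussianPDFReal 0 1 (x i) := by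
  simp only [gaussianPDFReal_def, Finset.prod_mul_distrib, Finset.prod_const, Finset.card_univ,
    ← Real.exp_sum, gnorm, nsq]
  congr 2
  · simp
  · rw [Finset.mul_sum]
    refine Finset.sum_congr rfl fun i _ => ?_
    simp
    ring

theorem gam_eq : gam ι = volume.withDensity
    (fun x => ENNReal.ofReal (gnorm ι * Real.exp (-(1 / 2) * nsq x))) := by
  refine (Measure.pi_eq fun s hs => ?_).symm.symm
  rw [withDensity_apply _ (MeasurableSet.univ_pi hs), volume_pi, Measure.restrict_pi_pi]
  simp only [gnorm_mul_exp]
  have hi : ∀ i, Integrable (gaussianPDFReal 0 1) (volume.restrict (s i)) := fun i =>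
    (integrable_gaussianPDFReal 0 1).restrict
  rw [← ofReal_integral_eq_lintegral_ofReal (Integrable.fintype_prod hi)
    (ae_of_all _ fun x => Finset.prod_nonneg fun i _ => gaussianPDFReal_nonneg _ _ _),
    integral_fintype_prod_eq_prod (fun _ : ι => gaussianPDFReal 0 1), ENNReal.ofReal_prod_of_nonneg
      fun i _ => integral_nonneg fun x => gaussianPDFReal_nonneg _ _ _]
  exact Finset.prod_congr rfl fun i _ =>
    (gaussianReal_apply_eq_integral 0 one_ne_zero (s i)).symm

theorem integral_gam (f : (ι → ℝ) → ℝ) :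
    ∫ x, f x ∂gam ι = gnorm ι * ∫ x, f x * Real.exp (-(1 / 2) * nsq x) := by
  rw [gam_eq, integral_withDensity_eq_integral_toReal_smul (by unfold nsq; fun_prop)
    (ae_of_all _ fun x => ENNReal.ofReal_lt_top), ← integral_const_mul]
  refine integral_congr_ae (ae_of_all _ fun x => ?_)
  have := gnorm_pos (ι := ι)
  simp only [smul_eq_mul]
  rw [ENNReal.toReal_ofReal (by positivity)]
  ring

theorem integrable_gam_iff (f : (ι → ℝ) → ℝ) :
    Integrable f (gam ι) ↔ Integrable (fun x => f x * Real.exp (-(1 / 2) * nsq x)) := by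
  have hp := gnorm_pos (ι := ι)
  rw [gam_eq, integrable_withDensity_iff_integrable_smul' (by unfold nsq; fun_prop)
    (ae_of_all _ fun x => ENNReal.ofReal_lt_top)]
  have : (fun x : ι → ℝ => (ENNReal.ofReal (gnorm ι * Real.exp (-(1 / 2) * nsq x))).toReal • f x) =
      fun x => gnorm ι * (f x * Real.exp (-(1 / 2) * nsq x)) := by
    ext x
    rw [ENNReal.toReal_ofReal (by positivity), smul_eq_mul]
    ring
  rw [this]
  exact integrable_const_mul_iff (isUnit_iff_ne_zero.2 hp.ne') _

theorem PG.integrable_gam {f : (ι → ℝ) → ℝ} (hf : PG f) : Integrable f (gam ι) :=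
  (integrable_gam_iff f).2 (hf.integrable_mul_exp (by norm_num))

theorem PG.integrable_prod {κ : Type*} [Fintype κ] {f : (ι → ℝ) × (κ → ℝ) → ℝ} (hf : PG f) :
    Integrable f ((gam ι).prod (gam κ)) := by
  obtain ⟨hm, C, k, hC, h⟩ := hf
  have h1 : PG (fun x : ι → ℝ => size x ^ k) := by fun_prop
  have h2 : PG (fun x : κ → ℝ => size x ^ k) := by fun_prop
  refine ((h1.integrable_gam.mul_prod h2.integrable_gam).const_mul C).mono' hm.aestronglyMeasurable
    (ae_of_all _ fun p => ?_)
  rw [Real.norm_eq_abs, ← mul_pow, ← size_prod]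
  exact h p

theorem nsq_add (x y : ι → ℝ) : nsq (x + y) = nsq x + 2 * ip x y + nsq y := by
  simp only [nsq, ip, Finset.mul_sum, ← Finset.sum_add_distrib, Pi.add_apply]
  exact Finset.sum_congr rfl fun i _ => by ring

theorem ip_add_right (x y z : ι → ℝ) : ip x (y + z) = ip x y + ip x z := by
  simp only [ip, ← Finset.sum_add_distrib, Pi.add_apply]
  exact Finset.sum_congr rfl fun i _ => by ring

theorem ip_smul_right (x y : ι → ℝ) (t : ℝ) : ip x (t • y) = t * ip x y := by
  simp only [ip, Finset.mul_sum, Pi.smul_apply, smul_eq_mul]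
  exact Finset.sum_congr rfl fun i _ => by ring

theorem nsq_smul (x : ι → ℝ) (t : ℝ) : nsq (t • x) = t ^ 2 * nsq x := by
  simp only [nsq, Finset.mul_sum, Pi.smul_apply, smul_eq_mul]
  exact Finset.sum_congr rfl fun i _ => by ring

theorem nsq_neg (x : ι → ℝ) : nsq (-x) = nsq x := by simp [nsq]

theorem ip_neg_right (x y : ι → ℝ) : ip x (-y) = -ip x y := by simp [ip]

theorem ip_single [DecidableEq ι] (x : ι → ℝ) (p : ι) : ip x (Pi.single p 1) = x p := by
  simp [ip, Pi.single_apply]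

theorem nsq_single [DecidableEq ι] (p : ι) : nsq (Pi.single p 1 : ι → ℝ) = 1 := by
  simp [nsq, Pi.single_apply]

/-- Gaussian integration by parts. -/
theorem stein [DecidableEq ι] (p : ι) {G G' : (ι → ℝ) → ℝ} (hG : PG G) (hG' : PG G')
    (hd : ∀ J, HasDerivAt (fun t : ℝ => G (J + t • Pi.single p 1)) (G' J) 0) :
    ∫ J, J p * G J ∂gam ι = ∫ J, G' J ∂gam ι := by
  have hn : (0 : ℝ) < 1 / 2 := by norm_num
  have key := integral_bilinear_hasLineDerivAt_right_eq_neg_left_of_integrable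
    (μ := (volume : Measure (ι → ℝ))) (f := G) (f' := G')
    (g := fun x : ι → ℝ => Real.exp (-(1 / 2) * nsq x))
    (g' := fun x : ι → ℝ => -(x p) * Real.exp (-(1 / 2) * nsq x)) (v := Pi.single p 1)
    (B := ContinuousLinearMap.mul ℝ ℝ) (hG'.integrable_mul_exp hn) ?_ (hG.integrable_mul_exp hn)
    (fun x _ => hd x) ?_
  · rw [integral_gam, integral_gam]
    congr 1
    simp only [ContinuousLinearMap.mul_apply'] at key
    rw [← neg_eq_iff_eq_neg] at key
    rw [← key, ← integral_neg]
    exact integral_congr_ae (ae_of_all _ fun x => by ring)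
  · have h : PG fun x => G x * -(x p) := by fun_prop
    refine (h.integrable_mul_exp hn).congr (ae_of_all _ fun x => ?_)
    simp only [ContinuousLinearMap.mul_apply']
    ring
  · intro x _
    have h0 : (fun t : ℝ => Real.exp (-(1 / 2) * nsq (x + t • Pi.single p 1))) =
        fun t => Real.exp (-(1 / 2) * (nsq x + 2 * (t * x p) + t ^ 2 * 1)) := by
      ext t
      rw [nsq_add, ip_smul_right, nsq_smul, ip_single, nsq_single]
    unfold HasLineDerivAt
    rw [h0]
    have h1 : HasDerivAt (fun t : ℝ => -(1 / 2) * (nsq x + 2 * (t * x p) + t ^ 2 * 1))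
        (-(1 / 2) * (2 * (1 * x p) + (2 * (0 : ℝ) ^ (2 - 1) * 1) * 1)) 0 := by
      refine HasDerivAt.const_mul _ (HasDerivAt.add (HasDerivAt.const_add _ ?_) ?_)
      · exact ((hasDerivAt_id (0 : ℝ)).mul_const (x p)).const_mul 2
      · exact ((hasDerivAt_id (0 : ℝ)).fun_pow 2).mul_const 1
    convert! h1.exp using 1
    simp
    ring

/-- Change of variables for shifted Gaussians. -/
theorem integral_gam_add (m : ι → ℝ) (Φ : (ι → ℝ) → ℝ) :
    ∫ J, Φ (J + m) ∂gam ι = ∫ J, Φ J * Real.exp (ip m J - nsq m / 2) ∂gam ι := by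
  rw [integral_gam, integral_gam]
  congr 1
  rw [← integral_add_right_eq_self (fun J => Φ J * Real.exp (ip m J - nsq m / 2) *
    Real.exp (-(1 / 2) * nsq J)) m]
  refine integral_congr_ae (ae_of_all _ fun J => ?_)
  simp only
  rw [mul_assoc, ← Real.exp_add]
  congr 2
  rw [ip_add_right, nsq_add, ip_self, ip_comm J m]
  ring

theorem integral_coord_sq (p : ι) : ∫ J, J p ^ 2 ∂gam ι = 1 := by
  classical
  have h := stein p (G := fun J => J p) (G' := fun _ => 1) (by fun_prop) (by fun_prop) fun J => by
    simpa using (hasDerivAt_id (0 : ℝ)).const_add (J p)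
  simpa [pow_two] using h

theorem integral_nsq : ∫ J, nsq J ∂gam ι = Fintype.card ι := by
  unfold nsq
  rw [integral_finsetSum]
  · simp [integral_coord_sq]
  · intro i _
    have h : PG fun J : ι → ℝ => J i ^ 2 := by fun_prop
    exact h.integrable_gam

theorem integral_nsq_sq :
    ∫ J, nsq J ^ 2 ∂gam ι = (Fintype.card ι : ℝ) ^ 2 + 2 * Fintype.card ι := by
  classical
  have hP : PG (nsq : (ι → ℝ) → ℝ) := by unfold nsq; fun_prop
  have h : ∀ p : ι, ∫ J, J p * (J p * nsq J) ∂gam ι = Fintype.card ι + 2 := by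
    intro p
    rw [stein p (G := fun J => J p * nsq J) (G' := fun J => nsq J + 2 * J p ^ 2) (by fun_prop)
      (by fun_prop)]
    · have h2 : PG fun J : ι → ℝ => 2 * J p ^ 2 := by fun_prop
      rw [integral_add hP.integrable_gam h2.integrable_gam, integral_nsq, integral_const_mul,
        integral_coord_sq, mul_one]
    · intro J
      have h0 : (fun t : ℝ => (J + t • Pi.single p 1 : ι → ℝ) p * nsq (J + t • Pi.single p 1)) =
          fun t => (J p + t) * (nsq J + 2 * (t * J p) + t ^ 2 * 1) := by
        ext t
        rw [nsq_add, ip_smul_right, nsq_smul, ip_single, nsq_single]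
        simp
      rw [h0]
      have h1 : HasDerivAt (fun t : ℝ => (nsq J + 2 * (t * J p) + t ^ 2 * 1))
          (2 * (1 * J p) + (2 * (0 : ℝ) ^ (2 - 1) * 1) * 1) 0 := by
        refine (HasDerivAt.add (HasDerivAt.const_add _ ?_) ?_)
        · exact ((hasDerivAt_id (0 : ℝ)).mul_const (J p)).const_mul 2
        · exact ((hasDerivAt_id (0 : ℝ)).fun_pow 2).mul_const 1
      convert! ((hasDerivAt_id (0 : ℝ)).const_add (J p)).mul h1 using 1
      simp
      ring
  have h2 : ∀ J : ι → ℝ, nsq J ^ 2 = ∑ p, J p * (J p * nsq J) := by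
    intro J
    rw [pow_two]
    nth_rewrite 1 [nsq]
    rw [Finset.sum_mul]
    exact Finset.sum_congr rfl fun i _ => by ring
  simp_rw [h2]
  rw [integral_finsetSum]
  · simp [h]; ring
  · intro i _
    have h : PG fun J : ι → ℝ => J i * (J i * nsq J) := by fun_prop
    exact h.integrable_gam

/-- Differentiating Gibbs averages along a linear perturbation. -/
theorem hasDerivAt_av {U k f : (ι → ℝ) → ℝ} (hU : Measurable U) (hk : PG k) (hf : PG f)
    (h : ∃ C η : ℝ, 0 < η ∧ ∀ t : ℝ, |t| ≤ 1 → ∀ x, U x + t * k x ≤ C - η * nsq x) :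
    HasDerivAt (fun t : ℝ => av (fun x => U x + t * k x) f)
      (av U (fun x => f x * k x) - av U f * av U k) 0 := by
  obtain ⟨C, η, hη, h⟩ := h
  have hgood : Good U := ⟨hU, C, η, hη, fun x => by simpa using h 0 (by simp) x⟩
  have main : ∀ {f : (ι → ℝ) → ℝ}, PG f →
      HasDerivAt (fun t : ℝ => ∫ x, f x * Real.exp (U x + t * k x))
        (∫ x, f x * k x * Real.exp (U x)) 0 := by
    intro f hf
    have hfm := hf.measurable
    have hkm := hk.measurable
    have := (hasDerivAt_integral_of_dominated_loc_of_deriv_le (μ := (volume : Measure (ι → ℝ)))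
      (F := fun t x => f x * Real.exp (U x + t * k x)) (x₀ := (0 : ℝ)) (s := Metric.ball 0 1)
      (F' := fun t x => f x * k x * Real.exp (U x + t * k x))
      (bound := fun x => |f x * k x| * Real.exp (C - η * nsq x))
      (Metric.ball_mem_nhds _ one_pos) ?_ ?_ ?_ ?_ ?_ ?_).2
    · simpa using this
    · exact Eventually.of_forall fun t => by fun_prop
    · simpa using hgood.integrable_mul hf
    · fun_prop
    · refine ae_of_all _ fun x t ht => ?_
      rw [Real.norm_eq_abs, abs_mul, Real.abs_exp]
      gcongr
      exact h t (by simpa using (Metric.mem_ball.1 ht).le) x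
    · have h1 : PG fun x => |f x * k x| := by fun_prop
      refine ((h1.integrable_mul_exp hη).const_mul (Real.exp C)).congr (ae_of_all _ fun x => ?_)
      simp only
      rw [sub_eq_add_neg, Real.exp_add, neg_mul]
      ring
    · refine ae_of_all _ fun x t _ => ?_
      have h1 : HasDerivAt (fun t : ℝ => U x + t * k x) (k x) t := by
        simpa using ((hasDerivAt_id t).mul_const (k x)).const_add (U x)
      convert! h1.exp.const_mul (f x) using 1
      ring
  have h1 := main hf
  have h2 := main (PG.const (1 : ℝ))
  simp only [one_mul] at h2
  have hZ := hgood.Zf_pos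
  have h3 := h1.div h2 (by simpa [Zf] using hZ.ne')
  unfold av Zf at *
  convert! h3 using 1
  simp only [zero_mul, add_zero]
  field_simp
end

end

section

variable {n : ℕ}

/-- Almost surely equal to a function of polynomial growth, uniformly in the noise. -/
def LPG (ν : Measure (Vec n)) (F : Om n → ℝ) : Prop :=
  ∃ G, PG G ∧ ∀ᵐ s ∂ν, ∀ J, F (s, J) = G (s, J)

/-- All moments of the planted vector are finite. -/
def Mom (ν : Measure (Vec n)) : Prop := ∀ k : ℕ, Integrable (fun s => size s ^ k) ν

/-- Disorder average. -/
def EE (ν : Measure (Vec n)) (F : Om n → ℝ) : ℝ := ∫ ω, F ω ∂ν.prod (gam (Ix n))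

/-- Almost sure admissibility. -/
def AdmA (ν : Measure (Vec n)) (K η : ℝ) (θ : Par) : Prop := ∀ᵐ s ∂ν, Adm n K η θ s

section
variable {ν : Measure (Vec n)}

theorem PG.lpg {F : Om n → ℝ} (hF : PG F) : LPG ν F := ⟨F, hF, ae_of_all _ fun _ _ => rfl⟩

theorem LPG.add {F G : Om n → ℝ} (hF : LPG ν F) (hG : LPG ν G) : LPG ν (fun ω => F ω + G ω) := by
  obtain ⟨f, hf, ef⟩ := hF
  obtain ⟨g, hg, eg⟩ := hG
  refine ⟨fun ω => f ω + g ω, hf.add hg, ?_⟩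
  filter_upwards [ef, eg] with s h1 h2 J
  rw [h1, h2]

theorem LPG.mul {F G : Om n → ℝ} (hF : LPG ν F) (hG : LPG ν G) : LPG ν (fun ω => F ω * G ω) := by
  obtain ⟨f, hf, ef⟩ := hF
  obtain ⟨g, hg, eg⟩ := hG
  refine ⟨fun ω => f ω * g ω, hf.mul hg, ?_⟩
  filter_upwards [ef, eg] with s h1 h2 J
  rw [h1, h2]

theorem LPG.const (c : ℝ) : LPG ν (fun _ => c) := (PG.const c).lpg

theorem LPG.const_mul (c : ℝ) {F : Om n → ℝ} (hF : LPG ν F) : LPG ν (fun ω => c * F ω) :=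
  (LPG.const c).mul hF

theorem LPG.neg {F : Om n → ℝ} (hF : LPG ν F) : LPG ν (fun ω => -F ω) := by
  simpa using hF.const_mul (-1)

theorem LPG.sub {F G : Om n → ℝ} (hF : LPG ν F) (hG : LPG ν G) : LPG ν (fun ω => F ω - G ω) := by
  simpa [sub_eq_add_neg] using hF.add hG.neg

theorem LPG.pow {F : Om n → ℝ} (hF : LPG ν F) (k : ℕ) : LPG ν (fun ω => F ω ^ k) := by
  induction k with
  | zero => simpa using LPG.const 1
  | succ k ih => simpa [pow_succ] using ih.mul hF

theorem LPG.sum {κ : Type*} (S : Finset κ) {F : κ → Om n → ℝ} (hF : ∀ i, LPG ν (F i)) :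
    LPG ν (fun ω => ∑ i ∈ S, F i ω) := by
  classical
  induction S using Finset.induction_on with
  | empty => simpa using LPG.const 0
  | insert i S hi ih => simpa [Finset.sum_insert hi] using (hF i).add ih

theorem LPG.of_bound {F : Om n → ℝ} (hm : Measurable F) {C : ℝ} {k : ℕ} (hC : 0 ≤ C)
    (h : ∀ᵐ s ∂ν, ∀ J, |F (s, J)| ≤ C * size (s, J) ^ k) : LPG ν F := by
  refine ⟨fun ω => max (min (F ω) (C * size ω ^ k)) (-(C * size ω ^ k)), ?_, ?_⟩
  · have hs : Measurable fun ω : Om n => C * size ω ^ k :=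
      ((HasSize.meas (α := Om n)).pow_const k).const_mul C
    refine ⟨(hm.min hs).max hs.neg, C, k, hC, fun ω => ?_⟩
    have h0 : 0 ≤ C * size ω ^ k := by have := size_pos ω; positivity
    rw [abs_le]
    exact ⟨le_max_right _ _, max_le (min_le_right _ _) (by linarith)⟩
  · filter_upwards [h] with s h J
    have := abs_le.1 (h J)
    rw [min_eq_left this.2, max_eq_left this.1]

theorem EE_const_mul (c : ℝ) (F : Om n → ℝ) : EE ν (fun ω => c * F ω) = c * EE ν F :=
  integral_const_mul _ _

theorem AdmA.lpg_av {θ : Par} {K η : ℝ} (h : AdmA ν K η θ) {f : Om n × Vec n → ℝ} (hf : PG f) :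
    LPG ν (fun ω => av (pot θ ω) (fun x => f (ω, x))) := by
  obtain ⟨C, k, hC, h'⟩ := abs_av_le K η hf
  refine LPG.of_bound (measurable_av θ hf.1) hC (k := k) ?_
  filter_upwards [h] with s hs J using h' θ (s, J) hs

theorem AdmA.lpg_log {θ : Par} {K η : ℝ} (h : AdmA ν K η θ) :
    LPG ν (fun ω => Real.log (Zf (pot θ ω))) := by
  obtain ⟨C, k, hC, h'⟩ := abs_log_Zf_le K η n
  refine LPG.of_bound (measurable_Zf θ).log hC (k := k) ?_
  filter_upwards [h] with s hs J using h' θ (s, J) hs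

theorem ae_prod_of_ae [SFinite ν] {p : Om n → Prop} (h : ∀ᵐ s ∂ν, ∀ J, p (s, J)) :
    ∀ᵐ ω ∂ν.prod (gam (Ix n)), p ω := by
  have h1 := (Measure.quasiMeasurePreserving_fst (μ := ν) (ν := gam (Ix n))).ae h
  filter_upwards [h1] with ω hω using hω ω.2

variable [IsProbabilityMeasure ν]

theorem LPG.integrable (hν : Mom ν) {F : Om n → ℝ} (hF : LPG ν F) :
    Integrable F (ν.prod (gam (Ix n))) := by
  obtain ⟨f, ⟨hm, C, k, hC, h⟩, ef⟩ := hF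
  have h2 : PG (fun x : Ix n → ℝ => size x ^ k) := by fun_prop
  have hi : Integrable f (ν.prod (gam (Ix n))) := by
    refine (((hν k).mul_prod h2.integrable_gam).const_mul C).mono' hm.aestronglyMeasurable
      (ae_of_all _ fun p => ?_)
    rw [Real.norm_eq_abs, ← mul_pow, ← size_prod]
    exact h p
  refine hi.congr ?_
  filter_upwards [ae_prod_of_ae (p := fun ω => F ω = f ω) ef] with ω hω using hω.symm

theorem EE_add (hν : Mom ν) {F G : Om n → ℝ} (hF : LPG ν F) (hG : LPG ν G) :
    EE ν (fun ω => F ω + G ω) = EE ν F + EE ν G :=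
      integral_add (hF.integrable hν) (hG.integrable hν)

theorem EE_sub (hν : Mom ν) {F G : Om n → ℝ} (hF : LPG ν F) (hG : LPG ν G) :
    EE ν (fun ω => F ω - G ω) = EE ν F - EE ν G :=
      integral_sub (hF.integrable hν) (hG.integrable hν)

theorem EE_const (c : ℝ) : EE ν (fun _ => c) = c := by simp [EE]

theorem EE_sum (hν : Mom ν) {κ : Type*} (S : Finset κ) {F : κ → Om n → ℝ}
    (hF : ∀ i, LPG ν (F i)) : EE ν (fun ω => ∑ i ∈ S, F i ω) = ∑ i ∈ S, EE ν (F i) :=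
  integral_finsetSum _ fun i _ => (hF i).integrable hν

theorem EE_mono (hν : Mom ν) {F G : Om n → ℝ} (hF : LPG ν F) (hG : LPG ν G)
    (h : ∀ᵐ s ∂ν, ∀ J, F (s, J) ≤ G (s, J)) : EE ν F ≤ EE ν G :=
  integral_mono_ae (hF.integrable hν) (hG.integrable hν)
    (ae_prod_of_ae (p := fun ω => F ω ≤ G ω) h)

theorem EE_congr {F G : Om n → ℝ} (h : ∀ᵐ s ∂ν, ∀ J, F (s, J) = G (s, J)) : EE ν F = EE ν G :=
  integral_congr_ae (ae_prod_of_ae (p := fun ω => F ω = G ω) h)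

theorem EE_nonneg {F : Om n → ℝ} (h : ∀ᵐ s ∂ν, ∀ J, 0 ≤ F (s, J)) : 0 ≤ EE ν F :=
  integral_nonneg_of_ae (ae_prod_of_ae (p := fun ω => 0 ≤ F ω) h)

/-- Bounds on averages that are uniform over admissible parameters. -/
theorem EE_av_bound (hν : Mom ν) (K η : ℝ) {f : Om n × Vec n → ℝ} (hf : PG f) :
    ∃ C, ∀ θ, AdmA ν K η θ → |EE ν (fun ω => av (pot θ ω) (fun x => f (ω, x)))| ≤ C := by
  obtain ⟨C, k, hC, h'⟩ := abs_av_le K η hf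
  have hp : LPG ν (fun ω : Om n => C * size ω ^ k) := PG.lpg (by fun_prop)
  refine ⟨EE ν (fun ω : Om n => C * size ω ^ k), fun θ h => ?_⟩
  rw [abs_le, ← neg_one_mul, ← EE_const_mul]
  constructor
  · refine EE_mono hν (hp.const_mul _) (h.lpg_av hf) ?_
    filter_upwards [h] with s hs J
    have := (abs_le.1 (h' θ (s, J) hs)).1
    linarith
  · refine EE_mono hν (h.lpg_av hf) hp ?_
    filter_upwards [h] with s hs J using (abs_le.1 (h' θ (s, J) hs)).2

end

/-- Coefficient vector of the noise in the potential. -/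
def kv (θ : Par) (x : Vec n) : Ix n → ℝ :=
  Sum.elim (fun p => θ.b * (cf n p.1 p.2 * x p.1 * x p.2)) (fun i => θ.e * x i)

/-- Noise-free part of the potential. -/
def rest (θ : Par) (s x : Vec n) : ℝ :=
  θ.a / (2 * n) * ip s x ^ 2 + θ.f * ip s x - θ.τ / 2 * nsq x - θ.d / (4 * n) * nsq x ^ 2

theorem ip_kv (θ : Par) (J : Ix n → ℝ) (x : Vec n) :
    ip J (kv θ x) = θ.b * xw J x + θ.e * gx J x := by
  simp only [ip, kv, Fintype.sum_sum_type, Sum.elim_inl, Sum.elim_inr, xw, gx, Finset.mul_sum]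
  congr 1 <;> exact Finset.sum_congr rfl fun i _ => by ring

theorem pot_eq (θ : Par) (s : Vec n) (J : Ix n → ℝ) (x : Vec n) :
    pot θ (s, J) x = ip J (kv θ x) + rest θ s x := by
  rw [ip_kv, pot, rest]; ring

theorem PG.kv (θ : Par) (p : Ix n) : PG (fun x : Vec n => kv θ x p) := by
  rcases p with p | i <;> simp only [RankOne.kv, Sum.elim_inl, Sum.elim_inr] <;> fun_prop

theorem pot_shift (θ : Par) (s : Vec n) (J : Ix n → ℝ) (p : Ix n) (t : ℝ) (x : Vec n) :
    pot θ (s, J + t • Pi.single p 1) x = pot θ (s, J) x + t * kv θ x p := by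
  rw [pot_eq, pot_eq, ip_comm, ip_add_right, ip_smul_right, ip_single, ip_comm]
  ring

theorem stein_av {θ : Par} {K η : ℝ} {s : Vec n} (h : Adm n K η θ s) (p : Ix n)
    {f : Vec n → ℝ} (hf : PG f) :
    ∫ J, J p * av (pot θ (s, J)) f ∂gam (Ix n) =
      ∫ J, (av (pot θ (s, J)) (fun x => f x * kv θ x p) -
        av (pot θ (s, J)) f * av (pot θ (s, J)) (fun x => kv θ x p)) ∂gam (Ix n) := by
  have hk := PG.kv (n := n) θ p
  have c1 := PG.av_fix h (f := fun q : Om n × Vec n => f q.2) hf.snd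
  have c2 := PG.av_fix h (f := fun q : Om n × Vec n => f q.2 * kv θ q.2 p) (hf.snd.mul hk.snd)
  have c3 := PG.av_fix h (f := fun q : Om n × Vec n => kv θ q.2 p) hk.snd
  refine stein p c1 (c2.sub (c1.mul c3)) fun J => ?_
  simp only [funext (pot_shift θ s J p _)]
  refine hasDerivAt_av ?_ hk hf ?_
  · exact (PG.pot_vec θ (s, J)).measurable
  · obtain ⟨C, hC, hle⟩ := pot_le K η n
    have hη := h.η0
    refine ⟨C * (size s * (3 + 2 * nsq J)) ^ 2, η / 4, by linarith, fun t ht x => ?_⟩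
    rw [← pot_shift]
    have h1 := hle θ (s, J + t • Pi.single p 1) h x
    have h2 : size (s, J + t • (Pi.single p 1 : Ix n → ℝ)) ≤ size s * (3 + 2 * nsq J) := by
      rw [size_prod]
      have := size_pos s
      gcongr
      rw [size_eq_nsq, nsq_add, ip_smul_right, nsq_smul, ip_single, nsq_single]
      have h3 : J p ^ 2 ≤ nsq J :=
        Finset.single_le_sum (f := fun i => J i ^ 2) (fun i _ => sq_nonneg _) (Finset.mem_univ p)
      have h4 : t ^ 2 ≤ 1 := by rw [sq_le_one_iff_abs_le_one]; exact ht
      nlinarith [sq_nonneg (t - J p)]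
    have h5 : size (s, J + t • (Pi.single p 1 : Ix n → ℝ)) ^ 2 ≤
        (size s * (3 + 2 * nsq J)) ^ 2 := by
      have := size_pos (s, J + t • (Pi.single p 1 : Ix n → ℝ))
      gcongr
    have h6 := nsq_nonneg x
    have h7 := mul_le_mul_of_nonneg_left h5 hC
    nlinarith

/-- Second-order self-overlap. -/
def aQ4 (θ : Par) (ω : Om n) : ℝ := av (pot θ ω) (fun x => nsq x ^ 2)
/-- Self-overlap. -/
def aQ2 (θ : Par) (ω : Om n) : ℝ := av (pot θ ω) (fun x => nsq x)
/-- Squared overlap of two replicas. -/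
def aR2 (θ : Par) (ω : Om n) : ℝ := ∑ i, ∑ j, av (pot θ ω) (fun x => x i * x j) ^ 2
/-- Overlap of two replicas. -/
def aR1 (θ : Par) (ω : Om n) : ℝ := ∑ i, av (pot θ ω) (fun x => x i) ^ 2
/-- Squared overlap with the planted vector. -/
def aS2 (θ : Par) (ω : Om n) : ℝ := av (pot θ ω) (fun x => ip ω.1 x ^ 2)
/-- Overlap with the planted vector. -/
def aS1 (θ : Par) (ω : Om n) : ℝ := av (pot θ ω) (fun x => ip ω.1 x)

section
variable {ν : Measure (Vec n)} {θ : Par} {K η : ℝ}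

theorem AdmA.lpg_av' (h : AdmA ν K η θ) {f : Vec n → ℝ} (hf : PG f) :
    LPG ν (fun ω => av (pot θ ω) f) := h.lpg_av (f := fun q => f q.2) hf.snd

theorem AdmA.lpg_Q4 (h : AdmA ν K η θ) : LPG ν (aQ4 θ) := h.lpg_av' (by unfold nsq; fun_prop)

theorem AdmA.lpg_Q2 (h : AdmA ν K η θ) : LPG ν (aQ2 θ) := h.lpg_av' (by unfold nsq; fun_prop)

theorem AdmA.lpg_R2 (h : AdmA ν K η θ) : LPG ν (aR2 θ) :=
  LPG.sum _ fun i => LPG.sum _ fun j => LPG.pow (h.lpg_av' (by fun_prop)) 2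

theorem AdmA.lpg_R1 (h : AdmA ν K η θ) : LPG ν (aR1 θ) :=
  LPG.sum _ fun i => LPG.pow (h.lpg_av' (by fun_prop)) 2

theorem AdmA.lpg_S2 (h : AdmA ν K η θ) : LPG ν (aS2 θ) :=
  h.lpg_av (f := fun q => ip q.1.1 q.2 ^ 2) (by unfold ip; fun_prop)

theorem AdmA.lpg_S1 (h : AdmA ν K η θ) : LPG ν (aS1 θ) :=
  h.lpg_av (f := fun q => ip q.1.1 q.2) (by unfold ip; fun_prop)

variable [IsProbabilityMeasure ν]

theorem EE_stein (hν : Mom ν) (h : AdmA ν K η θ) (p : Ix n) {f : Vec n → ℝ} (hf : PG f) :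
    EE ν (fun ω => ω.2 p * av (pot θ ω) f) =
      EE ν (fun ω => av (pot θ ω) (fun x => f x * kv θ x p) -
        av (pot θ ω) f * av (pot θ ω) (fun x => kv θ x p)) := by
  have hk := PG.kv (n := n) θ p
  have l1 : LPG ν (fun ω : Om n => ω.2 p * av (pot θ ω) f) :=
    (PG.lpg (by fun_prop)).mul (h.lpg_av' hf)
  have l2 := (h.lpg_av' (hf.mul hk)).sub ((h.lpg_av' hf).mul (h.lpg_av' hk))
  unfold EE
  rw [integral_prod _ (l1.integrable hν), integral_prod _ (l2.integrable hν)]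
  refine integral_congr_ae ?_
  filter_upwards [h] with s hs using stein_av hs p hf

theorem sum_cf_symm (hn : n ≠ 0) (T : Fin n → Fin n → ℝ) (hT : ∀ i j, T i j = T j i) :
    ∑ p : Fin n × Fin n, cf n p.1 p.2 ^ 2 * T p.1 p.2 = (∑ i, ∑ j, T i j) / (2 * n) := by
  rw [Fintype.sum_prod_type]
  dsimp only
  have h1 : ∑ i, ∑ j, cf n i j ^ 2 * T i j = ∑ i, ∑ j, cf n j i ^ 2 * T i j := by
    rw [Finset.sum_comm]
    exact Finset.sum_congr rfl fun i _ => Finset.sum_congr rfl fun j _ => by rw [hT j i]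
  have h2 : ∑ i, ∑ j, cf n i j ^ 2 * T i j + ∑ i, ∑ j, cf n j i ^ 2 * T i j =
      (∑ i, ∑ j, T i j) / n := by
    rw [Finset.sum_div, ← Finset.sum_add_distrib]
    refine Finset.sum_congr rfl fun i _ => ?_
    rw [Finset.sum_div, ← Finset.sum_add_distrib]
    refine Finset.sum_congr rfl fun j _ => ?_
    rw [← add_mul, cf_sq_add hn]; ring
  have h3 : (0 : ℝ) < n := by positivity
  rw [← h1, eq_div_iff h3.ne'] at h2
  rw [eq_div_iff (by positivity)]
  linarith

theorem EE_xw (hν : Mom ν) (hn : n ≠ 0) (h : AdmA ν K η θ) :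
    EE ν (fun ω => av (pot θ ω) (fun x => xw ω.2 x)) =
      θ.b / (2 * n) * (EE ν (aQ4 θ) - EE ν (aR2 θ)) := by
  have hc : ∀ p : Fin n × Fin n, PG fun x : Vec n => cf n p.1 p.2 * x p.1 * x p.2 := by
    intro p; fun_prop
  have e1 : ∀ᵐ s ∂ν, ∀ J : Ix n → ℝ, av (pot θ (s, J)) (fun x => xw (s, J).2 x) =
      ∑ p : Fin n × Fin n, (s, J).2 (Sum.inl p) *
        av (pot θ (s, J)) (fun x => cf n p.1 p.2 * x p.1 * x p.2) := by
    filter_upwards [h] with s hs J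
    unfold xw
    have hg : Good (pot θ (s, J)) := Adm.good (h := hs)
    rw [av_sum hg _ fun p => (by fun_prop)]
    exact Finset.sum_congr rfl fun p _ => av_const_mul _ _
  rw [EE_congr (G := fun ω => ∑ p : Fin n × Fin n, ω.2 (Sum.inl p) *
        av (pot θ ω) (fun x => cf n p.1 p.2 * x p.1 * x p.2)) e1,
    EE_sum hν _ fun p => (PG.lpg (by fun_prop)).mul (h.lpg_av' (hc p)),
    Finset.sum_congr rfl fun p _ => EE_stein hν h (Sum.inl p) (hc p), ← EE_sum hν _ fun p =>
      (h.lpg_av' ((hc p).mul (PG.kv θ (Sum.inl p)))).sub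
        ((h.lpg_av' (hc p)).mul (h.lpg_av' (PG.kv θ (Sum.inl p)))),
    ← EE_sub hν h.lpg_Q4 h.lpg_R2, ← EE_const_mul]
  refine EE_congr ?_
  filter_upwards [h] with s hs J
  have hg : Good (pot θ (s, J)) := Adm.good (h := hs)
  rw [Finset.sum_sub_distrib, mul_sub]
  congr 1
  · rw [← av_sum hg _ fun p => (hc p).mul (PG.kv θ (Sum.inl p)), aQ4, ← av_const_mul]
    congr 1
    ext x
    have := sum_kernel hn x x
    rw [ip_self] at this
    simp only [kv, Sum.elim_inl]
    calc _ = θ.b * ∑ p : Fin n × Fin n, (cf n p.1 p.2 * x p.1 * x p.2) *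
          (cf n p.1 p.2 * x p.1 * x p.2) := by
            rw [Finset.mul_sum]; exact Finset.sum_congr rfl fun p _ => by ring
      _ = _ := by rw [this]; ring
  · have e2 : ∀ p : Fin n × Fin n, av (pot θ (s, J)) (fun x => cf n p.1 p.2 * x p.1 * x p.2) *
        av (pot θ (s, J)) (fun x => kv θ x (Sum.inl p)) =
        θ.b * (cf n p.1 p.2 ^ 2 * av (pot θ (s, J)) (fun x => x p.1 * x p.2) ^ 2) := by
      intro p
      have : (fun x : Vec n => cf n p.1 p.2 * x p.1 * x p.2) =
        fun x => cf n p.1 p.2 * (x p.1 * x p.2) := by ext x; ring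
      simp only [kv, Sum.elim_inl]
      rw [av_const_mul, this, av_const_mul]
      ring
    rw [Finset.sum_congr rfl fun p _ => e2 p, ← Finset.mul_sum,
      sum_cf_symm hn fun i j => av (pot θ (s, J)) (fun x => x i * x j) ^ 2]
    · rw [aR2]; ring
    · intro i j; simp only [mul_comm]

theorem EE_gx (hν : Mom ν) (h : AdmA ν K η θ) :
    EE ν (fun ω => av (pot θ ω) (fun x => gx ω.2 x)) =
      θ.e * (EE ν (aQ2 θ) - EE ν (aR1 θ)) := by
  have hc : ∀ i : Fin n, PG fun x : Vec n => x i := by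
    intro p; fun_prop
  have e1 : ∀ᵐ s ∂ν, ∀ J : Ix n → ℝ, av (pot θ (s, J)) (fun x => gx (s, J).2 x) =
      ∑ i : Fin n, (s, J).2 (Sum.inr i) * av (pot θ (s, J)) (fun x => x i) := by
    filter_upwards [h] with s hs J
    unfold gx
    have hg : Good (pot θ (s, J)) := Adm.good (h := hs)
    rw [av_sum hg _ fun p => (by fun_prop)]
    exact Finset.sum_congr rfl fun p _ => av_const_mul _ _
  rw [EE_congr (G := fun ω => ∑ i : Fin n, ω.2 (Sum.inr i) * av (pot θ ω) (fun x => x i)) e1,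
    EE_sum hν _ fun p => (PG.lpg (by fun_prop)).mul (h.lpg_av' (hc p)),
    Finset.sum_congr rfl fun p _ => EE_stein hν h (Sum.inr p) (hc p), ← EE_sum hν _ fun p =>
      (h.lpg_av' ((hc p).mul (PG.kv θ (Sum.inr p)))).sub
        ((h.lpg_av' (hc p)).mul (h.lpg_av' (PG.kv θ (Sum.inr p)))),
    ← EE_sub hν h.lpg_Q2 h.lpg_R1, ← EE_const_mul]
  refine EE_congr ?_
  filter_upwards [h] with s hs J
  have hg : Good (pot θ (s, J)) := Adm.good (h := hs)
  rw [Finset.sum_sub_distrib, mul_sub]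
  congr 1
  · rw [← av_sum hg _ fun p => (hc p).mul (PG.kv θ (Sum.inr p)), aQ2, ← av_const_mul]
    congr 1
    ext x
    simp only [kv, Sum.elim_inr, nsq, Finset.mul_sum]
    exact Finset.sum_congr rfl fun i _ => by ring
  · rw [aR1, Finset.mul_sum]
    refine Finset.sum_congr rfl fun i _ => ?_
    simp only [kv, Sum.elim_inr]
    rw [av_const_mul]
    ring

/-- Convexity inequality for the averaged log-partition function. -/
theorem EL_increment_le (hν : Mom ν) (hn : n ≠ 0) {θ' : Par} {K' η' : ℝ} (h : AdmA ν K η θ)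
    (h' : AdmA ν K' η' θ') :
    EE ν (fun ω => Real.log (Zf (pot θ ω)))
      + (θ'.b - θ.b) * (θ.b / (2 * n) * (EE ν (aQ4 θ) - EE ν (aR2 θ)))
      + (θ'.e - θ.e) * (θ.e * (EE ν (aQ2 θ) - EE ν (aR1 θ)))
      + (θ'.a - θ.a) / (2 * n) * EE ν (aS2 θ) + (θ'.f - θ.f) * EE ν (aS1 θ)
      - (θ'.τ - θ.τ) / 2 * EE ν (aQ2 θ) - (θ'.d - θ.d) / (4 * n) * EE ν (aQ4 θ)
      ≤ EE ν (fun ω => Real.log (Zf (pot θ' ω))) := by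
  have lx : LPG ν (fun ω => av (pot θ ω) (fun x => xw ω.2 x)) :=
    h.lpg_av (f := fun q => xw q.1.2 q.2) (by unfold xw; fun_prop)
  have lg : LPG ν (fun ω => av (pot θ ω) (fun x => gx ω.2 x)) :=
    h.lpg_av (f := fun q => gx q.1.2 q.2) (by unfold gx; fun_prop)
  have l4 := h.lpg_Q4
  have l2 := h.lpg_Q2
  have lS2 := h.lpg_S2
  have lS1 := h.lpg_S1
  have m1 := h.lpg_log.add (lx.const_mul (θ'.b - θ.b))
  have m2 := m1.add (lg.const_mul (θ'.e - θ.e))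
  have m3 := m2.add (lS2.const_mul ((θ'.a - θ.a) / (2 * n)))
  have m4 := m3.add (lS1.const_mul (θ'.f - θ.f))
  have m5 := m4.sub (l2.const_mul ((θ'.τ - θ.τ) / 2))
  have m6 := m5.sub (l4.const_mul ((θ'.d - θ.d) / (4 * n)))
  rw [← EE_xw hν hn h, ← EE_gx hν h]
  simp only [← EE_const_mul]
  rw [← EE_add hν h.lpg_log (lx.const_mul _), ← EE_add hν m1 (lg.const_mul _),
    ← EE_add hν m2 (lS2.const_mul _), ← EE_add hν m3 (lS1.const_mul _),
    ← EE_sub hν m4 (l2.const_mul _), ← EE_sub hν m5 (l4.const_mul _)]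
  refine EE_mono hν m6 h'.lpg_log ?_
  filter_upwards [h, h'] with s hs hs' J
  have hg : Good (pot θ (s, J)) := Adm.good (h := hs)
  have hg' : Good (pot θ' (s, J)) := Adm.good (h := hs')
  have px : PG (fun x : Vec n => xw J x) := by unfold xw; fun_prop
  have pg : PG (fun x : Vec n => gx J x) := by unfold gx; fun_prop
  have pi2 : PG (fun x : Vec n => ip s x ^ 2) := by unfold ip; fun_prop
  have pi1 : PG (fun x : Vec n => ip s x) := by unfold ip; fun_prop
  have p2 : PG (fun x : Vec n => nsq x) := by unfold nsq; fun_prop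
  have p4 : PG (fun x : Vec n => nsq x ^ 2) := by fun_prop
  have hd : PG (fun x => pot θ' (s, J) x - pot θ (s, J) x) :=
    (PG.pot_vec θ' (s, J)).sub (PG.pot_vec θ (s, J))
  have key := log_Zf_ge hg hg' hd
  have e : (fun x => pot θ' (s, J) x - pot θ (s, J) x) = fun x =>
      (θ'.b - θ.b) * xw J x + (θ'.e - θ.e) * gx J x + (θ'.a - θ.a) / (2 * n) * ip s x ^ 2
      + (θ'.f - θ.f) * ip s x - (θ'.τ - θ.τ) / 2 * nsq x - (θ'.d - θ.d) / (4 * n) * nsq x ^ 2 := by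
    ext x; unfold pot; ring
  rw [e, av_sub hg (by fun_prop) (by fun_prop), av_sub hg (by fun_prop) (by fun_prop),
    av_add hg (by fun_prop) (by fun_prop), av_add hg (by fun_prop) (by fun_prop),
    av_add hg (by fun_prop) (by fun_prop)] at key
  simp only [av_const_mul] at key
  unfold aS2 aS1 aQ2 aQ4
  dsimp only
  linarith

end

end

section

theorem le_of_quasi_mono {h : ℝ → ℝ} {C L : ℝ} (hL : 0 ≤ L)
    (hh : ∀ x y, 0 ≤ x → x ≤ y → y ≤ L → h x - C * (y - x) ^ 2 ≤ h y) : h 0 ≤ h L := by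
  have key : ∀ N : ℕ, 0 < N → ∀ k : ℕ, k ≤ N → h 0 - k * (C * (L / N) ^ 2) ≤ h (k * (L / N)) := by
    intro N hN k
    have hN' : (0 : ℝ) < N := by exact_mod_cast hN
    induction k with
    | zero => intro _; simp
    | succ k ih =>
      intro hk
      have h1 := ih (by omega)
      have hkN : ((k : ℝ) + 1) ≤ N := by exact_mod_cast hk
      have h2 := hh (k * (L / N)) ((k + 1 : ℕ) * (L / N)) (by positivity)
        (by gcongr; simp) (by
          push_cast
          calc ((k : ℝ) + 1) * (L / N) ≤ N * (L / N) := by gcongr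
            _ = L := by field_simp)
      have h3 : ((k + 1 : ℕ) : ℝ) * (L / N) - k * (L / N) = L / N := by push_cast; ring
      rw [h3] at h2
      push_cast at h2 ⊢
      linarith
  have key2 : ∀ᶠ N : ℕ in atTop, h 0 - C * L ^ 2 / N ≤ h L := by
    filter_upwards [eventually_gt_atTop 0] with N hN
    have h1 := key N hN N le_rfl
    have hN' : (0 : ℝ) < N := by exact_mod_cast hN
    have e1 : (N : ℝ) * (L / N) = L := by field_simp
    have e2 : (N : ℝ) * (C * (L / N) ^ 2) = C * L ^ 2 / N := by field_simp
    rwa [e1, e2] at h1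
  have lim : Tendsto (fun N : ℕ => h 0 - C * L ^ 2 / N) atTop (nhds (h 0 - 0)) :=
    tendsto_const_nhds.sub (tendsto_const_div_atTop_nhds_zero_nat _)
  rw [sub_zero] at lim
  exact le_of_tendsto lim key2

section
variable {ι : Type*} [Fintype ι]

theorem Zf_gauss (F : ι → ℝ) {τ : ℝ} (hτ : 0 < τ) :
    Zf (fun x => ip F x - τ / 2 * nsq x) =
      √(2 * Real.pi / τ) ^ Fintype.card ι * Real.exp (nsq F / (2 * τ)) := by
  unfold Zf
  have h1 : ∀ x : ι → ℝ, Real.exp (ip F x - τ / 2 * nsq x) =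
      Real.exp (-(τ / 2) * nsq (x + -((1 / τ) • F))) * Real.exp (nsq F / (2 * τ)) := by
    intro x
    rw [← Real.exp_add]
    congr 1
    rw [nsq_add, nsq_neg, nsq_smul, ip_neg_right, ip_smul_right, ip_comm x F]
    field_simp
    ring
  simp_rw [h1]
  rw [integral_mul_const, integral_add_right_eq_self fun x => Real.exp (-(τ / 2) * nsq x)]
  congr 1
  have h2 : ∀ x : ι → ℝ, Real.exp (-(τ / 2) * nsq x) = ∏ i, Real.exp (-(τ / 2) * x i ^ 2) := by
    intro x
    rw [← Real.exp_sum, nsq, Finset.mul_sum]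
  simp_rw [h2]
  rw [integral_fintype_prod_volume_eq_prod (fun _ : ι => fun x : ℝ => Real.exp (-(τ / 2) * x ^ 2))]
  simp only [integral_gaussian, Finset.prod_const, Finset.card_univ]
  congr 2
  field_simp

theorem Zf_eq_lintegral (U : (ι → ℝ) → ℝ) (hm : Measurable U) :
    Zf U = (∫⁻ x, ENNReal.ofReal (Real.exp (U x))).toReal :=
  integral_eq_lintegral_of_nonneg_ae (ae_of_all _ fun x => (Real.exp_pos _).le)
    (by fun_prop)

theorem good_gauss (F : ι → ℝ) {τ : ℝ} (hτ : 0 < τ) : Good (fun x => ip F x - τ / 2 * nsq x) := by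
  refine ⟨by unfold ip nsq; fun_prop, nsq F / τ, τ / 4, by positivity, fun x => ?_⟩
  have h := nsq_nonneg (x + -((2 / τ) • F))
  rw [nsq_add, nsq_neg, nsq_smul, ip_neg_right, ip_smul_right, ip_comm x F] at h
  have : ip F x ≤ τ / 4 * nsq x + nsq F / τ := by
    have h2 := mul_nonneg (by positivity : 0 ≤ τ / 4) h
    have e : τ / 4 * (nsq x + 2 * -(2 / τ * ip F x) + (2 / τ) ^ 2 * nsq F) =
      τ / 4 * nsq x - ip F x + nsq F / τ := by field_simp; ring
    rw [e] at h2
    linarith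
  linarith

theorem lintegral_gauss (F : ι → ℝ) {τ : ℝ} (hτ : 0 < τ) :
    ∫⁻ x, ENNReal.ofReal (Real.exp (ip F x - τ / 2 * nsq x)) =
      ENNReal.ofReal (√(2 * Real.pi / τ) ^ Fintype.card ι * Real.exp (nsq F / (2 * τ))) := by
  rw [← Zf_gauss F hτ, Zf, ofReal_integral_eq_lintegral_ofReal (good_gauss F hτ).integrable_exp
    (ae_of_all _ fun x => (Real.exp_pos _).le)]

/-- Gaussian integral with a rank-one perturbation of the covariance. -/
theorem Zf_gauss_rank_one (F s : ι → ℝ) {τ k : ℝ} (hτ : 0 < τ) (hk : k ^ 2 * nsq s < τ) :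
    Zf (fun x => ip F x + k ^ 2 / 2 * ip s x ^ 2 - τ / 2 * nsq x) =
      √(2 * Real.pi / τ) ^ Fintype.card ι * Real.exp (nsq F / (2 * τ)) *
        (√(1 / (1 - k ^ 2 * nsq s / τ)) *
          Real.exp (k ^ 2 * ip F s ^ 2 / (2 * τ * (τ - k ^ 2 * nsq s)))) := by
  have hτ' : 0 < 1 - k ^ 2 * nsq s / τ := by rw [sub_pos, div_lt_one hτ]; exact hk
  set c := √(2 * Real.pi / τ) ^ Fintype.card ι with hc
  have hc0 : 0 ≤ c := by positivity
  have key : ENNReal.ofReal (√(2 * Real.pi)) *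
      ∫⁻ x, ENNReal.ofReal (Real.exp (ip F x + k ^ 2 / 2 * ip s x ^ 2 - τ / 2 * nsq x)) =
      ENNReal.ofReal (c * Real.exp (nsq F / (2 * τ)) *
        (√(2 * Real.pi / (1 - k ^ 2 * nsq s / τ)) *
          Real.exp (k ^ 2 * ip F s ^ 2 / (2 * τ * (τ - k ^ 2 * nsq s))))) := by
    rw [← lintegral_const_mul _ (by unfold ip nsq; fun_prop)]
    have h1 : ∀ x : ι → ℝ, ENNReal.ofReal (√(2 * Real.pi)) *
        ENNReal.ofReal (Real.exp (ip F x + k ^ 2 / 2 * ip s x ^ 2 - τ / 2 * nsq x)) =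
        ∫⁻ z : Unit → ℝ, ENNReal.ofReal (Real.exp (ip (F + (k * z ()) • s) x - τ / 2 * nsq x)) *
          ENNReal.ofReal (Real.exp (-(1 / 2) * nsq z)) := by
      intro x
      have h2 := lintegral_gauss (fun _ : Unit => k * ip s x) one_pos
      have h3 : ∀ z : Unit → ℝ,
          ENNReal.ofReal (Real.exp (ip (F + (k * z ()) • s) x - τ / 2 * nsq x)) *
          ENNReal.ofReal (Real.exp (-(1 / 2) * nsq z)) =
          ENNReal.ofReal (Real.exp (ip F x - τ / 2 * nsq x)) *
          ENNReal.ofReal (Real.exp (ip (fun _ : Unit => k * ip s x) z - 1 / 2 * nsq z)) := by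
        intro z
        rw [← ENNReal.ofReal_mul (Real.exp_pos _).le, ← ENNReal.ofReal_mul (Real.exp_pos _).le,
          ← Real.exp_add, ← Real.exp_add]
        congr 2
        rw [ip_comm _ x, ip_add_right, ip_smul_right, ip_comm x F, ip_comm x s]
        simp [ip]
        ring
      simp_rw [h3]
      rw [lintegral_const_mul _ (by unfold ip nsq; fun_prop), h2,
        ← ENNReal.ofReal_mul (by positivity), ← ENNReal.ofReal_mul (by positivity)]
      congr 1
      simp only [nsq, Fintype.card_unit, Finset.univ_unique, Finset.sum_const,
        Finset.card_singleton, one_smul, pow_one, div_one, mul_one]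
      rw [mul_left_comm, ← Real.exp_add]
      congr 2
      ring
    simp_rw [h1]
    rw [lintegral_lintegral_swap]
    · have h2 : ∀ z : Unit → ℝ, ∫⁻ x : ι → ℝ,
          ENNReal.ofReal (Real.exp (ip (F + (k * z ()) • s) x - τ / 2 * nsq x)) *
          ENNReal.ofReal (Real.exp (-(1 / 2) * nsq z)) =
          ENNReal.ofReal (c * Real.exp (nsq F / (2 * τ))) * ENNReal.ofReal (Real.exp
            (ip (fun _ : Unit => k * ip F s / τ) z - (1 - k ^ 2 * nsq s / τ) / 2 * nsq z)) := by
        intro z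
        rw [lintegral_mul_const _ (by unfold ip nsq; fun_prop), lintegral_gauss _ hτ,
          ← ENNReal.ofReal_mul (by positivity), ← ENNReal.ofReal_mul (by positivity)]
        congr 1
        rw [mul_assoc, mul_assoc, ← Real.exp_add, ← Real.exp_add, nsq_add, ip_smul_right, nsq_smul]
        congr 2
        simp only [nsq, ip, Finset.univ_unique]
        simp
        field_simp
        ring
      simp_rw [h2]
      rw [lintegral_const_mul _ (by unfold ip nsq; fun_prop), lintegral_gauss _ hτ',
        ← ENNReal.ofReal_mul (by positivity)]
      congr 2
      simp only [nsq, Fintype.card_unit, Finset.univ_unique, Finset.sum_const,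
        Finset.card_singleton, one_smul, pow_one]
      congr 2
      have : τ - k ^ 2 * (∑ i, s i ^ 2) ≠ 0 := (sub_pos.2 hk).ne'
      have h' : 1 - k ^ 2 * (∑ i, s i ^ 2) / τ = (τ - k ^ 2 * (∑ i, s i ^ 2)) / τ := by field_simp
      rw [h']
      field_simp
    · unfold ip nsq
      simp only [Pi.add_apply, Pi.smul_apply]
      fun_prop
  rw [Zf_eq_lintegral _ (by unfold ip nsq; fun_prop)]
  have h4 := congrArg ENNReal.toReal key
  rw [ENNReal.toReal_mul, ENNReal.toReal_ofReal (by positivity),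
    ENNReal.toReal_ofReal (by positivity)] at h4
  have h5 : 0 < √(2 * Real.pi) := by positivity
  have h6 : √(2 * Real.pi / (1 - k ^ 2 * nsq s / τ)) =
      √(2 * Real.pi) * √(1 / (1 - k ^ 2 * nsq s / τ)) := by
    rw [← Real.sqrt_mul (by positivity)]
    congr 1
    ring
  rw [h6] at h4
  apply mul_left_cancel₀ h5.ne'
  rw [h4]
  ring

theorem log_Zf_gauss_rank_one (F s : ι → ℝ) {τ k : ℝ} (hτ : 0 < τ) (hk : k ^ 2 * nsq s < τ) :
    Real.log (Zf (fun x => ip F x + k ^ 2 / 2 * ip s x ^ 2 - τ / 2 * nsq x)) =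
      Fintype.card ι / 2 * (Real.log (2 * Real.pi) - Real.log τ) + nsq F / (2 * τ)
        - 1 / 2 * Real.log (1 - k ^ 2 * nsq s / τ)
        + k ^ 2 * ip F s ^ 2 / (2 * τ * (τ - k ^ 2 * nsq s)) := by
  have hτ' : 0 < 1 - k ^ 2 * nsq s / τ := by rw [sub_pos, div_lt_one hτ]; exact hk
  rw [Zf_gauss_rank_one F s hτ hk, Real.log_mul (by positivity) (by positivity),
    Real.log_mul (by positivity) (by positivity), Real.log_mul (by positivity) (by positivity),
    Real.log_exp, Real.log_exp, Real.log_pow, Real.log_sqrt (by positivity),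
    Real.log_sqrt (by positivity), Real.log_div (by positivity) (by positivity), one_div,
    Real.log_inv]
  ring

theorem integral_coord (p : ι) : ∫ J, J p ∂gam ι = 0 := by
  classical
  have h := stein p (G := fun _ => 1) (G' := fun _ => 0) (by fun_prop) (by fun_prop) fun J =>
    hasDerivAt_const _ _
  simpa using h

theorem integral_ip (m : ι → ℝ) : ∫ J, ip m J ∂gam ι = 0 := by
  unfold ip
  rw [integral_finsetSum]
  · simp [integral_const_mul, integral_coord]
  · intro i _
    have h : PG fun J : ι → ℝ => m i * J i := by fun_prop
    exact h.integrable_gam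

theorem integral_ip_sq (m : ι → ℝ) : ∫ J, ip m J ^ 2 ∂gam ι = nsq m := by
  classical
  have h2 : ∀ J : ι → ℝ, ip m J ^ 2 = ∑ p, m p * (J p * ip m J) := by
    intro J
    rw [pow_two]
    nth_rewrite 1 [ip]
    rw [Finset.sum_mul]
    exact Finset.sum_congr rfl fun i _ => by ring
  have hp : PG fun J : ι → ℝ => ip m J := by unfold ip; fun_prop
  have h3 : ∀ p, ∫ J, J p * ip m J ∂gam ι = m p := by
    intro p
    rw [stein p (G' := fun _ => m p) hp (by fun_prop)]
    · simp
    · intro J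
      simp only [ip_add_right, ip_smul_right, ip_single]
      simpa using ((hasDerivAt_id (0 : ℝ)).mul_const (m p)).const_add (ip m J)
  simp_rw [h2]
  rw [integral_finsetSum]
  · simp only [integral_const_mul, h3, nsq, pow_two]
  · intro i _
    have h : PG fun J : ι → ℝ => m i * (J i * ip m J) := by fun_prop
    exact h.integrable_gam

end

variable {n : ℕ}

/-- Explicit averaged free energy of the decoupled model. -/
theorem integral_log_Zf_decoupled {θ : Par} (hn : n ≠ 0) (hb : θ.b = 0) (hd : θ.d = 0)
    (ha : 0 ≤ θ.a) (hτ : 0 < θ.τ) (s : Vec n) (hs : θ.a * (nsq s / n) < θ.τ) :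
    ∫ J, Real.log (Zf (pot θ (s, J))) ∂gam (Ix n) =
      n / 2 * (Real.log (2 * Real.pi) - Real.log θ.τ)
        + (θ.e ^ 2 * n + θ.f ^ 2 * nsq s) / (2 * θ.τ)
        - 1 / 2 * Real.log (1 - θ.a * (nsq s / n) / θ.τ)
        + θ.a / n * (θ.e ^ 2 * nsq s + θ.f ^ 2 * nsq s ^ 2) /
          (2 * θ.τ * (θ.τ - θ.a * (nsq s / n))) := by
  have hn' : (0 : ℝ) < n := by positivity
  have hk2 : √(θ.a / n) ^ 2 = θ.a / n := Real.sq_sqrt (by positivity)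
  have hk3 : √(θ.a / n) ^ 2 * nsq s = θ.a * (nsq s / n) := by rw [hk2]; ring
  set F : (Ix n → ℝ) → Vec n := fun J i => θ.e * J (Sum.inr i) + θ.f * s i with hF
  have hpot : ∀ J, pot θ (s, J) = fun x => ip (F J) x + √(θ.a / n) ^ 2 / 2 * ip s x ^ 2
      - θ.τ / 2 * nsq x := by
    intro J
    ext x
    have : ip (F J) x = θ.e * gx J x + θ.f * ip s x := by
      simp only [ip, gx, hF, Finset.mul_sum, ← Finset.sum_add_distrib]
      exact Finset.sum_congr rfl fun i _ => by ring
    rw [this, pot, hb, hd, hk2]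
    ring
  have h1 : ∀ J : Ix n → ℝ, Real.log (Zf (pot θ (s, J))) =
      (n / 2 * (Real.log (2 * Real.pi) - Real.log θ.τ)
        - 1 / 2 * Real.log (1 - θ.a * (nsq s / n) / θ.τ)) + (1 / (2 * θ.τ) * nsq (F J)
        + θ.a / n / (2 * θ.τ * (θ.τ - θ.a * (nsq s / n))) * ip (F J) s ^ 2) := by
    intro J
    rw [hpot J, log_Zf_gauss_rank_one _ _ hτ (by rw [hk3]; exact hs), hk3, Fintype.card_fin, hk2]
    ring
  have hc : ∀ J, ip (F J) s = θ.e * ip (Sum.elim 0 s : Ix n → ℝ) J + θ.f * nsq s := by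
    intro J
    simp only [ip, nsq, hF, Fintype.sum_sum_type, Sum.elim_inl, Sum.elim_inr, Pi.zero_apply,
      zero_mul, Finset.sum_const_zero, zero_add, Finset.mul_sum, ← Finset.sum_add_distrib]
    exact Finset.sum_congr rfl fun i _ => by ring
  have hnm : nsq (Sum.elim 0 s : Ix n → ℝ) = nsq s := by
    simp [nsq, Fintype.sum_sum_type]
  have pF : PG fun J => nsq (F J) := by simp only [nsq, hF]; fun_prop
  have pG : PG fun J => ip (F J) s ^ 2 := by simp only [ip, hF]; fun_prop
  have pl : PG fun J => ip (Sum.elim 0 s : Ix n → ℝ) J := by simp only [ip]; fun_prop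
  have i1 : ∫ J, nsq (F J) ∂gam (Ix n) = θ.e ^ 2 * n + θ.f ^ 2 * nsq s := by
    have h2 : ∀ i J, F J i ^ 2 = θ.e ^ 2 * J (Sum.inr i) ^ 2 +
        (2 * θ.e * θ.f * s i * J (Sum.inr i) + θ.f ^ 2 * s i ^ 2) := fun i J => by
      simp only [hF]; ring
    simp only [nsq, h2]
    rw [integral_finsetSum]
    · have h3 : ∀ i : Fin n, ∫ J : Ix n → ℝ, (θ.e ^ 2 * J (Sum.inr i) ^ 2 +
          (2 * θ.e * θ.f * s i * J (Sum.inr i) + θ.f ^ 2 * s i ^ 2)) ∂gam (Ix n) =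
          θ.e ^ 2 + θ.f ^ 2 * s i ^ 2 := by
        intro i
        have q1 : PG fun J : Ix n → ℝ => θ.e ^ 2 * J (Sum.inr i) ^ 2 := by fun_prop
        have q2 : PG fun J : Ix n → ℝ => 2 * θ.e * θ.f * s i * J (Sum.inr i) := by fun_prop
        have q3 : PG fun J : Ix n → ℝ => θ.f ^ 2 * s i ^ 2 := by fun_prop
        rw [integral_add q1.integrable_gam (q2.add q3).integrable_gam,
          integral_add q2.integrable_gam q3.integrable_gam, integral_const_mul,
          integral_const_mul, integral_coord_sq, integral_coord]
        simp
      simp only [h3, Finset.sum_add_distrib, ← Finset.mul_sum]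
      simp
      ring
    · intro i _
      have q : PG fun J : Ix n → ℝ => θ.e ^ 2 * J (Sum.inr i) ^ 2 +
        (2 * θ.e * θ.f * s i * J (Sum.inr i) + θ.f ^ 2 * s i ^ 2) := by fun_prop
      exact q.integrable_gam
  have i2 : ∫ J, ip (F J) s ^ 2 ∂gam (Ix n) = θ.e ^ 2 * nsq s + θ.f ^ 2 * nsq s ^ 2 := by
    have h2 : ∀ J, ip (F J) s ^ 2 = θ.e ^ 2 * ip (Sum.elim 0 s : Ix n → ℝ) J ^ 2 +
        (2 * θ.e * θ.f * nsq s * ip (Sum.elim 0 s : Ix n → ℝ) J + θ.f ^ 2 * nsq s ^ 2) :=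
      fun J => by rw [hc]; ring
    simp only [h2]
    have q1 : PG fun J => θ.e ^ 2 * ip (Sum.elim 0 s : Ix n → ℝ) J ^ 2 := by fun_prop
    have q2 : PG fun J => 2 * θ.e * θ.f * nsq s * ip (Sum.elim 0 s : Ix n → ℝ) J := by fun_prop
    have q3 : PG fun _ : Ix n → ℝ => θ.f ^ 2 * nsq s ^ 2 := by fun_prop
    rw [integral_add q1.integrable_gam (q2.add q3).integrable_gam,
      integral_add q2.integrable_gam q3.integrable_gam, integral_const_mul,
      integral_const_mul, integral_ip_sq, integral_ip, hnm]
    simp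
  simp only [h1]
  rw [integral_add (PG.const _).integrable_gam
    (((PG.const _).mul pF).add ((PG.const _).mul pG)).integrable_gam,
    integral_add ((PG.const _).mul pF).integrable_gam ((PG.const _).mul pG).integrable_gam,
    integral_const_mul, integral_const_mul, i1, i2]
  simp
  ring

end

section

variable {n : ℕ}

theorem EE_dirac (s : Vec n) (F : Om n → ℝ) (hF : Measurable F) :
    EE (Measure.dirac s) F = ∫ J, F (s, J) ∂gam (Ix n) := by
  rw [EE, Measure.dirac_prod, integral_map measurable_prodMk_left.aemeasurable
    hF.aestronglyMeasurable]

theorem mom_dirac (s : Vec n) : Mom (Measure.dirac s) := fun k => by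
  have : Measurable fun s : Vec n => size s ^ k := (HasSize.meas (α := Vec n)).pow_const k
  exact integrable_dirac (by simp)

theorem aR1_nonneg (θ : Par) (ω : Om n) : 0 ≤ aR1 θ ω := Finset.sum_nonneg fun _ _ => sq_nonneg _

theorem aR2_nonneg (θ : Par) (ω : Om n) : 0 ≤ aR2 θ ω :=
  Finset.sum_nonneg fun _ _ => Finset.sum_nonneg fun _ _ => sq_nonneg _

theorem sum_av_mul {U : Vec n → ℝ} (hU : Good U) (y : Vec n) :
    ∑ i, av U (fun x => x i) * y i = av U (fun x => ip x y) := by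
  unfold ip
  rw [av_sum hU _ fun i => (by fun_prop)]
  exact Finset.sum_congr rfl fun i _ => (av_mul_const _ _).symm

theorem aR1_sq_le {K η : ℝ} {θ : Par} {ω : Om n} (h : Adm n K η θ ω.1) :
    aR1 θ ω ^ 2 ≤ aR2 θ ω := by
  have hg := h.good
  set v : Vec n := fun i => av (pot θ ω) (fun x => x i) with hv
  have h1 : aR1 θ ω = av (pot θ ω) (fun x => ip x v) := by
    rw [← sum_av_mul hg]; exact Finset.sum_congr rfl fun i _ => pow_two _
  have h2 : aR1 θ ω ^ 2 ≤ ∑ i, ∑ j, av (pot θ ω) (fun x => x i * x j) * (v i * v j) := by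
    have h3 := av_sq_le hg (f := fun x => ip x v) (by unfold ip; fun_prop)
    rw [← h1] at h3
    refine h3.trans (le_of_eq ?_)
    have e : (fun x : Vec n => ip x v ^ 2) = fun x => ∑ i, ∑ j, x i * x j * (v i * v j) := by
      ext x
      rw [ip, pow_two, Finset.sum_mul_sum]
      exact Finset.sum_congr rfl fun i _ => Finset.sum_congr rfl fun j _ => by ring
    rw [e, av_sum hg _ fun i => (by fun_prop)]
    refine Finset.sum_congr rfl fun i _ => ?_
    rw [av_sum hg _ fun j => (by fun_prop)]
    exact Finset.sum_congr rfl fun j _ => av_mul_const _ _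
  have h4 : (∑ i, ∑ j, av (pot θ ω) (fun x => x i * x j) * (v i * v j)) ≤
      ∑ i, ∑ j, (1 / 2 * av (pot θ ω) (fun x => x i * x j) ^ 2 + 1 / 2 * (v i ^ 2 * v j ^ 2)) :=
    Finset.sum_le_sum fun i _ => Finset.sum_le_sum fun j _ => by
      nlinarith [sq_nonneg (av (pot θ ω) (fun x => x i * x j) - v i * v j)]
  have h5 : (∑ i, ∑ j, (1 / 2 * av (pot θ ω) (fun x => x i * x j) ^ 2 +
      1 / 2 * (v i ^ 2 * v j ^ 2))) = 1 / 2 * aR2 θ ω + 1 / 2 * aR1 θ ω ^ 2 := by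
    simp only [Finset.sum_add_distrib, ← Finset.mul_sum]
    rw [aR2, aR1, pow_two, Finset.sum_mul]
  linarith

theorem sq_sin_sub_le (x y : ℝ) : (Real.sin x - Real.sin y) ^ 2 ≤ (y - x) ^ 2 := by
  have h := Real.abs_sin_sub_sin_le x y
  rw [← sq_abs (Real.sin x - Real.sin y), ← sq_abs (y - x), abs_sub_comm y x]
  gcongr

theorem sq_cos_sub_le (x y : ℝ) : (Real.cos x - Real.cos y) ^ 2 ≤ (y - x) ^ 2 := by
  have h := Real.abs_cos_sub_cos_le x y
  rw [← sq_abs (Real.cos x - Real.cos y), ← sq_abs (y - x), abs_sub_comm y x]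
  gcongr

theorem sq_sqrt_sub_le {ε k : ℝ} (hε : 0 ≤ ε) (hk : 0 ≤ k) (x y : ℝ) :
    (√(ε + k * x ^ 2) - √(ε + k * y ^ 2)) ^ 2 ≤ k * (x - y) ^ 2 := by
  have h1 := Real.sq_sqrt (by positivity : 0 ≤ ε + k * x ^ 2)
  have h2 := Real.sq_sqrt (by positivity : 0 ≤ ε + k * y ^ 2)
  have h3 : ε + k * (x * y) ≤ √(ε + k * x ^ 2) * √(ε + k * y ^ 2) := by
    rw [← Real.sqrt_mul (by positivity)]
    refine Real.le_sqrt_of_sq_le ?_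
    nlinarith [mul_nonneg (mul_nonneg hε hk) (sq_nonneg (x - y))]
  nlinarith

theorem aQ4_nonneg (θ : Par) (ω : Om n) : 0 ≤ aQ4 θ ω := av_nonneg fun _ => sq_nonneg _
theorem aQ2_nonneg (θ : Par) (ω : Om n) : 0 ≤ aQ2 θ ω := av_nonneg fun _ => nsq_nonneg _

section
variable {ν : Measure (Vec n)} [IsProbabilityMeasure ν]

theorem EE_R_ge (hν : Mom ν) {K η : ℝ} {θ : Par} (h : AdmA ν K η θ) (q : ℝ) :
    -(q ^ 2) ≤ EE ν (aR2 θ) - 2 * q * EE ν (aR1 θ) := by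
  rw [← EE_const_mul, ← EE_sub hν h.lpg_R2 (h.lpg_R1.const_mul _), ← EE_const (ν := ν) (-q ^ 2)]
  refine EE_mono hν (LPG.const _) (h.lpg_R2.sub (h.lpg_R1.const_mul _)) ?_
  filter_upwards [h] with s hs J
  have := aR1_sq_le (ω := (s, J)) hs
  nlinarith [sq_nonneg (aR1 θ (s, J) - q)]

/-- Interpolation upper bound. -/
theorem interpolation_upper (hν : Mom ν) (hn : n ≠ 0) {b a ε q K η : ℝ} (hε : 0 ≤ ε) (hq : 0 ≤ q)
    (hA : ∀ r : ℝ, AdmA ν K η ⟨b * Real.sin r, a, √(ε + b ^ 2 * q * Real.cos r ^ 2), ε,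
      1 + ε + b ^ 2 * q * Real.cos r ^ 2, b ^ 2 * Real.sin r ^ 2⟩) :
    EE ν (fun ω => Real.log (Zf (pot ⟨b, a, √ε, ε, 1 + ε, b ^ 2⟩ ω))) ≤ n * b ^ 2 * q ^ 2 / 4 +
      EE ν (fun ω => Real.log (Zf (pot ⟨0, a, √(ε + b ^ 2 * q), ε, 1 + ε + b ^ 2 * q, 0⟩ ω))) := by
  set θ : ℝ → Par := fun r => ⟨b * Real.sin r, a, √(ε + b ^ 2 * q * Real.cos r ^ 2), ε,
      1 + ε + b ^ 2 * q * Real.cos r ^ 2, b ^ 2 * Real.sin r ^ 2⟩ with hθ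
  set E : ℝ → ℝ := fun r => EE ν (fun ω => Real.log (Zf (pot (θ r) ω))) with hE
  have hn' : (0 : ℝ) < n := by positivity
  obtain ⟨C4, h4⟩ := EE_av_bound hν K η (f := fun p : Om n × Vec n => nsq p.2 ^ 2)
    (by unfold nsq; fun_prop)
  obtain ⟨C2, h2⟩ := EE_av_bound hν K η (f := fun p : Om n × Vec n => nsq p.2)
    (by unfold nsq; fun_prop)
  have key := le_of_quasi_mono (h := fun r => n * b ^ 2 * q ^ 2 / 4 * Real.sin r ^ 2 - E r)
    (C := b ^ 2 / (4 * n) * C4 + b ^ 2 * q / 2 * C2) (L := Real.pi / 2) (by positivity) ?_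
  · simp only [hE, hθ, Real.sin_zero, Real.cos_zero, Real.sin_pi_div_two,
      Real.cos_pi_div_two] at key
    norm_num at key
    linarith
  · intro x y hx hxy hy
    have hs := EL_increment_le hν hn (hA y) (hA x)
    have q4 := (abs_le.1 (h4 _ (hA y))).2
    have q2 := (abs_le.1 (h2 _ (hA y))).2
    have r1 := EE_nonneg (ν := ν) (F := aR1 (θ y)) (ae_of_all _ fun s J => aR1_nonneg _ _)
    have r2 := EE_nonneg (ν := ν) (F := aR2 (θ y)) (ae_of_all _ fun s J => aR2_nonneg _ _)
    have hR := EE_R_ge hν (hA y) (n * q)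
    change EE ν (aQ4 (θ y)) ≤ C4 at q4
    change EE ν (aQ2 (θ y)) ≤ C2 at q2
    change E y + _ + _ + _ + _ - _ - _ ≤ E x at hs
    change _ ≤ EE ν (aR2 (θ y)) - _ * EE ν (aR1 (θ y)) at hR
    change E y + _ * (_ * (EE ν (aQ4 (θ y)) - EE ν (aR2 (θ y))))
      + _ * (_ * (EE ν (aQ2 (θ y)) - EE ν (aR1 (θ y)))) + _ * EE ν (aS2 (θ y))
      + _ * EE ν (aS1 (θ y)) - _ * EE ν (aQ2 (θ y)) - _ * EE ν (aQ4 (θ y)) ≤ E x at hs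
    dsimp only at hs
    have p1 : 0 ≤ EE ν (aQ4 (θ y)) := EE_nonneg (ae_of_all _ fun s J => aQ4_nonneg _ _)
    have p2 : 0 ≤ EE ν (aQ2 (θ y)) := EE_nonneg (ae_of_all _ fun s J => aQ2_nonneg _ _)
    have g0 : Real.sin x ^ 2 ≤ Real.sin y ^ 2 := by
      have := Real.sin_le_sin_of_le_of_le_pi_div_two (x := x) (y := y) (by linarith) hy hxy
      have h0 := Real.sin_nonneg_of_nonneg_of_le_pi hx (by linarith [Real.pi_pos])
      gcongr
    generalize EE ν (aQ4 (θ y)) = Q4 at *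
    generalize EE ν (aQ2 (θ y)) = Q2 at *
    generalize EE ν (aR2 (θ y)) = R2 at *
    generalize EE ν (aR1 (θ y)) = R1 at *
    generalize EE ν (aS2 (θ y)) = S2 at *
    generalize EE ν (aS1 (θ y)) = S1 at *
    have es := sq_sin_sub_le x y
    have ec := sq_cos_sub_le x y
    have er := sq_sqrt_sub_le hε (mul_nonneg (sq_nonneg b) hq) (Real.cos x) (Real.cos y)
    have ex := Real.sq_sqrt (by positivity : 0 ≤ ε + b ^ 2 * q * Real.cos x ^ 2)
    have ey := Real.sq_sqrt (by positivity : 0 ≤ ε + b ^ 2 * q * Real.cos y ^ 2)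
    have cx := Real.sin_sq_add_cos_sq x
    have cy := Real.sin_sq_add_cos_sq y
    set ux := √(ε + b ^ 2 * q * Real.cos x ^ 2)
    set uy := √(ε + b ^ 2 * q * Real.cos y ^ 2)
    set sx := Real.sin x
    set sy := Real.sin y
    have er' : (ux - uy) ^ 2 ≤ b ^ 2 * q * (y - x) ^ 2 :=
      er.trans (by gcongr)
    -- error terms
    have e1 : (sx - sy) ^ 2 * (b ^ 2 / (4 * n)) * (Q4 - R2) ≤
        (y - x) ^ 2 * (b ^ 2 / (4 * n)) * C4 := by
      calc _ ≤ (sx - sy) ^ 2 * (b ^ 2 / (4 * n)) * C4 := by gcongr; linarith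
        _ ≤ _ := by
          have : 0 ≤ C4 := by linarith
          gcongr
    have e2 : (ux - uy) ^ 2 / 2 * (Q2 - R1) ≤ b ^ 2 * q * (y - x) ^ 2 / 2 * C2 := by
      calc _ ≤ (ux - uy) ^ 2 / 2 * C2 := by gcongr; linarith
        _ ≤ _ := by
          have : 0 ≤ C2 := by linarith
          gcongr
    have e3 : b ^ 2 * (sy ^ 2 - sx ^ 2) / (4 * n) * -((n * q) ^ 2) ≤
        b ^ 2 * (sy ^ 2 - sx ^ 2) / (4 * n) * (R2 - 2 * (n * q) * R1) := by
      have : 0 ≤ b ^ 2 * (sy ^ 2 - sx ^ 2) / (4 * n) := by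
        have := sub_nonneg.2 g0
        positivity
      gcongr
    have e4 : b ^ 2 * (sy ^ 2 - sx ^ 2) / (4 * n) * -((n * q) ^ 2) =
        n * b ^ 2 * q ^ 2 / 4 * sx ^ 2 - n * b ^ 2 * q ^ 2 / 4 * sy ^ 2 := by field_simp; ring
    have e5 : b ^ 2 * (sy ^ 2 - sx ^ 2) / (4 * n) * (R2 - 2 * (n * q) * R1) =
        b ^ 2 * (sy ^ 2 - sx ^ 2) / (4 * n) * R2 - b ^ 2 * (sy ^ 2 - sx ^ 2) / 2 * q * R1 := by
      field_simp; ring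
    have e6 : (b * sx - b * sy) * (b * sy / (2 * n) * (Q4 - R2)) =
        (b ^ 2 * (sx ^ 2 - sy ^ 2) / (4 * n)) * (Q4 - R2) -
          (sx - sy) ^ 2 * (b ^ 2 / (4 * n)) * (Q4 - R2) := by field_simp; ring
    have e7 : (ux - uy) * (uy * (Q2 - R1)) = (ux ^ 2 - uy ^ 2) / 2 * (Q2 - R1) -
        (ux - uy) ^ 2 / 2 * (Q2 - R1) := by ring
    rw [e6, e7, ex, ey] at hs
    have hcx : Real.cos x ^ 2 = 1 - sx ^ 2 := by linarith
    have hcy : Real.cos y ^ 2 = 1 - sy ^ 2 := by linarith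
    rw [hcx, hcy] at hs
    have e8 : (b ^ 2 * sx ^ 2 - b ^ 2 * sy ^ 2) / (4 * n) * Q4 =
      b ^ 2 * (sx ^ 2 - sy ^ 2) / (4 * n) * Q4 := by ring
    have e9 : b ^ 2 * (sy ^ 2 - sx ^ 2) / (4 * n) * R2 =
      -(b ^ 2 * (sx ^ 2 - sy ^ 2) / (4 * n) * R2) := by ring
    rw [e8] at hs
    rw [e4, e5, e9] at e3
    simp only [sub_self, zero_div, zero_mul, add_zero] at hs
    ring_nf at hs e1 e2 e3 ⊢
    linarith

end

/-- Upper bound for the conditional free energy given the planted vector. -/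
theorem integral_log_Zf_le (hn : n ≠ 0) {b a ε q : ℝ} (ha : 0 ≤ a) (hε : 0 ≤ ε)
    (hq : 0 ≤ q) (s : Vec n) (hs : a * (nsq s / n) < 1 + ε + b ^ 2 * q) :
    ∫ J, Real.log (Zf (pot ⟨b, a, √ε, ε, 1 + ε, b ^ 2⟩ (s, J))) ∂gam (Ix n) ≤
      n * b ^ 2 * q ^ 2 / 4 +
      ∫ J, Real.log (Zf (pot ⟨0, a, √(ε + b ^ 2 * q), ε, 1 + ε + b ^ 2 * q, 0⟩ (s, J))) ∂gam (Ix n)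
      := by
  have hσ : 0 ≤ nsq s / n := div_nonneg (nsq_nonneg s) (by positivity)
  have hw : 0 ≤ ε + b ^ 2 * q := by positivity
  have hA : ∀ r : ℝ, AdmA (Measure.dirac s) (|b| + a + √(ε + b ^ 2 * q) + (1 + ε + b ^ 2 * q)
      + b ^ 2 + q + 1) (1 + ε + b ^ 2 * q - a * (nsq s / n)) ⟨b * Real.sin r, a,
      √(ε + b ^ 2 * q * Real.cos r ^ 2), ε,
      1 + ε + b ^ 2 * q * Real.cos r ^ 2, b ^ 2 * Real.sin r ^ 2⟩ := by
    intro r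
    unfold AdmA
    rw [ae_dirac_eq]
    have s0 := sq_nonneg (Real.sin r)
    have c0 := sq_nonneg (Real.cos r)
    have s1 : Real.sin r ^ 2 ≤ 1 := by nlinarith [Real.sin_sq_add_cos_sq r]
    have c1 : Real.cos r ^ 2 ≤ 1 := by nlinarith [Real.sin_sq_add_cos_sq r]
    have c2 : b ^ 2 * q * Real.cos r ^ 2 ≤ b ^ 2 * q := mul_le_of_le_one_right (by positivity) c1
    have c3 : √(ε + b ^ 2 * q * Real.cos r ^ 2) ≤ √(ε + b ^ 2 * q) := by gcongr
    have c4 : b ^ 2 * Real.sin r ^ 2 ≤ b ^ 2 := mul_le_of_le_one_right (by positivity) s1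
    have c5 : |b * Real.sin r| ≤ |b| := by
      rw [abs_mul]; exact mul_le_of_le_one_right (abs_nonneg b) (Real.abs_sin_le_one r)
    have := abs_nonneg b
    have := Real.sqrt_nonneg (ε + b ^ 2 * q)
    have hb2 := sq_nonneg b
    have hbq := mul_nonneg hb2 hq
    set K := |b| + a + √(ε + b ^ 2 * q) + (1 + ε + b ^ 2 * q) + b ^ 2 + q + 1 with hK
    refine ⟨hn, by linarith, ?_, ?_, ?_, ?_, ?_, ?_, ha, ?_, ?_, ?_⟩
    · exact c5.trans (by linarith)
    · dsimp only; rw [abs_of_nonneg ha]; linarith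
    · dsimp only; rw [abs_of_nonneg (Real.sqrt_nonneg _)]; linarith
    · dsimp only; rw [abs_of_nonneg hε]; linarith
    · dsimp only; rw [abs_of_nonneg (by positivity)]; linarith
    · dsimp only; rw [abs_of_nonneg (by positivity)]; linarith
    · dsimp only; positivity
    · dsimp only
      rw [mul_pow]
      exact le_mul_of_one_le_left (by positivity) (by linarith)
    · dsimp only
      have k1 : q ≤ K * (1 + nsq s / n) := by
        have : 0 ≤ K * (nsq s / n) := mul_nonneg (by linarith) hσ
        rw [mul_add, mul_one]
        linarith
      have k2 := mul_le_mul_of_nonneg_left k1 (by positivity : 0 ≤ b ^ 2 * Real.sin r ^ 2)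
      have k3 : Real.cos r ^ 2 = 1 - Real.sin r ^ 2 := by linarith [Real.sin_sq_add_cos_sq r]
      rw [k3]
      linarith
  have key := interpolation_upper (mom_dirac s) hn hε hq hA
  rwa [EE_dirac s _ (measurable_Zf _).log, EE_dirac s _ (measurable_Zf _).log] at key

end

section

variable {n : ℕ}

theorem mom_gam : Mom (gam (Fin n)) := fun k => by
  have : PG fun s : Vec n => size s ^ k := by fun_prop
  exact this.integrable_gam

/-- A parameter point where confinement comes from the quartic term. -/
theorem admA_of {ν : Measure (Vec n)} (hn : n ≠ 0) {θ : Par} (ha : 0 ≤ θ.a) {d : ℝ} (hθ : θ.d = d)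
    (hd : 0 < d) : ∃ K, AdmA ν K 1 θ := by
  subst hθ
  refine ⟨|θ.b| + |θ.a| + |θ.e| + |θ.f| + |θ.τ| + |θ.d| + θ.b ^ 2 / θ.d + θ.a / θ.d +
    (1 + |θ.τ|) / θ.d, ae_of_all _ fun s => ?_⟩
  have h1 := abs_nonneg θ.b
  have h2 := abs_nonneg θ.a
  have h3 := abs_nonneg θ.e
  have h4 := abs_nonneg θ.f
  have h5 := abs_nonneg θ.τ
  have h6 := abs_nonneg θ.d
  have h7 : 0 ≤ θ.b ^ 2 / θ.d := by positivity
  have h8 : 0 ≤ θ.a / θ.d := by positivity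
  have h9 : 0 ≤ (1 + |θ.τ|) / θ.d := by positivity
  set K := |θ.b| + |θ.a| + |θ.e| + |θ.f| + |θ.τ| + |θ.d| + θ.b ^ 2 / θ.d + θ.a / θ.d +
    (1 + |θ.τ|) / θ.d with hK
  refine ⟨hn, one_pos, by linarith, by linarith, by linarith, by linarith, by linarith,
    by linarith, ha, hd.le, ?_, ?_⟩
  · rw [← div_le_iff₀ hd]; linarith
  · have hσ : 0 ≤ nsq s / n := div_nonneg (nsq_nonneg s) (by positivity)
    have k1 : θ.a ≤ K * θ.d := by rw [← div_le_iff₀ hd]; linarith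
    have k2 : 1 + |θ.τ| ≤ K * θ.d := by rw [← div_le_iff₀ hd]; linarith
    have k3 := neg_abs_le θ.τ
    have := mul_le_mul_of_nonneg_right k1 hσ
    nlinarith

/-- Parameters of the regularized mismatched model. -/
def st (b a ε : ℝ) : Par := ⟨b, a, √ε, ε, 1 + ε, b ^ 2⟩

theorem admA_st {ν : Measure (Vec n)} (hn : n ≠ 0) {b a : ℝ} (ε : ℝ) (hb : 0 < b) (ha : 0 ≤ a) :
    ∃ K, AdmA ν K 1 (st b a ε) := admA_of (θ := st b a ε) hn ha (d := b ^ 2) rfl (by positivity)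

/-- Averaged log-partition function with Gaussian planted vector. -/
def EL (n : ℕ) (θ : Par) : ℝ := EE (gam (Fin n)) (fun ω => Real.log (Zf (pot θ ω)))

/-- Free energy. -/
def phi (n : ℕ) (b a ε : ℝ) : ℝ := EL n (st b a ε) / n - 1 / 2 * Real.log (2 * Real.pi)

/-- Upper bound functional. -/
def ubf (b a ε w : ℝ) : ℝ :=
  (w - ε) ^ 2 / (4 * b ^ 2) + w / (2 * (1 + w)) - 1 / 2 * Real.log (1 + w)
    + ε ^ 2 / (2 * (1 + w - a))

theorem conditional_bound {N : ℝ} (hN : 0 < N) {b a ε w σ : ℝ} (hb : 0 < b) (ha : 0 ≤ a)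
    (hε : 0 ≤ ε) (hw : ε ≤ w) (haw : a < 1 + w) (hσ : 0 ≤ σ) {v : ℝ} (hv : v = w + a * |σ - 1|) :
    N * b ^ 2 * ((v - ε) / b ^ 2) ^ 2 / 4 + (N / 2 * (Real.log (2 * Real.pi) - Real.log (1 + v))
        + (v * N + ε ^ 2 * (N * σ)) / (2 * (1 + v))
        - 1 / 2 * Real.log (1 - a * σ / (1 + v))
        + a / N * (v * (N * σ) + ε ^ 2 * (N * σ) ^ 2) /
          (2 * (1 + v) * (1 + v - a * σ))) ≤
    N * (1 / 2 * Real.log (2 * Real.pi) + ubf b a ε w) +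
      N * (((w - ε) * a / (2 * b ^ 2) + a / 2 + ε ^ 2 / (2 * (1 + w - a))) * |σ - 1|
        + a ^ 2 / (4 * b ^ 2) * |σ - 1| ^ 2)
        + (1 + 2 * w + 2 * a * |σ - 1|) / (2 * (1 + w - a)) := by
  set u := |σ - 1| with hu
  have hu0 : 0 ≤ u := abs_nonneg _
  have hσu : σ ≤ 1 + u := by have := le_abs_self (σ - 1); linarith
  set η := 1 + w - a with hη
  have hη0 : 0 < η := by linarith
  have hau : 0 ≤ a * u := by positivity
  have hτ : 0 < 1 + v := by rw [hv]; linarith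
  have h1 : η ≤ 1 + v - a * σ := by
    have := mul_le_mul_of_nonneg_left hσu ha
    rw [hv, hη]; linarith
  have h1' : 0 < 1 + v - a * σ := by linarith
  have hw0 : 0 ≤ w := hε.trans hw
  -- individual terms
  have t1 : N * b ^ 2 * ((v - ε) / b ^ 2) ^ 2 / 4 = N * ((w - ε) ^ 2 / (4 * b ^ 2)) +
      N * ((w - ε) * a / (2 * b ^ 2) * u + a ^ 2 / (4 * b ^ 2) * u ^ 2) := by
    rw [hv]; field_simp; ring
  have t2 : -Real.log (1 + v) ≤ -Real.log (1 + w) := by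
    rw [neg_le_neg_iff]; exact Real.log_le_log (by linarith) (by rw [hv]; linarith)
  have t3 : v / (1 + v) ≤ w / (1 + w) + a * u := by
    have e1 : v / (1 + v) = w / (1 + w) + a * u * (1 / ((1 + v) * (1 + w))) := by
      have : 0 < 1 + w := by linarith
      rw [hv] at hτ ⊢; field_simp; ring
    have : 1 / ((1 + v) * (1 + w)) ≤ 1 := by
      rw [div_le_one (by positivity)]; nlinarith
    rw [e1]
    have := mul_le_of_le_one_right hau this
    linarith
  have t4 : -Real.log (1 - a * σ / (1 + v)) ≤ (1 + w + a * u) / η := by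
    have e : 1 - a * σ / (1 + v) = ((1 + v) / (1 + v - a * σ))⁻¹ := by
      rw [inv_div]; field_simp
    rw [e, Real.log_inv, neg_neg]
    refine (Real.log_le_self (by positivity)).trans ?_
    rw [show 1 + w + a * u = 1 + v by rw [hv]; ring]
    gcongr
  have t5 : a * σ * v / ((1 + v) * (1 + v - a * σ)) ≤ (w + a * u) / η := by
    have : a * σ ≤ 1 + v := by linarith
    calc _ ≤ (1 + v) * v / ((1 + v) * (1 + v - a * σ)) := by
          gcongr; rw [hv]; positivity
      _ = v / (1 + v - a * σ) := by field_simp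
      _ ≤ v / η := by gcongr; rw [hv]; positivity
      _ = _ := by rw [hv]
  have t6 : ε ^ 2 * σ / (1 + v - a * σ) ≤ ε ^ 2 / η + ε ^ 2 / η * u := by
    calc _ ≤ ε ^ 2 * (1 + u) / η := by gcongr
      _ = _ := by ring
  have t7 : (v * N + ε ^ 2 * (N * σ)) / (2 * (1 + v))
      + a / N * (v * (N * σ) + ε ^ 2 * (N * σ) ^ 2) /
          (2 * (1 + v) * (1 + v - a * σ)) = N / 2 * (v / (1 + v)) +
          1 / 2 * (a * σ * v / ((1 + v) * (1 + v - a * σ)))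
          + N / 2 * (ε ^ 2 * σ / (1 + v - a * σ)) := by
    have hne : 1 + v - a * σ ≠ 0 := h1'.ne'
    generalize hD : 1 + v - a * σ = D at *
    have hv2 : v = D + a * σ - 1 := by linarith
    rw [show 1 + v = D + a * σ by linarith] at hτ ⊢
    rw [hv2]
    field_simp; ring
  have t8 : ubf b a ε w = (w - ε) ^ 2 / (4 * b ^ 2) + 1 / 2 * (w / (1 + w))
      - 1 / 2 * Real.log (1 + w)
    + 1 / 2 * (ε ^ 2 / η) := by
    have : (1 + w) ≠ 0 := by linarith
    rw [ubf, ← hη]; field_simp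
  have t9 : (1 + 2 * w + 2 * a * u) / (2 * η) = 1 / 2 * ((1 + w + a * u) / η) +
    1 / 2 * ((w + a * u) / η) := by field_simp; ring
  have t10 : ε ^ 2 / (2 * η) = 1 / 2 * (ε ^ 2 / η) := by field_simp
  rw [t8, t9, t10, t1]
  have n2 := mul_le_mul_of_nonneg_left t2 hN.le
  have n3 := mul_le_mul_of_nonneg_left t3 hN.le
  have n6 := mul_le_mul_of_nonneg_left t6 hN.le
  linarith

theorem integral_sq_sub_one (hn : n ≠ 0) :
    (∫ s : Vec n, (nsq s / n - 1) ^ 2 ∂gam (Fin n) : ℝ) = 2 / n := by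
  have hn' : (0 : ℝ) < n := by positivity
  have hP : PG (nsq : Vec n → ℝ) := by unfold nsq; fun_prop
  have hP2 : PG (fun s : Vec n => nsq s ^ 2) := by fun_prop
  have e : (fun s : Vec n => (nsq s / n - 1) ^ 2) =
      fun s => (1 / (n : ℝ) ^ 2) * nsq s ^ 2 - 2 / n * nsq s + 1 := by
    ext s; field_simp; ring
  have hi : Integrable (fun s : Vec n => (1 / (n : ℝ) ^ 2) * nsq s ^ 2 - 2 / n * nsq s)
      (gam (Fin n)) := (hP2.integrable_gam.const_mul _).sub (hP.integrable_gam.const_mul _)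
  rw [e, integral_add hi (integrable_const _), integral_sub (hP2.integrable_gam.const_mul _)
    (hP.integrable_gam.const_mul _), integral_const_mul, integral_const_mul, integral_nsq,
    integral_nsq_sq]
  simp
  field_simp
  ring

/-- Upper bound on the free energy. -/
theorem phi_le {b a ε w : ℝ} (hb : 0 < b) (ha : 0 ≤ a)
    (hε : 0 ≤ ε) (hw : ε ≤ w) (haw : a < 1 + w) :
    ∃ C, ∀ n : ℕ, n ≠ 0 → phi n b a ε ≤ ubf b a ε w + C / √n := by
  set c1 := (w - ε) * a / (2 * b ^ 2) + a / 2 + ε ^ 2 / (2 * (1 + w - a)) with hc1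
  set c2 := a ^ 2 / (4 * b ^ 2) with hc2
  set c3 := (1 + 2 * w) / (2 * (1 + w - a)) with hc3
  set c4 := a / (1 + w - a) with hc4
  have hη0 : 0 < 1 + w - a := by linarith
  have p1 : 0 ≤ c1 := by
    have : 0 ≤ w - ε := by linarith
    positivity
  have p2 : 0 ≤ c2 := by positivity
  have p3 : 0 ≤ c3 := by have : 0 ≤ w := hε.trans hw; positivity
  have p4 : 0 ≤ c4 := by positivity
  refine ⟨3 / 2 * c1 + 2 * c2 + c3 + 3 / 2 * c4, fun n hn => ?_⟩
  have hn' : (0 : ℝ) < n := by positivity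
  have hn1 : (1 : ℝ) ≤ n := by exact_mod_cast Nat.one_le_iff_ne_zero.2 hn
  obtain ⟨K, hK⟩ := admA_st (ν := gam (Fin n)) hn ε hb ha
  set r := √(n : ℝ) with hr
  have hr0 : 0 < r := Real.sqrt_pos.2 hn'
  have hr2 : r ^ 2 = n := Real.sq_sqrt hn'.le
  have hr1 : 1 ≤ r := Real.one_le_sqrt.2 hn1
  set Q : Vec n → ℝ := fun s => (nsq s / n - 1) ^ 2 with hQ
  have hQi : Integrable Q (gam (Fin n)) := by
    have : PG Q := by simp only [hQ, nsq]; fun_prop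
    exact this.integrable_gam
  have hpt : ∀ s : Vec n, ∫ J, Real.log (Zf (pot (st b a ε) (s, J))) ∂gam (Ix n) ≤
      n * (1 / 2 * Real.log (2 * Real.pi) + ubf b a ε w) + n * c1 / (2 * r) + c3 + c4 / (2 * r)
        + (n * c1 * r / 2 + n * c2 + c4 * r / 2) * Q s := by
    intro s
    set σ := nsq s / n with hσ
    have hσ0 : 0 ≤ σ := div_nonneg (nsq_nonneg s) hn'.le
    have hns : nsq s = n * σ := by rw [hσ]; field_simp
    have hv0 : 0 ≤ w + a * |σ - 1| - ε := by
      have : 0 ≤ a * |σ - 1| := by positivity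
      linarith
    have hq : ε + b ^ 2 * ((w + a * |σ - 1| - ε) / b ^ 2) = w + a * |σ - 1| := by field_simp; ring
    have hv1 : 0 ≤ w + a * |σ - 1| := by linarith
    have hlt : a * σ < 1 + (w + a * |σ - 1|) := by
      have := mul_le_mul_of_nonneg_left (le_abs_self (σ - 1)) ha
      linarith
    have h := integral_log_Zf_le hn (b := b) (q := (w + a * |σ - 1| - ε) / b ^ 2) ha hε
      (by positivity) s (by rw [add_assoc, hq]; exact hlt)
    rw [add_assoc 1 ε, hq, integral_log_Zf_decoupled (θ := ⟨0, a, √(w + a * |σ - 1|), ε,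
      1 + (w + a * |σ - 1|), 0⟩) hn rfl rfl ha (by dsimp only; linarith) s hlt] at h
    dsimp only at h
    rw [Real.sq_sqrt hv1, ← hσ, hns] at h
    refine (h.trans (conditional_bound hn' hb ha hε hw haw hσ0 rfl)).trans ?_
    rw [← hc1, ← hc2]
    have hu : |σ - 1| ≤ 1 / (2 * r) + r / 2 * Q s := by
      simp only [hQ, ← hσ]
      rw [← sq_abs (σ - 1)]
      have : 1 / (2 * r) + r / 2 * |σ - 1| ^ 2 - |σ - 1| = (r * |σ - 1| - 1) ^ 2 / (2 * r) := by
        field_simp; ring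
      have h2 : 0 ≤ (r * |σ - 1| - 1) ^ 2 / (2 * r) := by positivity
      linarith
    have hu2 : |σ - 1| ^ 2 = Q s := sq_abs _
    have e3 : (1 + 2 * w + 2 * a * |σ - 1|) / (2 * (1 + w - a)) = c3 + c4 * |σ - 1| := by
      rw [hc3, hc4]; field_simp
    rw [hu2, e3]
    have m1 := mul_le_mul_of_nonneg_left hu (mul_nonneg hn'.le p1)
    have m2 := mul_le_mul_of_nonneg_left hu p4
    have m3 : n * c1 * (1 / (2 * r) + r / 2 * Q s) = n * c1 / (2 * r) + n * c1 * r / 2 * Q s :=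
      by ring
    have m4 : c4 * (1 / (2 * r) + r / 2 * Q s) = c4 / (2 * r) + c4 * r / 2 * Q s := by ring
    linarith
  have hexp : EL n (st b a ε) ≤ ∫ s, (n * (1 / 2 * Real.log (2 * Real.pi) + ubf b a ε w)
      + n * c1 / (2 * r) + c3 + c4 / (2 * r)
        + (n * c1 * r / 2 + n * c2 + c4 * r / 2) * Q s) ∂gam (Fin n) := by
    have hi := hK.lpg_log.integrable mom_gam
    rw [EL, EE, integral_prod _ hi]
    exact integral_mono hi.integral_prod_left ((integrable_const _).add (hQi.const_mul _)) hpt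
  rw [integral_add (integrable_const _) (hQi.const_mul _), integral_const_mul,
    integral_sq_sub_one hn] at hexp
  simp only [integral_const, probReal_univ, one_smul] at hexp
  have h1 : EL n (st b a ε) / n ≤ 1 / 2 * Real.log (2 * Real.pi) + ubf b a ε w +
      (3 / 2 * c1 / r + 2 * c2 / n + c3 / n + 3 / 2 * c4 / r / n) := by
    rw [div_le_iff₀ hn']
    refine hexp.trans (le_of_eq ?_)
    rw [← hr2]
    field_simp
    ring
  have hrn : 1 / (n : ℝ) ≤ 1 / r := by
    rw [← hr2]; gcongr; nlinarith
  have h2 : 2 * c2 / n ≤ 2 * c2 / r := by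
    rw [div_eq_mul_one_div, div_eq_mul_one_div _ r]; gcongr
  have h3 : c3 / n ≤ c3 / r := by
    rw [div_eq_mul_one_div, div_eq_mul_one_div _ r]; gcongr
  have h4 : 3 / 2 * c4 / r / n ≤ 3 / 2 * c4 / r := div_le_self (by positivity) hn1
  have h5 : (3 / 2 * c1 + 2 * c2 + c3 + 3 / 2 * c4) / r =
    3 / 2 * c1 / r + 2 * c2 / r + c3 / r + 3 / 2 * c4 / r := by ring
  rw [phi, h5]
  linarith

end

section

variable {n : ℕ}

/-- Parameters of the matched (Bayes-optimal) model. -/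
def nis (b e : ℝ) : Par := ⟨b, b ^ 2, e, e ^ 2, 1 + e ^ 2, b ^ 2⟩

theorem ip_kv_kv (hn : n ≠ 0) (θ : Par) (s x : Vec n) :
    ip (kv θ s) (kv θ x) = θ.b ^ 2 * (ip s x ^ 2 / (2 * n)) + θ.e ^ 2 * ip s x := by
  rw [← sum_kernel hn s x]
  simp only [ip, kv, Fintype.sum_sum_type, Sum.elim_inl, Sum.elim_inr, Finset.mul_sum]
  congr 1 <;> exact Finset.sum_congr rfl fun i _ => by ring

theorem nis_shift (hn : n ≠ 0) (b e : ℝ) (s : Vec n) (J : Ix n → ℝ) (x : Vec n) :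
    pot (nis b e) (s, J) x = pot (nis b e) (0, J + kv (nis b e) s) x := by
  have h0 : ip (0 : Vec n) x = 0 := by simp [ip]
  rw [pot_eq, pot_eq, ip_comm (J + _), ip_add_right, ip_comm _ J, ip_comm _ (kv _ s), ip_kv_kv hn,
    rest, rest, h0]
  simp only [nis]
  ring

theorem nis_tilt (hn : n ≠ 0) (b e : ℝ) (s : Vec n) (J : Ix n → ℝ) :
    Real.exp (ip (kv (nis b e) s) J - nsq (kv (nis b e) s) / 2) * Real.exp (-(1 / 2) * nsq s) =
      Real.exp (pot (nis b e) (0, J) s) := by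
  have h0 : ip (0 : Vec n) s = 0 := by simp [ip]
  rw [← Real.exp_add, pot_eq, rest, h0, ← ip_self (kv _ s), ip_kv_kv hn, ip_comm _ J, ip_self]
  congr 1
  simp only [nis]
  ring

theorem admA_nis (hn : n ≠ 0) {B E : ℝ} (b e : ℝ) (hb : |b| ≤ B) (he : |e| ≤ E) (s : Vec n) :
    Adm n (B + B ^ 2 + E + E ^ 2 + 1) 1 (nis b e) s := by
  have hB : 0 ≤ B := (abs_nonneg b).trans hb
  have hE : 0 ≤ E := (abs_nonneg e).trans he
  have h1 : b ^ 2 ≤ B ^ 2 := by rw [← sq_abs b]; gcongr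
  have h2 : e ^ 2 ≤ E ^ 2 := by rw [← sq_abs e]; gcongr
  have h3 := sq_nonneg B
  have h4 := sq_nonneg E
  have hσ : 0 ≤ nsq s / n := div_nonneg (nsq_nonneg s) (Nat.cast_nonneg n)
  set K := B + B ^ 2 + E + E ^ 2 + 1 with hK
  refine ⟨hn, one_pos, ?_, ?_, ?_, ?_, ?_, ?_, sq_nonneg b, sq_nonneg b, ?_, ?_⟩
  · dsimp only [nis]; linarith
  · dsimp only [nis]; rw [abs_of_nonneg (sq_nonneg b)]; linarith
  · dsimp only [nis]; linarith
  · dsimp only [nis]; rw [abs_of_nonneg (sq_nonneg e)]; linarith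
  · dsimp only [nis]; rw [abs_of_nonneg (by positivity)]; linarith
  · dsimp only [nis]; rw [abs_of_nonneg (sq_nonneg b)]; linarith
  · dsimp only [nis]; exact le_mul_of_one_le_left (sq_nonneg b) (by linarith)
  · dsimp only [nis]
    have hK1 : 1 ≤ K := by linarith
    have : b ^ 2 * (nsq s / n) ≤ b ^ 2 * K * (1 + nsq s / n) := by
      have k1 : nsq s / n ≤ K * (1 + nsq s / n) := by nlinarith
      calc _ ≤ b ^ 2 * (K * (1 + nsq s / n)) := by gcongr
        _ = _ := by ring
    nlinarith [sq_nonneg e]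

/-- Planting shift of the noise. -/
theorem PG.plant {F : Om n → ℝ} (hF : PG F) (θ : Par) :
    PG (fun ω : Om n => F (ω.1, ω.2 + RankOne.kv θ ω.1)) := by
  obtain ⟨hm, C, k, hC, h⟩ := hF
  have hk : ∀ p, PG (fun ω : Om n => RankOne.kv θ ω.1 p) := fun p => (PG.kv θ p).fst
  have hmT : Measurable fun ω : Om n => (ω.1, ω.2 + RankOne.kv θ ω.1) := by
    refine measurable_fst.prodMk (measurable_pi_lambda _ fun p => ?_)
    exact ((measurable_pi_apply p).comp measurable_snd).add (hk p).measurable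
  have hp : ∀ p, PG (fun ω : Om n => ω.2 p) := fun p => by fun_prop
  have h1 : PG (fun ω : Om n => size ω.1) := PG.size_self.fst
  have h2 : PG (fun ω : Om n => 1 + ∑ p, (ω.2 p + RankOne.kv θ ω.1 p) ^ 2) :=
    (PG.const 1).add (PG.sum _ fun p => ((hp p).add (hk p)).pow 2)
  exact PG.of_le (hm.comp hmT) ((PG.const C).mul ((h1.mul h2).pow k)) fun ω => h _

theorem integrable_gam_add (m : Ix n → ℝ) {Φ : (Ix n → ℝ) → ℝ} (hΦ : PG Φ) :
    Integrable (fun J => Φ J * Real.exp (ip m J - nsq m / 2)) (gam (Ix n)) := by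
  rw [integrable_gam_iff]
  have hg := good_gauss m one_pos
  have := (hg.integrable_mul hΦ).mul_const (Real.exp (-nsq m / 2))
  refine this.congr (ae_of_all _ fun J => ?_)
  dsimp only
  rw [mul_assoc, mul_assoc, ← Real.exp_add, ← Real.exp_add]
  congr 2
  ring

theorem EE_plant (hn : n ≠ 0) (b e : ℝ) {F : Om n → ℝ} (hF : PG F) :
    EE (gam (Fin n)) (fun ω => F (ω.1, ω.2 + kv (nis b e) ω.1)) =
      gnorm (Fin n) * ∫ J, (∫ x, F (x, J) * Real.exp (pot (nis b e) (0, J) x)) ∂gam (Ix n) := by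
  set θ := nis b e with hθ
  have hT := hF.plant θ
  have hS : ∀ s, PG (fun J => F (s, J)) := fun s => hF.section_right s
  have hpt : ∀ s J, F (s, J) * Real.exp (pot θ (0, J) s) =
      (F (s, J) * Real.exp (ip (kv θ s) J - nsq (kv θ s) / 2)) * Real.exp (-(1 / 2) * nsq s) :=
    fun s J => by rw [mul_assoc, hθ, nis_tilt hn]
  have hmeas : Measurable (fun p : Om n => F p * Real.exp (pot θ (0, p.2) p.1)) := by
    have h := (PG.pot_joint (n := n) θ).1
    have h' : Measurable fun p : Om n => pot θ (0, p.2) p.1 :=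
      Measurable.comp (g := fun q : Om n × Vec n => pot θ q.1 q.2)
        (f := fun p : Om n => (((0 : Vec n), p.2), p.1)) h (by fun_prop)
    exact hF.1.mul h'.exp
  have hI : Integrable (fun p : Om n => F p * Real.exp (pot θ (0, p.2) p.1))
      ((volume : Measure (Vec n)).prod (gam (Ix n))) := by
    rw [integrable_prod_iff hmeas.aestronglyMeasurable]
    refine ⟨ae_of_all _ fun s => ?_, ?_⟩
    · dsimp only
      simp_rw [hpt]
      exact (integrable_gam_add _ (hS s)).mul_const _
    · have h1 : Integrable (fun ω : Om n => ‖F (ω.1, ω.2 + kv θ ω.1)‖)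
          ((gam (Fin n)).prod (gam (Ix n))) := hT.integrable_prod.norm
      have h2 := (integrable_gam_iff _).1 h1.integral_prod_left
      refine h2.congr (ae_of_all _ fun s => ?_)
      dsimp only
      rw [integral_gam_add (kv θ s) (fun J => ‖F (s, J)‖), ← integral_mul_const]
      refine integral_congr_ae (ae_of_all _ fun J => ?_)
      dsimp only
      rw [hpt, norm_mul, norm_mul, Real.norm_of_nonneg (Real.exp_pos _).le,
        Real.norm_of_nonneg (Real.exp_pos _).le]
  rw [EE, integral_prod _ hT.integrable_prod, integral_gam]
  congr 1
  rw [← integral_integral_swap hI]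
  refine integral_congr_ae (ae_of_all _ fun s => ?_)
  dsimp only
  rw [integral_gam_add (kv θ s) (fun J => F (s, J)), ← integral_mul_const]
  exact integral_congr_ae (ae_of_all _ fun J => (hpt s J).symm)

/-- Nishimori identity. -/
theorem nishimori (hn : n ≠ 0) (b e : ℝ) {F : Om n → ℝ} (hF : PG F) :
    EE (gam (Fin n)) (fun ω => F (ω.1, ω.2 + kv (nis b e) ω.1)) =
      EE (gam (Fin n)) (fun ω => av (pot (nis b e) ω)
        (fun x => F (x, ω.2 + kv (nis b e) ω.1))) := by
  set θ := nis b e with hθ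
  have hA := admA_nis hn b e le_rfl le_rfl (0 : Vec n)
  have hG : PG (fun J : Ix n → ℝ => av (pot θ (0, J)) (fun x => F (x, J))) := by
    refine PG.av_fix hA (f := fun p : Om n × Vec n => F (p.2, p.1.2)) ?_
    obtain ⟨hm, C, k, hC, h⟩ := hF
    refine ⟨hm.comp (measurable_snd.prodMk measurable_fst.snd), C, k, hC, fun p => (h _).trans ?_⟩
    change C * (size p.2 * size p.1.2) ^ k ≤ C * ((size p.1.1 * size p.1.2) * size p.2) ^ k
    have h1 := one_le p.1.1
    have h2 := size_pos p.2
    have h3 := size_pos p.1.2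
    refine mul_le_mul_of_nonneg_left (pow_le_pow_left₀ (by positivity) ?_ k) hC
    calc size p.2 * size p.1.2 = 1 * size p.1.2 * size p.2 := by ring
      _ ≤ _ := by gcongr
  have e1 : EE (gam (Fin n)) (fun ω => av (pot θ ω) (fun x => F (x, ω.2 + kv θ ω.1))) =
      EE (gam (Fin n)) (fun ω => (fun p : Om n => av (pot θ (0, p.2)) (fun x => F (x, p.2)))
        (ω.1, ω.2 + kv θ ω.1)) := by
    refine EE_congr (ae_of_all _ fun s J => ?_)
    dsimp only
    have : pot θ (s, J) = pot θ (0, J + kv θ s) := funext fun x => nis_shift hn b e s J x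
    rw [this]
  rw [e1, EE_plant hn b e hF, EE_plant hn b e hG.snd]
  congr 1
  refine integral_congr_ae (ae_of_all _ fun J => ?_)
  dsimp only
  have hZ := hA.good (ω := (0, J))
  rw [integral_const_mul, av, ← hθ]
  have := hZ.Zf_pos
  exact (div_mul_cancel₀ _ this.ne').symm

section
variable {b e : ℝ}

theorem nis_all (hn : n ≠ 0) (b e : ℝ) : ∃ K, AdmA (gam (Fin n)) K 1 (nis b e) :=
  ⟨_, ae_of_all _ fun s => admA_nis hn b e le_rfl le_rfl s⟩

theorem nis_Q2 (hn : n ≠ 0) : EE (gam (Fin n)) (aQ2 (nis b e)) = n := by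
  have h := nishimori hn b e (F := fun ω => nsq ω.1) (by unfold nsq; fun_prop)
  dsimp only at h
  refine h.symm.trans ?_
  rw [EE, integral_fun_fst]
  simp [integral_nsq]

theorem nis_Q4 (hn : n ≠ 0) : EE (gam (Fin n)) (aQ4 (nis b e)) = n ^ 2 + 2 * n := by
  have h := nishimori hn b e (F := fun ω => nsq ω.1 ^ 2) (by unfold nsq; fun_prop)
  dsimp only at h
  refine h.symm.trans ?_
  rw [EE, integral_fun_fst (f := fun s : Vec n => nsq s ^ 2)]
  simp [integral_nsq_sq]

theorem nis_S1 (hn : n ≠ 0) :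
    EE (gam (Fin n)) (aS1 (nis b e)) = EE (gam (Fin n)) (aR1 (nis b e)) := by
  set θ := nis b e with hθ
  have hA := admA_nis hn b e le_rfl le_rfl (n := n)
  have hG : ∀ i, PG (fun J : Ix n → ℝ => av (pot θ (0, J)) (fun x => x i)) := fun i =>
    PG.av_fix (hA 0) (f := fun p : Om n × Vec n => p.2 i) (by fun_prop)
  have h := nishimori hn b e (F := fun ω => ∑ i, ω.1 i * av (pot θ (0, ω.2)) (fun x => x i))
    (PG.sum _ fun i => ((PG.coord i).fst).mul (hG i).snd)
  have hp : ∀ s J, pot θ (0, J + kv θ s) = pot θ (s, J) :=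
    fun s J => funext fun x => (nis_shift hn b e s J x).symm
  refine Eq.trans (EE_congr (ae_of_all _ fun s J => ?_)) (h.trans
    (EE_congr (ae_of_all _ fun s J => ?_)))
  · dsimp only
    rw [← hθ, hp, aS1]
    unfold ip
    rw [av_sum (hA s).good _ fun i => (by fun_prop)]
    exact Finset.sum_congr rfl fun i _ => av_const_mul _ _
  · dsimp only
    rw [← hθ, hp, aR1, av_sum (hA s).good _ fun i => (by fun_prop)]
    exact Finset.sum_congr rfl fun i _ => by rw [av_mul_const]; ring

theorem nis_S2 (hn : n ≠ 0) :
    EE (gam (Fin n)) (aS2 (nis b e)) = EE (gam (Fin n)) (aR2 (nis b e)) := by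
  set θ := nis b e with hθ
  have hA := admA_nis hn b e le_rfl le_rfl (n := n)
  have hG : ∀ i j, PG (fun J : Ix n → ℝ => av (pot θ (0, J)) (fun x => x i * x j)) := fun i j =>
    PG.av_fix (hA 0) (f := fun p : Om n × Vec n => p.2 i * p.2 j) (by fun_prop)
  have h := nishimori hn b e (F := fun ω => ∑ i, ∑ j, ω.1 i * ω.1 j *
      av (pot θ (0, ω.2)) (fun x => x i * x j))
    (PG.sum _ fun i => PG.sum _ fun j => (((PG.coord i).mul (PG.coord j)).fst).mul (hG i j).snd)
  have hp : ∀ s J, pot θ (0, J + kv θ s) = pot θ (s, J) :=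
    fun s J => funext fun x => (nis_shift hn b e s J x).symm
  refine Eq.trans (EE_congr (ae_of_all _ fun s J => ?_)) (h.trans
    (EE_congr (ae_of_all _ fun s J => ?_)))
  · dsimp only
    rw [← hθ, hp, aS2]
    have e1 : (fun x : Vec n => ip s x ^ 2) = fun x => ∑ i, ∑ j, s i * s j * (x i * x j) := by
      ext x
      rw [ip, pow_two, Finset.sum_mul_sum]
      exact Finset.sum_congr rfl fun i _ => Finset.sum_congr rfl fun j _ => by ring
    dsimp only
    rw [e1, av_sum (hA s).good _ fun i => (by fun_prop)]
    refine Finset.sum_congr rfl fun i _ => ?_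
    rw [av_sum (hA s).good _ fun j => (by fun_prop)]
    exact Finset.sum_congr rfl fun j _ => av_const_mul _ _
  · dsimp only
    rw [← hθ, hp, aR2, av_sum (hA s).good _ fun i => (by fun_prop)]
    refine Finset.sum_congr rfl fun i _ => ?_
    rw [av_sum (hA s).good _ fun j => (by fun_prop)]
    exact Finset.sum_congr rfl fun j _ => by rw [av_mul_const]; ring

end

end

section

theorem phi_le_eventually {b a ε w : ℝ} (hb : 0 < b) (ha : 0 ≤ a)
    (hε : 0 ≤ ε) (hw : ε ≤ w) (haw : a < 1 + w) {δ : ℝ} (hδ : 0 < δ) :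
    ∀ᶠ n : ℕ in atTop, phi n b a ε ≤ ubf b a ε w + δ := by
  obtain ⟨C, hC⟩ := phi_le hb ha hε hw haw
  have h1 : Tendsto (fun n : ℕ => C / √(n : ℝ)) atTop (nhds 0) :=
    (Real.tendsto_sqrt_atTop.comp tendsto_natCast_atTop_atTop).const_div_atTop C
  filter_upwards [h1.eventually_lt_const hδ, eventually_ne_atTop 0] with n h2 h3
  linarith [hC n h3]

/-- Differentiable squeezing. -/
theorem tendsto_of_tangent {D : ℕ → ℝ} {G : ℝ → ℝ} {d r : ℝ} (hr : 0 < r) (hG0 : G 0 = 0)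
    (hG : HasDerivAt G d 0)
    (h : ∀ x, |x| < r → ∀ δ > 0, ∀ᶠ n in atTop, x * D n ≤ G x + δ) :
    Tendsto D atTop (nhds d) := by
  rw [Metric.tendsto_atTop']
  intro ε hε
  have h1 : ∀ᶠ x in nhds (0 : ℝ), |G x - x * d| ≤ ε / 4 * |x| := by
    have := (hasDerivAt_iff_isLittleO_nhds_zero.1 hG).def (by positivity : 0 < ε / 4)
    simpa [hG0] using this
  obtain ⟨ρ, hρ, h2⟩ := Metric.eventually_nhds_iff.1 h1
  set x := min ρ r / 2 with hx
  have hm : 0 < min ρ r := lt_min hρ hr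
  have hx0 : 0 < x := by positivity
  have hxρ : x < ρ := by have := min_le_left ρ r; linarith
  have hxr : x < r := by have := min_le_right ρ r; linarith
  have p1 := h2 (y := x) (by rw [Real.dist_eq, sub_zero, abs_of_pos hx0]; exact hxρ)
  have p2 := h2 (y := -x) (by rw [Real.dist_eq, sub_zero, abs_neg, abs_of_pos hx0]; exact hxρ)
  rw [abs_of_pos hx0] at p1
  rw [abs_neg, abs_of_pos hx0] at p2
  have e1 := h x (by rw [abs_of_pos hx0]; exact hxr) (ε / 4 * x) (by positivity)
  have e2 := h (-x) (by rw [abs_neg, abs_of_pos hx0]; exact hxr) (ε / 4 * x) (by positivity)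
  obtain ⟨N, hN⟩ := eventually_atTop.1 (e1.and e2)
  refine ⟨N, fun n hn => ?_⟩
  obtain ⟨q1, q2⟩ := hN n hn.le
  rw [Real.dist_eq, abs_lt]
  have a1 := (abs_le.1 p1).2
  have a2 := (abs_le.1 p2).2
  have b1 : x * D n < x * (d + ε) := by nlinarith
  have b2 : x * (d - ε) < x * D n := by nlinarith
  exact ⟨by linarith [lt_of_mul_lt_mul_left b2 hx0.le],
      by linarith [lt_of_mul_lt_mul_left b1 hx0.le]⟩

variable {n : ℕ}

theorem nis_step (hn : n ≠ 0) (b e b' e' : ℝ) :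
    EL n (nis b e) + (b' ^ 2 - b ^ 2) / (4 * n) * EE (gam (Fin n)) (aR2 (nis b e))
      + (e' ^ 2 - e ^ 2) / 2 * EE (gam (Fin n)) (aR1 (nis b e))
      - (b' - b) ^ 2 / 4 * (n + 2) - (e' - e) ^ 2 / 2 * n ≤ EL n (nis b' e') := by
  obtain ⟨K, hK⟩ := nis_all hn b e
  obtain ⟨K', hK'⟩ := nis_all hn b' e'
  have h := EL_increment_le mom_gam hn hK hK'
  have hn' : (0 : ℝ) < n := by positivity
  rw [nis_S2 hn, nis_S1 hn, nis_Q4 hn, nis_Q2 hn] at h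
  have r1 := EE_nonneg (ν := gam (Fin n)) (F := aR1 (nis b e))
    (ae_of_all _ fun s J => aR1_nonneg _ _)
  have r2 := EE_nonneg (ν := gam (Fin n)) (F := aR2 (nis b e))
    (ae_of_all _ fun s J => aR2_nonneg _ _)
  change EL n (nis b e) + _ + _ + _ + _ - _ - _ ≤ EL n (nis b' e') at h
  refine le_trans ?_ h
  generalize EE (gam (Fin n)) (aR2 (nis b e)) = R2 at *
  generalize EE (gam (Fin n)) (aR1 (nis b e)) = R1 at *
  have c1 : 0 ≤ (b' - b) ^ 2 / (4 * n) * R2 := by positivity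
  have c2 : 0 ≤ (e' - e) ^ 2 / 2 * R1 := by positivity
  simp only [nis]
  rw [← sub_nonneg]
  refine le_of_le_of_eq (add_nonneg c1 c2) ?_
  field_simp
  ring

theorem EL_nis_zero (hn : n ≠ 0) (e : ℝ) :
    EL n (nis 0 e) = n * (1 / 2 * Real.log (2 * Real.pi) +
      (1 / 2 * e ^ 2 - 1 / 2 * Real.log (1 + e ^ 2))) := by
  obtain ⟨K, hK⟩ := nis_all hn 0 e
  have hn' : (0 : ℝ) < n := by positivity
  have hP : PG (nsq : Vec n → ℝ) := by unfold nsq; fun_prop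
  rw [EL, EE, integral_prod _ (hK.lpg_log.integrable mom_gam)]
  have hτ : 0 < 1 + e ^ 2 := by positivity
  have h : ∀ s : Vec n, ∫ J, Real.log (Zf (pot (nis 0 e) (s, J))) ∂gam (Ix n) =
      n / 2 * (Real.log (2 * Real.pi) - Real.log (1 + e ^ 2)) + e ^ 2 * n / (2 * (1 + e ^ 2)) +
        e ^ 4 / (2 * (1 + e ^ 2)) * nsq s := by
    intro s
    rw [integral_log_Zf_decoupled hn rfl (by simp [nis]) (by simp [nis]) hτ s
      (by simp [nis]; exact hτ)]
    simp [nis]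
    field_simp
    ring
  simp_rw [h]
  rw [integral_add (integrable_const _) (hP.integrable_gam.const_mul _), integral_const_mul,
    integral_nsq]
  simp
  field_simp
  ring

theorem nis_lb (hn : n ≠ 0) {b e w : ℝ} (hb : b ≠ 0) (he : 0 ≤ e) (hw : e ^ 2 ≤ w) :
    n * (1 / 2 * Real.log (2 * Real.pi) + (1 / 2 * w - 1 / 2 * Real.log (1 + w)
      - (w - e ^ 2) ^ 2 / (4 * b ^ 2))) ≤ EL n (nis b e) := by
  set q := (w - e ^ 2) / b ^ 2 with hq
  have hw0 : 0 ≤ w := (sq_nonneg e).trans hw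
  have hq0 : 0 ≤ q := div_nonneg (by linarith) (sq_nonneg b)
  have hbq : b ^ 2 * q = w - e ^ 2 := by rw [hq]; field_simp
  have hn' : (0 : ℝ) < n := by positivity
  set bb : ℝ → ℝ := fun r => b * Real.sin r with hbb
  set ee : ℝ → ℝ := fun r => √(e ^ 2 + b ^ 2 * q * Real.cos r ^ 2) with hee
  have key := le_of_quasi_mono (h := fun r => EL n (nis (bb r) (ee r)) +
    n * b ^ 2 * q ^ 2 / 4 * Real.sin r ^ 2) (C := b ^ 2 / 4 * (n + 2) + b ^ 2 * q / 2 * n)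
    (L := Real.pi / 2) (by positivity) ?_
  · have s1 : e ^ 2 + b ^ 2 * q = w := by rw [hbq]; ring
    have s2 : n * b ^ 2 * q ^ 2 / 4 = n * ((w - e ^ 2) ^ 2 / (4 * b ^ 2)) := by
      rw [hq]; field_simp
    simp only [hbb, hee, Real.sin_zero, Real.cos_zero, Real.sin_pi_div_two, Real.cos_pi_div_two]
      at key
    norm_num [Real.sqrt_sq he] at key
    rw [s1, EL_nis_zero hn, Real.sq_sqrt hw0, s2] at key
    linarith
  · intro x y hx hxy hy
    have hs := nis_step hn (bb x) (ee x) (bb y) (ee y)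
    obtain ⟨K, hK⟩ := nis_all hn (bb x) (ee x)
    have hR := EE_R_ge mom_gam hK (n * q)
    have g0 : Real.sin x ^ 2 ≤ Real.sin y ^ 2 := by
      have := Real.sin_le_sin_of_le_of_le_pi_div_two (x := x) (y := y) (by linarith) hy hxy
      have h0 := Real.sin_nonneg_of_nonneg_of_le_pi hx (by linarith [Real.pi_pos])
      gcongr
    generalize EE (gam (Fin n)) (aR2 (nis (bb x) (ee x))) = R2 at *
    generalize EE (gam (Fin n)) (aR1 (nis (bb x) (ee x))) = R1 at *
    generalize EL n (nis (bb x) (ee x)) = E1 at *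
    generalize EL n (nis (bb y) (ee y)) = E2 at *
    have es := sq_sin_sub_le y x
    have ec := sq_cos_sub_le y x
    have er := sq_sqrt_sub_le (sq_nonneg e) (mul_nonneg (sq_nonneg b) hq0) (Real.cos y) (Real.cos x)
    have ex := Real.sq_sqrt (by positivity : 0 ≤ e ^ 2 + b ^ 2 * q * Real.cos x ^ 2)
    have ey := Real.sq_sqrt (by positivity : 0 ≤ e ^ 2 + b ^ 2 * q * Real.cos y ^ 2)
    simp only [hbb, hee] at hs
    rw [ex, ey] at hs
    have er' : (√(e ^ 2 + b ^ 2 * q * Real.cos y ^ 2) - √(e ^ 2 + b ^ 2 * q * Real.cos x ^ 2)) ^ 2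
        / 2 * n ≤ b ^ 2 * q * (x - y) ^ 2 / 2 * n := by
      have := er.trans (mul_le_mul_of_nonneg_left ec (mul_nonneg (sq_nonneg b) hq0))
      gcongr
    have eb' : (b * Real.sin y - b * Real.sin x) ^ 2 / 4 * (n + 2) ≤
        b ^ 2 * (x - y) ^ 2 / 4 * (n + 2) := by
      rw [← mul_sub, mul_pow]
      gcongr
    have hcx : Real.cos x ^ 2 = 1 - Real.sin x ^ 2 := by linarith [Real.sin_sq_add_cos_sq x]
    have hcy : Real.cos y ^ 2 = 1 - Real.sin y ^ 2 := by linarith [Real.sin_sq_add_cos_sq y]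
    have e3 : b ^ 2 * (Real.sin y ^ 2 - Real.sin x ^ 2) / (4 * n) * -((n * q) ^ 2) ≤
        b ^ 2 * (Real.sin y ^ 2 - Real.sin x ^ 2) / (4 * n) * (R2 - 2 * (n * q) * R1) := by
      have : 0 ≤ b ^ 2 * (Real.sin y ^ 2 - Real.sin x ^ 2) / (4 * n) := by
        have := sub_nonneg.2 g0
        positivity
      gcongr
    have e4 : b ^ 2 * (Real.sin y ^ 2 - Real.sin x ^ 2) / (4 * n) * -((n * q) ^ 2) =
        n * b ^ 2 * q ^ 2 / 4 * Real.sin x ^ 2 - n * b ^ 2 * q ^ 2 / 4 * Real.sin y ^ 2 := by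
      field_simp; ring
    have e5 : b ^ 2 * (Real.sin y ^ 2 - Real.sin x ^ 2) / (4 * n) * (R2 - 2 * (n * q) * R1) =
        ((b * Real.sin y) ^ 2 - (b * Real.sin x) ^ 2) / (4 * n) * R2 +
         (e ^ 2 + b ^ 2 * q * (1 - Real.sin y ^ 2) - (e ^ 2 + b ^ 2 * q * (1 - Real.sin x ^ 2))) / 2
          * R1 := by
      field_simp; ring
    rw [hcx, hcy] at hs er'
    rw [e4, e5] at e3
    have e6 : (b ^ 2 / 4 * (n + 2) + b ^ 2 * q / 2 * n) * (y - x) ^ 2 =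
      b ^ 2 * (x - y) ^ 2 / 4 * (n + 2) + b ^ 2 * q * (x - y) ^ 2 / 2 * n := by ring
    rw [e6]
    linarith

theorem st_eq_nis {b e : ℝ} (he : 0 ≤ e) : st b (b ^ 2) (e ^ 2) = nis b e := by
  simp [st, nis, Real.sqrt_sq he]

end

theorem ubf_nis {b w ε : ℝ} (hb : 0 < b) (hw : 0 < w) (hbw : b ^ 2 < 1 + w)
    (hε : ε = w * (1 + w - b ^ 2) / (1 + w)) :
    ubf b (b ^ 2) ε w = 1 / 2 * w - 1 / 2 * Real.log (1 + w) - (w - ε) ^ 2 / (4 * b ^ 2) := by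
  have h1 : 1 + w - b ^ 2 ≠ 0 := by linarith
  have h2 : 1 + w ≠ 0 := by positivity
  rw [ubf, hε]
  field_simp
  ring

theorem phi_nis_ge {n : ℕ} (hn : n ≠ 0) {b w e : ℝ} (hb : 0 < b) (he : 0 ≤ e) (hew : e ^ 2 ≤ w) :
    1 / 2 * w - 1 / 2 * Real.log (1 + w) - (w - e ^ 2) ^ 2 / (4 * b ^ 2)
      ≤ phi n b (b ^ 2) (e ^ 2) := by
  have h := nis_lb hn hb.ne' he hew
  have hn' : (0 : ℝ) < n := by positivity
  rw [phi, st_eq_nis he, le_sub_iff_add_le, le_div_iff₀ hn']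
  linarith

theorem hasDerivAt_sqrt_sub_sq {t : ℝ} (ht : 0 < t) :
    HasDerivAt (fun h => (√(t + h) - √t) ^ 2) 0 0 := by
  have h1 : HasDerivAt (fun h : ℝ => √(t + h)) (1 / (2 * √(t + 0))) 0 :=
    ((hasDerivAt_id' (0 : ℝ)).const_add t).sqrt (by simpa using ht.ne')
  have h2 := (h1.sub_const (√t)).fun_pow 2
  simpa using h2

theorem tendsto_nis_R1 {b w e : ℝ} (hb : 0 < b) (hw : 0 < w) (hbw : b ^ 2 < 1 + w) (he : 0 < e)
    (hε : e ^ 2 = w * (1 + w - b ^ 2) / (1 + w)) :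
    Tendsto (fun n : ℕ => EE (gam (Fin n)) (aR1 (nis b e)) / n) atTop (nhds (w / (1 + w))) := by
  have hew : e ^ 2 < w := by
    rw [hε, div_lt_iff₀ (by positivity)]; nlinarith [mul_pos hw (pow_pos hb 2)]
  have hr : 0 < min (e ^ 2) (w - e ^ 2) := lt_min (by positivity) (by linarith)
  have key := tendsto_of_tangent (D := fun n : ℕ => EE (gam (Fin n)) (aR1 (nis b e)) / (2 * n))
    (G := fun h => ubf b (b ^ 2) (e ^ 2 + h) w - ubf b (b ^ 2) (e ^ 2) w
      + (√(e ^ 2 + h) - √(e ^ 2)) ^ 2 / 2) (d := w / (1 + w) / 2) hr (by simp) ?_ ?_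
  · have := key.const_mul 2
    refine (this.congr fun n => ?_).trans_eq ?_
    · rw [mul_div_assoc', mul_div_mul_left _ _ two_ne_zero]
    · congr 1; ring
  · have h0 := (hasDerivAt_id' (0 : ℝ)).const_add (e ^ 2)
    have h1 := ((((h0.const_sub w).pow 2).div_const (4 * b ^ 2)).add_const (w / (2 * (1 + w)))
      |>.sub_const (1 / 2 * Real.log (1 + w))).add ((h0.pow 2).div_const (2 * (1 + w - b ^ 2)))
    have h2 := (h1.sub_const (ubf b (b ^ 2) (e ^ 2) w)).add
      ((hasDerivAt_sqrt_sub_sq (t := e ^ 2) (by positivity)).div_const 2)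
    refine (h2.congr_deriv ?_)
    have g1 : 1 + w - b ^ 2 ≠ 0 := by linarith
    have g2 : 1 + w ≠ 0 := by positivity
    simp only [add_zero, Nat.cast_ofNat, Nat.add_one_sub_one, pow_one, zero_div]
    rw [hε]
    field_simp
    ring
  · intro x hx δ hδ
    have hx1 := (abs_lt.1 hx).1
    have hx2 := (abs_lt.1 hx).2
    have m1 := min_le_left (e ^ 2) (w - e ^ 2)
    have m2 := min_le_right (e ^ 2) (w - e ^ 2)
    have hp : 0 ≤ e ^ 2 + x := by linarith
    filter_upwards [phi_le_eventually (ε := e ^ 2 + x) hb (sq_nonneg b) hp (by linarith) hbw hδ,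
      eventually_ne_atTop 0] with n h1 hn
    have hn' : (0 : ℝ) < n := by positivity
    have h2 := nis_step hn b e b √(e ^ 2 + x)
    have h3 := phi_nis_ge hn hb he.le hew.le
    rw [← ubf_nis hb hw hbw hε] at h3
    rw [phi, st_eq_nis he.le] at h3
    have h4 := st_eq_nis (b := b) (Real.sqrt_nonneg (e ^ 2 + x))
    rw [Real.sq_sqrt hp] at h4 h2
    rw [phi, h4] at h1
    rw [Real.sqrt_sq he.le]
    have h5 := (div_le_div_iff_of_pos_right hn').2 h2
    have h6 : (EL n (nis b e) + (b ^ 2 - b ^ 2) / (4 * n) * EE (gam (Fin n)) (aR2 (nis b e))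
      + (e ^ 2 + x - e ^ 2) / 2 * EE (gam (Fin n)) (aR1 (nis b e))
      - (b - b) ^ 2 / 4 * (n + 2) - (√(e ^ 2 + x) - e) ^ 2 / 2 * n) / n =
      EL n (nis b e) / n + x * (EE (gam (Fin n)) (aR1 (nis b e)) / (2 * n)) -
        (√(e ^ 2 + x) - e) ^ 2 / 2 := by
      field_simp; ring
    rw [h6] at h5
    linarith

theorem tendsto_nis_R2 {b w e : ℝ} (hb : 0 < b) (hw : 0 < w) (hbw : b ^ 2 < 1 + w) (he : 0 < e)
    (hε : e ^ 2 = w * (1 + w - b ^ 2) / (1 + w)) :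
    Tendsto (fun n : ℕ => EE (gam (Fin n)) (aR2 (nis b e)) / (n : ℝ) ^ 2) atTop
      (nhds ((w / (1 + w)) ^ 2)) := by
  have hew : e ^ 2 < w := by
    rw [hε, div_lt_iff₀ (by positivity)]; nlinarith [mul_pos hw (pow_pos hb 2)]
  have hr : 0 < min (b ^ 2) (1 + w - b ^ 2) := lt_min (by positivity) (by linarith)
  have key := tendsto_of_tangent (D := fun n : ℕ => EE (gam (Fin n)) (aR2 (nis b e)) / (4 * n ^ 2))
    (G := fun h => ((w - e ^ 2) ^ 2 / (4 * (b ^ 2 + h)) + (e ^ 2) ^ 2 / (2 * (1 + w - (b ^ 2 + h))))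
      - ((w - e ^ 2) ^ 2 / (4 * b ^ 2) + (e ^ 2) ^ 2 / (2 * (1 + w - b ^ 2)))
      + 3 / 4 * (√(b ^ 2 + h) - √(b ^ 2)) ^ 2) (d := (w / (1 + w)) ^ 2 / 4) hr (by simp) ?_ ?_
  · have := key.const_mul 4
    refine (this.congr fun n => ?_).trans_eq ?_
    · rw [mul_div_assoc', mul_div_mul_left _ _ four_ne_zero]
    · congr 1; ring
  · have g1 : 1 + w - b ^ 2 ≠ 0 := by linarith
    have g2 : 1 + w ≠ 0 := by positivity
    have h0 := (hasDerivAt_id' (0 : ℝ)).const_add (b ^ 2)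
    have h1 := ((hasDerivAt_const (0 : ℝ) ((w - e ^ 2) ^ 2)).div (h0.const_mul 4)
        (by positivity)).add
      ((hasDerivAt_const (0 : ℝ) ((e ^ 2) ^ 2)).div ((h0.const_sub (1 + w)).const_mul 2)
        (by simpa using g1))
    have h2 := (h1.sub_const
      ((w - e ^ 2) ^ 2 / (4 * b ^ 2) + (e ^ 2) ^ 2 / (2 * (1 + w - b ^ 2)))).add
      ((hasDerivAt_sqrt_sub_sq (t := b ^ 2) (by positivity)).const_mul (3 / 4))
    refine (h2.congr_deriv ?_)
    simp only [add_zero, mul_zero, zero_mul]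
    rw [hε]
    field_simp
    ring
  · intro x hx δ hδ
    have hx1 := (abs_lt.1 hx).1
    have hx2 := (abs_lt.1 hx).2
    have m1 := min_le_left (b ^ 2) (1 + w - b ^ 2)
    have m2 := min_le_right (b ^ 2) (1 + w - b ^ 2)
    have hp : 0 < b ^ 2 + x := by linarith
    filter_upwards [phi_le_eventually (b := √(b ^ 2 + x)) (a := b ^ 2 + x) (ε := e ^ 2)
      (Real.sqrt_pos.2 hp) hp.le (sq_nonneg e) hew.le (by linarith) hδ,
      eventually_ne_atTop 0] with n h1 hn
    have hn' : (0 : ℝ) < n := by positivity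
    have hn1 : (1 : ℝ) ≤ n := by exact_mod_cast Nat.one_le_iff_ne_zero.2 hn
    have h2 := nis_step hn b e √(b ^ 2 + x) e
    have h3 := phi_nis_ge hn hb he.le hew.le
    rw [← ubf_nis hb hw hbw hε] at h3
    rw [phi, st_eq_nis he.le, ubf] at h3
    have h4 := st_eq_nis (b := √(b ^ 2 + x)) he.le
    rw [Real.sq_sqrt hp.le] at h4 h2
    rw [phi, h4, ubf, Real.sq_sqrt hp.le] at h1
    rw [Real.sqrt_sq hb.le]
    have h5 := (div_le_div_iff_of_pos_right hn').2 h2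
    have h6 : (EL n (nis b e) + (b ^ 2 + x - b ^ 2) / (4 * n) * EE (gam (Fin n)) (aR2 (nis b e))
      + (e ^ 2 - e ^ 2) / 2 * EE (gam (Fin n)) (aR1 (nis b e))
      - (√(b ^ 2 + x) - b) ^ 2 / 4 * (n + 2) - (e - e) ^ 2 / 2 * n) / n =
      EL n (nis b e) / n + x * (EE (gam (Fin n)) (aR2 (nis b e)) / (4 * n ^ 2)) -
        (√(b ^ 2 + x) - b) ^ 2 / 4 * ((n + 2) / n) := by
      field_simp; ring
    have h7 : (√(b ^ 2 + x) - b) ^ 2 / 4 * ((n + 2) / n) ≤ (√(b ^ 2 + x) - b) ^ 2 / 4 * 3 := by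
      gcongr
      rw [div_le_iff₀ hn']; linarith
    rw [h6] at h5
    linarith

section

variable {n : ℕ}

@[fun_prop] theorem PG.nsq_id : PG (fun x : Vec n => nsq x) := by unfold nsq; fun_prop
@[fun_prop] theorem PG.ip_left (y : Vec n) : PG (fun x : Vec n => ip x y) := by unfold ip; fun_prop
@[fun_prop] theorem PG.ip_right (y : Vec n) : PG (fun x : Vec n => ip y x) := by unfold ip; fun_prop
@[fun_prop] theorem PG.gx_id (J : Ix n → ℝ) : PG (fun x : Vec n => gx J x) := by unfold gx; fun_prop

/-- Gibbs mean. -/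
def mean (U : Vec n → ℝ) : Vec n := fun i => av U (fun x => x i)

/-- Correlation of the squared norm with the overlap. -/
def aT3 (U : Vec n → ℝ) : ℝ := av U (fun x => nsq x * ip x (mean U))

/-- Squared overlap with the Gibbs mean. -/
def aT4 (U : Vec n → ℝ) : ℝ := av U (fun x => ip x (mean U) ^ 2)

/-- Polarized noise form. -/
def xb (J : Ix n → ℝ) (x y : Vec n) : ℝ :=
  ∑ p : Fin n × Fin n, J (Sum.inl p) * (cf n p.1 p.2 * (x p.1 * y p.2 + y p.1 * x p.2))

@[fun_prop] theorem PG.xb_left (J : Ix n → ℝ) (y : Vec n) : PG (fun x : Vec n => xb J x y) := by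
  unfold xb; fun_prop

theorem av_ip {U : Vec n → ℝ} (hU : Good U) (y : Vec n) : av U (fun x => ip x y) = ip (mean U) y :=
  (sum_av_mul hU y).symm

theorem av_ip' {U : Vec n → ℝ} (hU : Good U) (y : Vec n) :
    av U (fun x => ip y x) = ip y (mean U) := by
  simp_rw [ip_comm y]; exact av_ip hU y

theorem av_gx {U : Vec n → ℝ} (hU : Good U) (J : Ix n → ℝ) :
    av U (fun x => gx J x) = gx J (mean U) := by
  unfold gx
  rw [av_sum hU _ fun i => (by fun_prop)]
  simp_rw [av_const_mul]; rfl

theorem av_xb {U : Vec n → ℝ} (hU : Good U) (J : Ix n → ℝ) :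
    av U (fun x => xb J x (mean U)) = 2 * xw J (mean U) := by
  unfold xb
  rw [av_sum hU _ fun i => (by fun_prop), xw, Finset.mul_sum]
  refine Finset.sum_congr rfl fun p _ => ?_
  rw [av_const_mul, av_const_mul, av_add hU (by fun_prop) (by fun_prop), av_mul_const, av_const_mul]
  simp only [mean]
  ring

theorem xw_add_smul (J : Ix n → ℝ) (x v : Vec n) (t : ℝ) :
    xw J (x + t • v) = xw J x + t * xb J x v + t ^ 2 * xw J v := by
  unfold xw xb
  rw [Finset.mul_sum, Finset.mul_sum, ← Finset.sum_add_distrib, ← Finset.sum_add_distrib]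
  refine Finset.sum_congr rfl fun p _ => ?_
  simp only [Pi.add_apply, Pi.smul_apply, smul_eq_mul]
  ring

theorem gx_add_smul (J : Ix n → ℝ) (x v : Vec n) (t : ℝ) :
    gx J (x + t • v) = gx J x + t * gx J v := by
  unfold gx
  rw [Finset.mul_sum, ← Finset.sum_add_distrib]
  refine Finset.sum_congr rfl fun p _ => ?_
  simp only [Pi.add_apply, Pi.smul_apply, smul_eq_mul]
  ring

theorem nsq_add_smul (x v : Vec n) (t : ℝ) :
    nsq (x + t • v) = nsq x + 2 * t * ip x v + t ^ 2 * nsq v := by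
  rw [nsq_add, nsq_smul, ip_smul_right]; ring

theorem pot_add_smul (θ : Par) (ω : Om n) (x v : Vec n) (t : ℝ) :
    pot θ ω (x + t • v) = pot θ ω x
      + (t * θ.b) * xb ω.2 x v + (t * θ.a / n * ip ω.1 v) * ip ω.1 x
      + (-(t * θ.τ) - θ.d / n * t ^ 3 * nsq v) * ip x v
      + (-(θ.d / n * t)) * (nsq x * ip x v) + (-(θ.d / n * t ^ 2)) * ip x v ^ 2
      + (-(θ.d / (2 * n) * t ^ 2 * nsq v)) * nsq x
      + (t ^ 2 * (θ.b * xw ω.2 v + θ.a / (2 * n) * ip ω.1 v ^ 2 - θ.τ / 2 * nsq v)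
        + t * (θ.e * gx ω.2 v + θ.f * ip ω.1 v) - θ.d / (4 * n) * t ^ 4 * nsq v ^ 2) := by
  unfold pot
  rw [xw_add_smul, gx_add_smul, nsq_add_smul, ip_add_right, ip_smul_right]
  ring

theorem av_pot_shift {U : Vec n → ℝ} (hU : Good U) (θ : Par) (ω : Om n) (t : ℝ) :
    av U (fun x => pot θ ω (x + t • mean U)) = av U (pot θ ω)
      + (2 * t + t ^ 2) * (θ.b * xw ω.2 (mean U) + θ.a / (2 * n) * ip ω.1 (mean U) ^ 2
        - θ.τ / 2 * nsq (mean U))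
      + t * (θ.e * gx ω.2 (mean U) + θ.f * ip ω.1 (mean U))
      - θ.d / (4 * n) * (4 * t * aT3 U + 4 * t ^ 2 * aT4 U + 2 * t ^ 2 * (nsq (mean U) * av U nsq)
        + (4 * t ^ 3 + t ^ 4) * nsq (mean U) ^ 2) := by
  have hp : PG (fun x => pot θ ω x) := PG.pot_vec θ ω
  simp_rw [pot_add_smul]
  rw [av_add hU (by fun_prop) (by fun_prop), av_add hU (by fun_prop) (by fun_prop),
    av_add hU (by fun_prop) (by fun_prop), av_add hU (by fun_prop) (by fun_prop),
    av_add hU (by fun_prop) (by fun_prop), av_add hU (by fun_prop) (by fun_prop),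
    av_add hU (by fun_prop) (by fun_prop), av_const hU]
  simp_rw [av_const_mul]
  rw [av_xb hU, av_ip hU, av_ip' hU, ← aT3, ← aT4, ip_self]
  change av U (pot θ ω) + _ + _ + _ + _ + _ + _ * av U nsq + _ = _
  ring

theorem Good.affine {V : Vec n → ℝ} (hV : Good V) {κ : ℝ} (hκ : 0 < κ) (m : Vec n) :
    Good (fun x => V (κ • (x + m))) := by
  obtain ⟨hm, C, η, hη, h⟩ := hV
  refine ⟨hm.comp (by fun_prop), C + η * κ ^ 2 * nsq m, η * κ ^ 2 / 2, by positivity, fun x => ?_⟩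
  have h1 := h (κ • (x + m))
  rw [nsq_smul] at h1
  have h2 : nsq x ≤ 2 * nsq (x + m) + 2 * nsq m := by
    rw [nsq_add]
    have h3 := nsq_nonneg (x + (2 : ℝ) • m)
    rw [nsq_add_smul] at h3
    nlinarith
  nlinarith [mul_le_mul_of_nonneg_left h2 (by positivity : 0 ≤ η * κ ^ 2 / 2)]

theorem PG.pot_affine (θ : Par) (ω : Om n) (κ : ℝ) (m : Vec n) :
    PG (fun x => pot θ ω (κ • (x + m))) := by
  simp only [pot, xw, gx, ip, nsq, Pi.smul_apply, Pi.add_apply, smul_eq_mul]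
  fun_prop

theorem pot_smul (θ : Par) (ω : Om n) (κ : ℝ) (x : Vec n) :
    pot θ ω (κ • x) = pot ⟨θ.b * κ ^ 2, θ.a * κ ^ 2, θ.e * κ, θ.f * κ, θ.τ * κ ^ 2, θ.d * κ ^ 4⟩
      ω x := by
  have h1 : xw ω.2 (κ • x) = κ ^ 2 * xw ω.2 x := by
    unfold xw; rw [Finset.mul_sum]
    exact Finset.sum_congr rfl fun p _ => by simp only [Pi.smul_apply, smul_eq_mul]; ring
  have h2 : gx ω.2 (κ • x) = κ * gx ω.2 x := by
    unfold gx; rw [Finset.mul_sum]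
    exact Finset.sum_congr rfl fun p _ => by simp only [Pi.smul_apply, smul_eq_mul]; ring
  unfold pot
  rw [h1, h2, ip_smul_right, nsq_smul]
  ring

theorem eq_zero_of_quartic {α β γ δ : ℝ}
    (h : ∀ t : ℝ, α * t + β * t ^ 2 + γ * t ^ 3 + δ * t ^ 4 ≤ 0) :
    α = 0 := by
  have hd : HasDerivAt (fun t : ℝ => α * t + β * t ^ 2 + γ * t ^ 3 + δ * t ^ 4) α 0 := by
    have h0 := hasDerivAt_id' (0 : ℝ)
    refine ((((h0.const_mul α).add ((h0.fun_pow 2).const_mul β)).add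
      ((h0.fun_pow 3).const_mul γ)).add ((h0.fun_pow 4).const_mul δ)).congr_deriv ?_
    simp
  have hm : IsLocalMax (fun t : ℝ => α * t + β * t ^ 2 + γ * t ^ 3 + δ * t ^ 4) 0 :=
    Eventually.of_forall fun t => by simpa using h t
  exact hm.hasDerivAt_eq_zero hd

/-- Invariance of the partition function under translation along the Gibbs mean. -/
theorem stationarity {θ : Par} {ω : Om n} (hU : Good (pot θ ω)) :
    2 * (θ.b * xw ω.2 (mean (pot θ ω)) + θ.a / (2 * n) * ip ω.1 (mean (pot θ ω)) ^ 2) =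
      θ.τ * nsq (mean (pot θ ω)) - (θ.e * gx ω.2 (mean (pot θ ω)) + θ.f * ip ω.1 (mean (pot θ ω)))
        + θ.d / n * aT3 (pot θ ω) := by
  set U := pot θ ω with hUd
  rw [← sub_eq_zero]
  refine eq_zero_of_quartic (β := θ.b * xw ω.2 (mean U) + θ.a / (2 * n) * ip ω.1 (mean U) ^ 2
        - θ.τ / 2 * nsq (mean U)
      - θ.d / (4 * n) * (4 * aT4 U + 2 * (nsq (mean U) * av U nsq)))
    (γ := -(θ.d / n * nsq (mean U) ^ 2)) (δ := -(θ.d / (4 * n) * nsq (mean U) ^ 2)) fun t => ?_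
  have hp : PG (fun x => U x) := PG.pot_vec θ ω
  have hp' : PG (fun x => U (x + t • mean U)) := by
    simpa using PG.pot_affine θ ω 1 (t • mean U)
  have h := log_Zf_ge_affine hU one_pos (t • mean U) (hU.affine one_pos _) (by
    simp only [one_smul]; exact hp'.sub hp)
  simp only [one_smul, Real.log_one, mul_zero, add_zero] at h
  rw [av_sub hU hp' hp] at h
  have h2 := av_pot_shift hU θ ω t
  rw [← hUd] at h2
  rw [h2] at h
  have : av U (fun x => U x) = av U U := rfl
  rw [this] at h
  refine le_of_eq_of_le ?_ (add_le_iff_nonpos_right _ |>.1 h)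
  ring

end

section

variable {n : ℕ}

/-- Variational lower bound with a rescaled and shifted planted posterior as trial measure. -/
theorem log_Zf_trial {b c e κ : ℝ} {ω : Om n} (hU : Good (pot (nis c e) ω)) (hκ : 0 < κ)
    (hbκ : b * κ ^ 2 = c) (hV : Good (pot (st b (c * b) 0) ω)) (t : ℝ) :
    Real.log (Zf (pot (nis c e) ω)) + n * Real.log κ
      + ((2 * t + t ^ 2) * (1 / 2 * ((1 + e ^ 2 - κ ^ 2) * aR1 (nis c e) ω
        - (e * av (pot (nis c e) ω) (fun x => gx ω.2 x) + e ^ 2 * aS1 (nis c e) ω)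
        + c ^ 2 / n * aT3 (pot (nis c e) ω)))
        - (e * av (pot (nis c e) ω) (fun x => gx ω.2 x) + e ^ 2 * aS1 (nis c e) ω)
        + (1 + e ^ 2 - κ ^ 2) / 2 * aQ2 (nis c e) ω
        - c ^ 2 / (4 * n) * (4 * t * aT3 (pot (nis c e) ω) + 4 * t ^ 2 * aT4 (pot (nis c e) ω)
          + 2 * t ^ 2 * (aR1 (nis c e) ω * aQ2 (nis c e) ω)
          + (4 * t ^ 3 + t ^ 4) * aR1 (nis c e) ω ^ 2))
      ≤ Real.log (Zf (pot (st b (c * b) 0) ω)) := by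
  have hst := stationarity hU
  set U := pot (nis c e) ω with hUd
  set θ' : Par := ⟨c, c ^ 2, 0, 0, κ ^ 2, c ^ 2⟩ with hθ'
  have hVe : ∀ x, pot (st b (c * b) 0) ω (κ • (x + t • mean U)) = pot θ' ω (x + t • mean U) := by
    intro x
    rw [pot_smul]
    congr 1
    simp only [st, hθ', Real.sqrt_zero, zero_mul, add_zero, one_mul, Par.mk.injEq, true_and]
    refine ⟨hbκ, ?_, ?_⟩
    · rw [mul_assoc, hbκ, pow_two]
    · rw [← hbκ]; ring
  have hp : PG (fun x => U x) := PG.pot_vec _ ω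
  have hpθ : PG (fun x => pot θ' ω x) := PG.pot_vec _ ω
  have hp' : PG (fun x => pot θ' ω (x + t • mean U)) := by
    simpa using PG.pot_affine θ' ω 1 (t • mean U)
  have h := log_Zf_ge_affine hU hκ (t • mean U) (hV.affine hκ _) (by
    simp only [hVe]; exact hp'.sub hp)
  simp only [hVe] at h
  rw [av_sub hU hp' hp, av_pot_shift hU, Fintype.card_fin] at h
  have h1 : (fun x => pot θ' ω x) = fun x => U x + (-e * gx ω.2 x + (-e ^ 2 * ip ω.1 x +
      (1 + e ^ 2 - κ ^ 2) / 2 * nsq x)) := by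
    ext x
    simp only [hUd, pot, nis, hθ']
    ring
  have h2 : av U (pot θ' ω) = av U U + (-e * av U (fun x => gx ω.2 x) + (-e ^ 2 * ip ω.1 (mean U) +
      (1 + e ^ 2 - κ ^ 2) / 2 * av U nsq)) := by
    change av U (fun x => pot θ' ω x) = _
    rw [h1, av_add hU hp (by fun_prop), av_add hU (by fun_prop) (by fun_prop),
      av_add hU (by fun_prop) (by fun_prop), av_const_mul, av_const_mul, av_const_mul, av_ip' hU]
  rw [h2] at h
  refine le_of_eq_of_le ?_ h
  have e1 : av U (fun x => U x) = av U U := rfl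
  have e2 : aS1 (nis c e) ω = ip ω.1 (mean U) := av_ip' hU _
  have e3 : av U (fun x => gx ω.2 x) = gx ω.2 (mean U) := av_gx hU _
  have e4 : aR1 (nis c e) ω = nsq (mean U) := rfl
  have e5 : aQ2 (nis c e) ω = av U nsq := rfl
  rw [e1, e2, e3, e4, e5]
  simp only [hθ']
  simp only [nis] at hst
  linear_combination (-(2 * t + t ^ 2) / 2) * hst

theorem aT3_eq {U : Vec n → ℝ} (hU : Good U) :
    aT3 U = ∑ i, av U (fun x => nsq x * x i) * av U (fun x => x i) := by
  unfold aT3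
  have : (fun x : Vec n => nsq x * ip x (mean U)) =
      fun x => ∑ i, nsq x * x i * av U (fun x => x i) := by
    ext x; rw [ip, Finset.mul_sum]
    exact Finset.sum_congr rfl fun i _ => by rw [mean]; ring
  rw [this, av_sum hU _ fun i => (by fun_prop)]
  simp_rw [av_mul_const]

theorem aT4_eq {U : Vec n → ℝ} (hU : Good U) :
    aT4 U = ∑ i, ∑ j, av U (fun x => x i * x j) * (av U (fun x => x i) * av U (fun x => x j)) := by
  unfold aT4
  have : (fun x : Vec n => ip x (mean U) ^ 2) =
      fun x => ∑ i, ∑ j, x i * x j * (av U (fun x => x i) * av U (fun x => x j)) := by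
    ext x; rw [ip, pow_two, Finset.sum_mul_sum]
    exact Finset.sum_congr rfl fun i _ => Finset.sum_congr rfl fun j _ => by simp only [mean]; ring
  rw [this, av_sum hU _ fun i => (by fun_prop)]
  refine Finset.sum_congr rfl fun i _ => ?_
  rw [av_sum hU _ fun i => (by fun_prop)]
  simp_rw [av_mul_const]

theorem aR1_sq_le_aT4 {θ : Par} {ω : Om n} (hU : Good (pot θ ω)) :
    aR1 θ ω ^ 2 ≤ aT4 (pot θ ω) := by
  have h := av_sq_le hU (f := fun x => ip x (mean (pot θ ω))) (by fun_prop)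
  rwa [av_ip hU, ip_self] at h

theorem aT4_le {K η : ℝ} {θ : Par} {ω : Om n} (h : Adm n K η θ ω.1) :
    aT4 (pot θ ω) ≤ aR2 θ ω := by
  have h0 := aR1_sq_le h
  set v : Vec n := mean (pot θ ω) with hv
  rw [aT4_eq h.good]
  have h4 : (∑ i, ∑ j, av (pot θ ω) (fun x => x i * x j) * (v i * v j)) ≤
      ∑ i, ∑ j, (1 / 2 * av (pot θ ω) (fun x => x i * x j) ^ 2 + 1 / 2 * (v i ^ 2 * v j ^ 2)) :=
    Finset.sum_le_sum fun i _ => Finset.sum_le_sum fun j _ => by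
      nlinarith [sq_nonneg (av (pot θ ω) (fun x => x i * x j) - v i * v j)]
  have h5 : (∑ i, ∑ j, (1 / 2 * av (pot θ ω) (fun x => x i * x j) ^ 2 +
      1 / 2 * (v i ^ 2 * v j ^ 2))) = 1 / 2 * aR2 θ ω + 1 / 2 * aR1 θ ω ^ 2 := by
    simp only [Finset.sum_add_distrib, ← Finset.mul_sum]
    rw [aR2, aR1, pow_two, Finset.sum_mul]
    rfl
  change (∑ i, ∑ j, av (pot θ ω) (fun x => x i * x j) * (v i * v j)) ≤ _
  linarith

/-- Decorrelation of the norm from the overlap with the mean. -/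
theorem abs_aT3_sub_le {θ : Par} {ω : Om n} (hU : Good (pot θ ω)) (m r : ℝ) :
    |aT3 (pot θ ω) - r * aQ2 θ ω - m * aR1 θ ω + m * r| ≤
      1 / 2 * (aQ4 θ ω - 2 * m * aQ2 θ ω + m ^ 2)
        + 1 / 2 * (aT4 (pot θ ω) - 2 * r * aR1 θ ω + r ^ 2) := by
  set U := pot θ ω with hUd
  have e1 : av U (fun x => (nsq x - m) * (ip x (mean U) - r)) =
      aT3 U - r * aQ2 θ ω - m * aR1 θ ω + m * r := by
    have : (fun x : Vec n => (nsq x - m) * (ip x (mean U) - r)) = fun x =>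
      nsq x * ip x (mean U) - r * nsq x - m * ip x (mean U) + m * r := by ext x; ring
    rw [this, av_add hU (by fun_prop) (by fun_prop), av_sub hU (by fun_prop) (by fun_prop),
      av_sub hU (by fun_prop) (by fun_prop), av_const hU, av_const_mul, av_const_mul, av_ip hU,
      ip_self]
    rfl
  have e2 : av U (fun x => 1 / 2 * (nsq x - m) ^ 2 + 1 / 2 * (ip x (mean U) - r) ^ 2) =
      1 / 2 * (aQ4 θ ω - 2 * m * aQ2 θ ω + m ^ 2) + 1 / 2 * (aT4 U - 2 * r * aR1 θ ω + r ^ 2) := by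
    have : (fun x : Vec n => 1 / 2 * (nsq x - m) ^ 2 + 1 / 2 * (ip x (mean U) - r) ^ 2) = fun x =>
      1 / 2 * nsq x ^ 2 - m * nsq x + 1 / 2 * ip x (mean U) ^ 2 - r * ip x (mean U)
        + (1 / 2 * m ^ 2 + 1 / 2 * r ^ 2) := by ext x; ring
    rw [this, av_add hU (by fun_prop) (by fun_prop), av_sub hU (by fun_prop) (by fun_prop),
      av_add hU (by fun_prop) (by fun_prop), av_sub hU (by fun_prop) (by fun_prop), av_const hU]
    simp_rw [av_const_mul]
    rw [av_ip hU, ip_self, ← aT4]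
    change 1 / 2 * aQ4 θ ω - m * aQ2 θ ω + _ - r * aR1 θ ω + _ = _
    ring
  rw [← e1, ← e2]
  refine (av_abs_le hU (by fun_prop)).trans (av_mono hU (by fun_prop) (by fun_prop) fun x => ?_)
  rw [abs_mul, ← sq_abs (nsq x - m), ← sq_abs (ip x (mean U) - r)]
  nlinarith [sq_nonneg (|nsq x - m| - |ip x (mean U) - r|)]

theorem aQ2_sq_le {θ : Par} {ω : Om n} (hU : Good (pot θ ω)) : aQ2 θ ω ^ 2 ≤ aQ4 θ ω :=
  av_sq_le hU (by fun_prop)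

section
variable {ν : Measure (Vec n)} {θ : Par} {K η : ℝ}

theorem LPG.congr {F G : Om n → ℝ} (hF : LPG ν F) (h : ∀ᵐ s ∂ν, ∀ J, F (s, J) = G (s, J)) :
    LPG ν G := by
  obtain ⟨f, hf, ef⟩ := hF
  refine ⟨f, hf, ?_⟩
  filter_upwards [ef, h] with s h1 h2 J
  rw [← h2, h1]

theorem AdmA.lpg_T3 (h : AdmA ν K η θ) : LPG ν (fun ω => aT3 (pot θ ω)) := by
  refine (LPG.sum Finset.univ fun i : Fin n => (h.lpg_av' (f := fun x => nsq x * x i)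
    (by fun_prop)).mul (h.lpg_av' (f := fun x => x i) (by fun_prop))).congr ?_
  filter_upwards [h] with s hs J
  exact (aT3_eq hs.good).symm

theorem AdmA.lpg_T4 (h : AdmA ν K η θ) : LPG ν (fun ω => aT4 (pot θ ω)) := by
  refine (LPG.sum Finset.univ fun i : Fin n => LPG.sum Finset.univ fun j : Fin n =>
    (h.lpg_av' (f := fun x => x i * x j) (by fun_prop)).mul
      ((h.lpg_av' (f := fun x => x i) (by fun_prop)).mul
        (h.lpg_av' (f := fun x => x j) (by fun_prop)))).congr ?_
  filter_upwards [h] with s hs J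
  exact (aT4_eq hs.good).symm

theorem AdmA.lpg_gx (h : AdmA ν K η θ) : LPG ν (fun ω => av (pot θ ω) (fun x => gx ω.2 x)) :=
  h.lpg_av (f := fun q => gx q.1.2 q.2) (by unfold gx; fun_prop)

end

end

section

variable {n : ℕ}

theorem EL_trial (hn : n ≠ 0) {b c e κ : ℝ} (hb : 0 < b) (hc : 0 < c) (hκ : 0 < κ)
    (hbκ : b * κ ^ 2 = c) (t : ℝ) :
    EL n (nis c e) + n * Real.log κ
      + (2 * t + t ^ 2) * (1 / 2 * ((1 + e ^ 2 - κ ^ 2) * EE (gam (Fin n)) (aR1 (nis c e))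
        - e ^ 2 * n + c ^ 2 / n * EE (gam (Fin n)) (fun ω => aT3 (pot (nis c e) ω))))
      - e ^ 2 * n + (1 + e ^ 2 - κ ^ 2) / 2 * n
      - c ^ 2 / (4 * n) * (4 * t * EE (gam (Fin n)) (fun ω => aT3 (pot (nis c e) ω))
        + 4 * t ^ 2 * EE (gam (Fin n)) (fun ω => aT4 (pot (nis c e) ω))
        + 2 * t ^ 2 * EE (gam (Fin n)) (fun ω => aR1 (nis c e) ω * aQ2 (nis c e) ω)
        + (4 * t ^ 3 + t ^ 4) * EE (gam (Fin n)) (fun ω => aR1 (nis c e) ω ^ 2))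
      ≤ EL n (st b (c * b) 0) := by
  obtain ⟨K, hK⟩ := nis_all hn c e
  obtain ⟨K', hK'⟩ := admA_st (ν := gam (Fin n)) hn 0 hb (mul_pos hc hb).le
  have hν := mom_gam (n := n)
  set θ := nis c e with hθ
  have hgx := EE_gx hν hK
  have hS1 := nis_S1 hn (b := c) (e := e)
  have hQ2 := nis_Q2 hn (b := c) (e := e)
  rw [← hθ] at hS1 hQ2
  rw [hQ2] at hgx
  have hR := hK.lpg_R1
  have l7 : LPG (gam (Fin n)) (fun ω => aR1 θ ω * aQ2 θ ω) := hR.mul hK.lpg_Q2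
  have l8 : LPG (gam (Fin n)) (fun ω => aR1 θ ω ^ 2) := hR.pow 2
  set k1 := (2 * t + t ^ 2) * (1 / 2 * (1 + e ^ 2 - κ ^ 2))
  set k2 := -(e * ((2 * t + t ^ 2) / 2 + 1))
  set k3 := -(e ^ 2 * ((2 * t + t ^ 2) / 2 + 1))
  set k4 := (2 * t + t ^ 2) / 2 * (c ^ 2 / n) - c ^ 2 / (4 * n) * (4 * t)
  set k5 := (1 + e ^ 2 - κ ^ 2) / 2
  set k6 := -(c ^ 2 / (4 * n) * (4 * t ^ 2))
  set k7 := -(c ^ 2 / (4 * n) * (2 * t ^ 2))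
  set k8 := -(c ^ 2 / (4 * n) * (4 * t ^ 3 + t ^ 4))
  have L1 := hR.const_mul k1
  have L2 := (hK.lpg_gx).const_mul k2
  have L3 := (hK.lpg_S1).const_mul k3
  have L4 := (hK.lpg_T3).const_mul k4
  have L5 := (hK.lpg_Q2).const_mul k5
  have L6 := (hK.lpg_T4).const_mul k6
  have L7 := l7.const_mul k7
  have L8 := l8.const_mul k8
  have L0 : LPG (gam (Fin n)) (fun _ : Om n => (n : ℝ) * Real.log κ) := LPG.const _
  have A7 := L7.add L8
  have A6 := L6.add A7
  have A5 := L5.add A6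
  have A4 := L4.add A5
  have A3 := L3.add A4
  have A2 := L2.add A3
  have A1 := L1.add A2
  have A0 := L0.add A1
  have key := EE_mono hν (hK.lpg_log.add A0) hK'.lpg_log (by
    filter_upwards [hK, hK'] with s h1 h2 J
    refine le_of_eq_of_le ?_ (log_Zf_trial (ω := (s, J)) h1.good hκ hbκ h2.good t)
    simp only [k1, k2, k3, k4, k5, k6, k7, k8]
    ring)
  rw [EE_add hν hK.lpg_log A0, EE_add hν L0 A1, EE_add hν L1 A2, EE_add hν L2 A3, EE_add hν L3 A4,
    EE_add hν L4 A5, EE_add hν L5 A6, EE_add hν L6 A7, EE_add hν L7 L8, EE_const] at key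
  simp only [EE_const_mul] at key
  change EL n θ + (_ + (k1 * EE _ (aR1 θ) +
    (_ + (k3 * EE _ (aS1 θ) + (_ + (k5 * EE _ (aQ2 θ) + _)))))) ≤
    EL n (st b (c * b) 0) at key
  rw [hgx, hS1, hQ2] at key
  refine le_of_eq_of_le ?_ key
  simp only [k1, k2, k3, k4, k5, k6, k7, k8, hθ, nis]
  ring

section
variable {c w e : ℝ}

theorem nis_R1_sq_bounds (hn : n ≠ 0) (c e r : ℝ) :
    2 * r * EE (gam (Fin n)) (aR1 (nis c e)) - r ^ 2
      ≤ EE (gam (Fin n)) (fun ω => aR1 (nis c e) ω ^ 2) ∧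
    EE (gam (Fin n)) (fun ω => aR1 (nis c e) ω ^ 2)
      ≤ EE (gam (Fin n)) (fun ω => aT4 (pot (nis c e) ω)) ∧
    EE (gam (Fin n)) (fun ω => aT4 (pot (nis c e) ω)) ≤ EE (gam (Fin n)) (aR2 (nis c e)) := by
  obtain ⟨K, hK⟩ := nis_all hn c e
  have hν := mom_gam (n := n)
  have hR := hK.lpg_R1
  refine ⟨?_, EE_mono hν (hR.pow 2) hK.lpg_T4 ?_, EE_mono hν hK.lpg_T4 hK.lpg_R2 ?_⟩
  · rw [← EE_const_mul, ← EE_const (ν := gam (Fin n)) (n := n) (r ^ 2),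
      ← EE_sub hν (hR.const_mul _) (LPG.const _)]
    refine EE_mono hν ((hR.const_mul _).sub (LPG.const _)) (hR.pow 2) (ae_of_all _ fun s J => ?_)
    nlinarith [sq_nonneg (aR1 (nis c e) (s, J) - r)]
  · filter_upwards [hK] with s h J using aR1_sq_le_aT4 h.good
  · filter_upwards [hK] with s h J using aT4_le (ω := (s, J)) h

theorem EE_le_of_abs_le {ν : Measure (Vec n)} [IsProbabilityMeasure ν] (hν : Mom ν) {F G : Om n → ℝ}
    (hF : LPG ν F) (hG : LPG ν G) (h : ∀ᵐ s ∂ν, ∀ J, |F (s, J)| ≤ G (s, J)) :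
    |EE ν F| ≤ EE ν G := by
  rw [abs_le]
  constructor
  · have := EE_mono hν (hG.const_mul (-1)) hF (by
      filter_upwards [h] with s h J
      linarith [(abs_le.1 (h J)).1])
    rw [EE_const_mul] at this
    linarith
  · refine EE_mono hν hF hG ?_
    filter_upwards [h] with s h J using (abs_le.1 (h J)).2

theorem nis_T3_bound (hn : n ≠ 0) (c e r : ℝ) :
    |EE (gam (Fin n)) (fun ω => aT3 (pot (nis c e) ω)) - n * EE (gam (Fin n)) (aR1 (nis c e))|
      ≤ n + 1 / 2 * (EE (gam (Fin n)) (aR2 (nis c e))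
        - 2 * r * EE (gam (Fin n)) (aR1 (nis c e)) + r ^ 2) := by
  obtain ⟨K, hK⟩ := nis_all hn c e
  have hν := mom_gam (n := n)
  have b2 := (nis_R1_sq_bounds hn c e r).2.2
  set θ := nis c e with hθ
  have hQ2 := nis_Q2 hn (b := c) (e := e)
  have hQ4 := nis_Q4 hn (b := c) (e := e)
  rw [← hθ] at hQ2 hQ4
  have l2 := hK.lpg_Q2.const_mul r
  have l1 := hK.lpg_R1.const_mul (n : ℝ)
  have lc := LPG.const (ν := gam (Fin n)) (n := n) ((n : ℝ) * r)
  have lF := ((hK.lpg_T3.sub l2).sub l1).add lc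
  have m4 := hK.lpg_Q4
  have m2 := hK.lpg_Q2.const_mul (2 * (n : ℝ))
  have mc := LPG.const (ν := gam (Fin n)) (n := n) ((n : ℝ) ^ 2)
  have m1 := hK.lpg_R1.const_mul (2 * r)
  have mr := LPG.const (ν := gam (Fin n)) (n := n) (r ^ 2)
  have g1 := (m4.sub m2).add mc
  have g2 := (hK.lpg_T4.sub m1).add mr
  have key := EE_le_of_abs_le hν lF ((g1.const_mul (1 / 2)).add (g2.const_mul (1 / 2))) (by
    filter_upwards [hK] with s h J using abs_aT3_sub_le h.good n r)
  rw [EE_add hν (g1.const_mul (1 / 2)) (g2.const_mul (1 / 2)), EE_const_mul, EE_const_mul,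
    EE_add hν (m4.sub m2) mc, EE_sub hν m4 m2, EE_add hν (hK.lpg_T4.sub m1) mr,
    EE_sub hν hK.lpg_T4 m1, EE_add hν ((hK.lpg_T3.sub l2).sub l1) lc,
      EE_sub hν (hK.lpg_T3.sub l2) l1,
    EE_sub hν hK.lpg_T3 l2] at key
  simp only [EE_const_mul, EE_const] at key
  change |_ - r * EE _ (aQ2 θ) - n * EE _ (aR1 θ) + _| ≤
    1 / 2 * (EE _ (aQ4 θ) - 2 * n * EE _ (aQ2 θ)
    + _) + 1 / 2 * (_ - 2 * r * EE _ (aR1 θ) + _) at key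
  rw [hQ2, hQ4] at key
  refine le_of_eq_of_le ?_ (key.trans ?_)
  · congr 1; ring
  · linarith

theorem nis_R1Q2_bound (hn : n ≠ 0) (c e r : ℝ) :
    |EE (gam (Fin n)) (fun ω => aR1 (nis c e) ω * aQ2 (nis c e) ω)
        - n * EE (gam (Fin n)) (aR1 (nis c e))|
      ≤ n + 1 / 2 * (EE (gam (Fin n)) (aR2 (nis c e))
        - 2 * r * EE (gam (Fin n)) (aR1 (nis c e)) + r ^ 2) := by
  obtain ⟨K, hK⟩ := nis_all hn c e
  have hν := mom_gam (n := n)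
  have b1 := (nis_R1_sq_bounds hn c e r).2.1
  have b2 := (nis_R1_sq_bounds hn c e r).2.2
  set θ := nis c e with hθ
  have hQ2 := nis_Q2 hn (b := c) (e := e)
  have hQ4 := nis_Q4 hn (b := c) (e := e)
  rw [← hθ] at hQ2 hQ4
  have l2 := hK.lpg_Q2.const_mul r
  have l0 : LPG (gam (Fin n)) (fun ω => aR1 θ ω * aQ2 θ ω) := hK.lpg_R1.mul hK.lpg_Q2
  have lS : LPG (gam (Fin n)) (fun ω => aR1 θ ω ^ 2) := hK.lpg_R1.pow 2
  have l1 := hK.lpg_R1.const_mul (n : ℝ)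
  have lc := LPG.const (ν := gam (Fin n)) (n := n) ((n : ℝ) * r)
  have lF := ((l0.sub l2).sub l1).add lc
  have m4 := hK.lpg_Q4
  have m2 := hK.lpg_Q2.const_mul (2 * (n : ℝ))
  have mc := LPG.const (ν := gam (Fin n)) (n := n) ((n : ℝ) ^ 2)
  have m1 := hK.lpg_R1.const_mul (2 * r)
  have mr := LPG.const (ν := gam (Fin n)) (n := n) (r ^ 2)
  have g1 := (m4.sub m2).add mc
  have g2 := (lS.sub m1).add mr
  have key := EE_le_of_abs_le hν lF ((g1.const_mul (1 / 2)).add (g2.const_mul (1 / 2))) (by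
    filter_upwards [hK] with s h J
    have hq := aQ2_sq_le (ω := (s, J)) h.good
    have e1 : aR1 θ (s, J) * aQ2 θ (s, J) - r * aQ2 θ (s, J) - n * aR1 θ (s, J) + n * r =
      (aQ2 θ (s, J) - n) * (aR1 θ (s, J) - r) := by ring
    rw [e1, abs_le]
    constructor
    · nlinarith [sq_nonneg ((aQ2 θ (s, J) - n) + (aR1 θ (s, J) - r))]
    · nlinarith [sq_nonneg ((aQ2 θ (s, J) - n) - (aR1 θ (s, J) - r))])
  rw [EE_add hν (g1.const_mul (1 / 2)) (g2.const_mul (1 / 2)), EE_const_mul, EE_const_mul,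
    EE_add hν (m4.sub m2) mc, EE_sub hν m4 m2, EE_add hν (lS.sub m1) mr,
    EE_sub hν lS m1, EE_add hν ((l0.sub l2).sub l1) lc, EE_sub hν (l0.sub l2) l1,
    EE_sub hν l0 l2] at key
  simp only [EE_const_mul, EE_const] at key
  change |_ - r * EE _ (aQ2 θ) - n * EE _ (aR1 θ) + _| ≤
    1 / 2 * (EE _ (aQ4 θ) - 2 * n * EE _ (aQ2 θ)
    + _) + 1 / 2 * (_ - 2 * r * EE _ (aR1 θ) + _) at key
  rw [hQ2, hQ4] at key
  refine le_of_eq_of_le ?_ (key.trans ?_)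
  · congr 1; ring
  · linarith

theorem tendsto_of_decorrelated {q : ℝ} {T R1 R2 : ℕ → ℝ}
    (h1 : Tendsto (fun n : ℕ => R1 n / n) atTop (nhds q))
    (h2 : Tendsto (fun n : ℕ => R2 n / (n : ℝ) ^ 2) atTop (nhds (q ^ 2)))
    (hT : ∀ n : ℕ, n ≠ 0 → |T n - n * R1 n| ≤
      n + 1 / 2 * (R2 n - 2 * (n * q) * R1 n + (n * q) ^ 2)) :
    Tendsto (fun n : ℕ => T n / (n : ℝ) ^ 2) atTop (nhds q) := by
  have h3 : Tendsto (fun n : ℕ => 1 / (n : ℝ) + 1 / 2 * (R2 n / (n : ℝ) ^ 2 - 2 * q * (R1 n / n)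
      + q ^ 2)) atTop (nhds 0) := by
    have := tendsto_one_div_atTop_nhds_zero_nat (𝕜 := ℝ) |>.add
      (((h2.sub (h1.const_mul (2 * q))).add_const (q ^ 2)).const_mul (1 / 2))
    refine this.trans_eq ?_
    congr 1; ring
  have h4 : Tendsto (fun n : ℕ => T n / (n : ℝ) ^ 2 - R1 n / n) atTop (nhds 0) := by
    refine squeeze_zero_norm' ?_ h3
    filter_upwards [eventually_ne_atTop 0] with n hn
    have hn' : (0 : ℝ) < n := by positivity
    have e1 : T n / (n : ℝ) ^ 2 - R1 n / n = (T n - n * R1 n) / (n : ℝ) ^ 2 := by field_simp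
    rw [Real.norm_eq_abs, e1, abs_div, abs_of_pos (pow_pos hn' 2), div_le_iff₀ (by positivity)]
    refine (hT n hn).trans_eq ?_
    field_simp
  simpa using h4.add h1

variable {c w e : ℝ}

theorem tendsto_nis_sq (hc : 0 < c) (hw : 0 < w) (hcw : c ^ 2 < 1 + w) (he : 0 < e)
    (hε : e ^ 2 = w * (1 + w - c ^ 2) / (1 + w)) :
    Tendsto (fun n : ℕ => EE (gam (Fin n)) (fun ω => aR1 (nis c e) ω ^ 2) / (n : ℝ) ^ 2) atTop
      (nhds ((w / (1 + w)) ^ 2)) ∧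
    Tendsto (fun n : ℕ => EE (gam (Fin n)) (fun ω => aT4 (pot (nis c e) ω)) / (n : ℝ) ^ 2) atTop
      (nhds ((w / (1 + w)) ^ 2)) := by
  have h1 := tendsto_nis_R1 hc hw hcw he hε
  have h2 := tendsto_nis_R2 hc hw hcw he hε
  set q := w / (1 + w)
  have h3 : Tendsto (fun n : ℕ => 2 * q * (EE (gam (Fin n)) (aR1 (nis c e)) / n) - q ^ 2) atTop
      (nhds (q ^ 2)) := by
    refine ((h1.const_mul (2 * q)).sub_const (q ^ 2)).trans_eq ?_
    congr 1; ring
  have h4 : ∀ n : ℕ, n ≠ 0 → 2 * q * (EE (gam (Fin n)) (aR1 (nis c e)) / n) - q ^ 2 =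
      (2 * (n * q) * EE (gam (Fin n)) (aR1 (nis c e)) - (n * q) ^ 2) / (n : ℝ) ^ 2 := by
    intro n hn
    have hn' : (0 : ℝ) < n := by positivity
    field_simp
  constructor
  · refine tendsto_of_tendsto_of_tendsto_of_le_of_le' h3 h2 ?_ ?_
    · filter_upwards [eventually_ne_atTop 0] with n hn
      rw [h4 n hn]
      gcongr
      exact (nis_R1_sq_bounds hn c e _).1
    · filter_upwards [eventually_ne_atTop 0] with n hn
      obtain ⟨-, b1, b2⟩ := nis_R1_sq_bounds hn c e 0
      gcongr
      exact b1.trans b2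
  · refine tendsto_of_tendsto_of_tendsto_of_le_of_le' h3 h2 ?_ ?_
    · filter_upwards [eventually_ne_atTop 0] with n hn
      rw [h4 n hn]
      obtain ⟨b0, b1, b2⟩ := nis_R1_sq_bounds hn c e (n * q)
      gcongr
      exact b0.trans b1
    · filter_upwards [eventually_ne_atTop 0] with n hn
      obtain ⟨-, b1, b2⟩ := nis_R1_sq_bounds hn c e 0
      gcongr

/-- Value of the variational lower bound. -/
def vlb (b c t w : ℝ) : ℝ :=
  1 / 2 * w - 1 / 2 * Real.log (1 + w) - c ^ 2 / 4 * (w / (1 + w)) ^ 2 + 1 / 2 * Real.log (c / b)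
    + (2 * t + t ^ 2) * (1 / 2 * ((1 + w * (1 + w - c ^ 2) / (1 + w) - c / b) * (w / (1 + w))
        - w * (1 + w - c ^ 2) / (1 + w) + c ^ 2 * (w / (1 + w))))
      - w * (1 + w - c ^ 2) / (1 + w) + (1 + w * (1 + w - c ^ 2) / (1 + w) - c / b) / 2
      - c ^ 2 / 4 * (4 * t * (w / (1 + w)) + 4 * t ^ 2 * (w / (1 + w)) ^ 2
        + 2 * t ^ 2 * (w / (1 + w)) + (4 * t ^ 3 + t ^ 4) * (w / (1 + w)) ^ 2)

theorem phi_ge_vlb {b : ℝ} (hb : 0 < b) (hc : 0 < c) (hw : 0 < w) (hcw : c ^ 2 < 1 + w) (t : ℝ)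
    {δ : ℝ} (hδ : 0 < δ) : ∀ᶠ n : ℕ in atTop, vlb b c t w - δ ≤ phi n b (c * b) 0 := by
  set e := √(w * (1 + w - c ^ 2) / (1 + w)) with hed
  have hpos : 0 < w * (1 + w - c ^ 2) / (1 + w) := by
    have : 0 < 1 + w - c ^ 2 := by linarith
    positivity
  have he : 0 < e := Real.sqrt_pos.2 hpos
  have hε : e ^ 2 = w * (1 + w - c ^ 2) / (1 + w) := Real.sq_sqrt hpos.le
  have hew : e ^ 2 ≤ w := by
    rw [hε, div_le_iff₀ (by positivity)]; nlinarith [mul_pos hw (pow_pos hc 2)]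
  set κ := √(c / b) with hκd
  have hκ : 0 < κ := Real.sqrt_pos.2 (by positivity)
  have hκ2 : κ ^ 2 = c / b := Real.sq_sqrt (by positivity)
  have hlog : Real.log κ = 1 / 2 * Real.log (c / b) := by
    rw [hκd, Real.log_sqrt (by positivity)]; ring
  have h1 := tendsto_nis_R1 hc hw hcw he hε
  have h2 := tendsto_nis_R2 hc hw hcw he hε
  obtain ⟨h3, h4⟩ := tendsto_nis_sq hc hw hcw he hε
  have h5 := tendsto_of_decorrelated h1 h2 fun n hn => nis_T3_bound hn c e _
  have h6 := tendsto_of_decorrelated h1 h2 fun n hn => nis_R1Q2_bound hn c e _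
  have hP : 1 / 2 * w - 1 / 2 * Real.log (1 + w) - (w - e ^ 2) ^ 2 / (4 * c ^ 2) =
      1 / 2 * w - 1 / 2 * Real.log (1 + w) - c ^ 2 / 4 * (w / (1 + w)) ^ 2 := by
    have g2 : 1 + w ≠ 0 := by positivity
    rw [hε]; field_simp; ring
  set q := w / (1 + w) with hq
  have hlim : Tendsto (fun n : ℕ => 1 / 2 * w - 1 / 2 * Real.log (1 + w) - c ^ 2 / 4 * q ^ 2
      + 1 / 2 * Real.log (c / b)
      + (2 * t + t ^ 2) * (1 / 2 * ((1 + e ^ 2 - c / b) * (EE (gam (Fin n)) (aR1 (nis c e)) / n)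
        - e ^ 2 + c ^ 2 * (EE (gam (Fin n)) (fun ω => aT3 (pot (nis c e) ω)) / (n : ℝ) ^ 2)))
      - e ^ 2 + (1 + e ^ 2 - c / b) / 2
      - c ^ 2 / 4 * (4 * t * (EE (gam (Fin n)) (fun ω => aT3 (pot (nis c e) ω)) / (n : ℝ) ^ 2)
        + 4 * t ^ 2 * (EE (gam (Fin n)) (fun ω => aT4 (pot (nis c e) ω)) / (n : ℝ) ^ 2)
        + 2 * t ^ 2 * (EE (gam (Fin n)) (fun ω => aR1 (nis c e) ω * aQ2 (nis c e) ω) / (n : ℝ) ^ 2)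
        + (4 * t ^ 3 + t ^ 4) * (EE (gam (Fin n)) (fun ω => aR1 (nis c e) ω ^ 2) / (n : ℝ) ^ 2)))
      atTop (nhds (vlb b c t w)) := by
    rw [vlb, ← hq, ← hε]
    refine ((((((((h1.const_mul _).sub_const _).add (h5.const_mul _)).const_mul _).const_mul
      _).const_add
      _).sub_const _).add_const _).sub ?_
    exact ((((h5.const_mul _).add (h4.const_mul _)).add (h6.const_mul _)).add
      (h3.const_mul _)).const_mul _
  filter_upwards [hlim.eventually_const_lt (sub_lt_self _ hδ), eventually_ne_atTop 0] with n hn1 hn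
  refine hn1.le.trans ?_
  have hn' : (0 : ℝ) < n := by positivity
  have k1 := EL_trial hn hb hc hκ (e := e) (by rw [hκ2]; field_simp) t
  have k2 := phi_nis_ge hn hc he.le hew
  rw [hP, phi, st_eq_nis he.le] at k2
  have k3 := (div_le_div_iff_of_pos_right hn').2 k1
  rw [hlog, hκ2] at k3
  rw [phi]
  refine le_trans ?_ (sub_le_sub_right k3 _)
  rw [← sub_nonneg] at k2 ⊢
  refine k2.trans_eq ?_
  field_simp
  ring

end

end

/-- Limit free energy. -/
def Fb (b w : ℝ) : ℝ := w ^ 2 / (4 * b ^ 2) + w / (2 * (1 + w)) - 1 / 2 * Real.log (1 + w)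

theorem ubf_zero (b a w : ℝ) : ubf b a 0 w = Fb b w := by simp [ubf, Fb]

theorem vlb_eq {b c t : ℝ} (hb : 0 < b) (hc : 1 < c)
    (ht : (2 * t + t ^ 2) * ((c ^ 2 - 1) / c ^ 2) = 1 / c ^ 2 - 1 / (c * b)) :
    vlb b c t (c ^ 2 - 1) = Fb b (c * b - 1) := by
  have hc0 : 0 < c := by linarith
  have e1 : 1 + (c ^ 2 - 1) = c ^ 2 := by ring
  have e2 : 1 + (c * b - 1) = c * b := by ring
  have e3 : (c ^ 2 - 1) * (c ^ 2 - c ^ 2) / c ^ 2 = 0 := by simp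
  rw [vlb, Fb, e1, e2, e3, Real.log_pow, Real.log_mul hc0.ne' hb.ne', Real.log_div hc0.ne' hb.ne']
  set q := (c ^ 2 - 1) / c ^ 2 with hq
  have e4 : 4 * t * q + 4 * t ^ 2 * q ^ 2 + 2 * t ^ 2 * q + (4 * t ^ 3 + t ^ 4) * q ^ 2 =
      2 * ((2 * t + t ^ 2) * q) + ((2 * t + t ^ 2) * q) ^ 2 := by ring
  have e5 : (2 * t + t ^ 2) * (1 / 2 * ((1 + 0 - c / b) * q - 0 + c ^ 2 * q)) =
      1 / 2 * (1 - c / b + c ^ 2) * ((2 * t + t ^ 2) * q) := by ring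
  rw [e4, e5, ht, hq]
  push_cast
  field_simp
  ring

theorem phi_ge_supercritical {b a δ : ℝ} (hb : 0 < b) (ha : 1 < a) (hba : b < a) (hδ : 0 < δ) :
    ∀ᶠ n : ℕ in atTop, Fb b (a - 1) - δ ≤ phi n b a 0 := by
  set c := a / b with hcd
  have hc : 1 < c := by rw [hcd, lt_div_iff₀ hb]; linarith
  have hc0 : 0 < c := by linarith
  have hcb : c * b = a := by rw [hcd]; field_simp
  have hc2 : 0 < c ^ 2 - 1 := by nlinarith
  set t := √((1 - 1 / a) / ((c ^ 2 - 1) / c ^ 2)) - 1 with htd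
  have hnn : 0 ≤ (1 - 1 / a) / ((c ^ 2 - 1) / c ^ 2) := by
    have : 0 ≤ 1 - 1 / a := by rw [sub_nonneg, div_le_one (by linarith)]; exact ha.le
    positivity
  have ht : (2 * t + t ^ 2) * ((c ^ 2 - 1) / c ^ 2) = 1 / c ^ 2 - 1 / (c * b) := by
    have h1 : 2 * t + t ^ 2 = (1 - 1 / a) / ((c ^ 2 - 1) / c ^ 2) - 1 := by
      rw [← Real.sq_sqrt hnn, htd]; ring
    rw [h1, hcb, sub_mul, div_mul_cancel₀ _ (by positivity)]
    field_simp
    ring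
  have hcont : ContinuousAt (vlb b c t) (c ^ 2 - 1) := by
    have : 1 + (c ^ 2 - 1) ≠ 0 := by positivity
    unfold vlb
    fun_prop (disch := first | assumption | positivity)
  have hev : ∀ᶠ w in nhdsWithin (c ^ 2 - 1) (Set.Ioi (c ^ 2 - 1)),
      vlb b c t (c ^ 2 - 1) - δ / 2 < vlb b c t w :=
    (hcont.tendsto.mono_left nhdsWithin_le_nhds).eventually_const_lt (by linarith)
  obtain ⟨w, hw1, hw2⟩ := (hev.and self_mem_nhdsWithin).exists
  rw [vlb_eq hb hc ht, hcb] at hw1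
  have hw2' : c ^ 2 - 1 < w := hw2
  filter_upwards [phi_ge_vlb hb hc0 (by linarith) (by linarith) t (half_pos hδ)] with n hn
  rw [hcb] at hn
  linarith

section

variable {n : ℕ}

/-- Derivative of the limit free energy. -/
def Fd (b w : ℝ) : ℝ := w / 2 * (1 / b ^ 2 - 1 / (1 + w) ^ 2)

theorem hasDerivAt_Fb {b w : ℝ} (hw : 0 ≤ w) : HasDerivAt (Fb b) (Fd b w) w := by
  have g2 : 1 + w ≠ 0 := by positivity
  have h0 := hasDerivAt_id' w
  have h1 := h0.const_add 1
  have h := (((h0.fun_pow 2).div_const (4 * b ^ 2)).add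
    (h0.fun_div (h1.const_mul 2) (by positivity))).sub ((h1.log g2).const_mul (1 / 2))
  refine h.congr_deriv ?_
  rw [Fd]
  by_cases hb : b = 0
  · subst hb; field_simp; ring
  · field_simp; ring

theorem phi_step (hn : n ≠ 0) {b a a' : ℝ} (hb : 0 < b) (ha : 0 ≤ a) (ha' : 0 ≤ a') :
    phi n b a 0 + (a' - a) * (EE (gam (Fin n)) (aS2 (st b a 0)) / (2 * n ^ 2)) ≤ phi n b a' 0 := by
  obtain ⟨K, hK⟩ := admA_st (ν := gam (Fin n)) hn 0 hb ha
  obtain ⟨K', hK'⟩ := admA_st (ν := gam (Fin n)) hn 0 hb ha'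
  have h := EL_increment_le mom_gam hn hK hK'
  have hn' : (0 : ℝ) < n := by positivity
  change EL n (st b a 0) + _ + _ + _ + _ - _ - _ ≤ EL n (st b a' 0) at h
  have h2 := (div_le_div_iff_of_pos_right hn').2 h
  rw [phi, phi]
  refine le_trans (le_of_eq ?_) (sub_le_sub_right h2 _)
  simp only [st]
  field_simp
  ring

theorem phi_le_Fb {b a w δ : ℝ} (hb : 0 < b) (ha : 0 ≤ a) (hw : 0 ≤ w) (haw : a ≤ 1 + w)
    (hδ : 0 < δ) : ∀ᶠ n : ℕ in atTop, phi n b a 0 ≤ Fb b w + δ := by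
  have hev : ∀ᶠ v in nhdsWithin w (Set.Ioi w), Fb b v < Fb b w + δ / 2 :=
    ((hasDerivAt_Fb hw).continuousAt.tendsto.mono_left nhdsWithin_le_nhds).eventually_lt_const
      (by linarith)
  obtain ⟨v, hv1, hv2⟩ := (hev.and self_mem_nhdsWithin).exists
  have hv2' : w < v := hv2
  filter_upwards [phi_le_eventually (w := v) hb ha le_rfl (by linarith) (by linarith)
    (half_pos hδ)] with n hn
  rw [ubf_zero] at hn
  linarith

theorem Fd_critical {b : ℝ} : Fd b (max 1 b - 1) = 0 := by
  rcases max_cases 1 b with ⟨h, -⟩ | ⟨h, -⟩ <;> rw [h, Fd] <;> simp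

theorem tendsto_S2_supercritical {b a : ℝ} (hb : 0 < b) (ha : 1 < a) (hba : b < a) :
    Tendsto (fun n : ℕ => EE (gam (Fin n)) (aS2 (st b a 0)) / (2 * n ^ 2)) atTop
      (nhds (Fd b (a - 1))) := by
  have hr : 0 < a - max 1 b := sub_pos.2 (max_lt ha hba)
  have m1 := le_max_left 1 b
  refine tendsto_of_tangent (G := fun h => Fb b (a - 1 + h) - Fb b (a - 1)) hr (by simp) ?_ ?_
  · have h1 : HasDerivAt (Fb b) (Fd b (a - 1)) (a - 1 + 0) := by
      rw [add_zero]; exact hasDerivAt_Fb (by linarith)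
    simpa using (h1.comp_const_add (a - 1) 0).sub_const (Fb b (a - 1))
  · intro x hx δ hδ
    have hx1 := (abs_lt.1 hx).1
    filter_upwards [phi_le_Fb (w := a - 1 + x) (a := a + x) hb (by linarith) (by linarith)
      (by linarith) (half_pos hδ), phi_ge_supercritical hb ha hba (half_pos hδ),
      eventually_ne_atTop 0] with n h1 h2 hn
    have h3 := phi_step hn hb (a := a) (a' := a + x) (by linarith) (by linarith)
    rw [add_sub_cancel_left] at h3
    linarith

theorem phi_ge_subcritical {b a δ : ℝ} (hb : 0 < b) (ha : 0 ≤ a) (hδ : 0 < δ) :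
    ∀ᶠ n : ℕ in atTop, Fb b (max 1 b - 1) - δ ≤ phi n b a 0 := by
  set m := max 1 b with hm
  have m1 : 1 ≤ m := le_max_left 1 b
  have m2 : b ≤ m := le_max_right 1 b
  have hc : ContinuousAt (fun v => Fb b (v - 1) - (v - a) * Fd b (v - 1)) m := by
    have g1 : ContinuousAt (fun v => Fb b (v - 1)) m :=
      ContinuousAt.comp (g := Fb b) (hasDerivAt_Fb (b := b) (w := m - 1) (by linarith)).continuousAt
        (by fun_prop)
    have g2 : ContinuousAt (fun v => Fd b (v - 1)) m := by
      have : 1 + (m - 1) ≠ 0 := by linarith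
      unfold Fd
      fun_prop (disch := first | assumption | positivity)
    exact g1.sub ((continuousAt_id.sub continuousAt_const).mul g2)
  have hv : Fb b (m - 1) - (m - a) * Fd b (m - 1) = Fb b (m - 1) := by
    rw [hm, Fd_critical]; ring
  have hev : ∀ᶠ v in nhdsWithin m (Set.Ioi m),
      Fb b (m - 1) - δ / 3 < Fb b (v - 1) - (v - a) * Fd b (v - 1) :=
    (hc.tendsto.mono_left nhdsWithin_le_nhds).eventually_const_lt (by linarith)
  obtain ⟨v, hv1, hv2⟩ := (hev.and self_mem_nhdsWithin).exists
  have hv2' : m < v := hv2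
  have hS := (tendsto_S2_supercritical hb (a := v) (by linarith) (by linarith)).const_mul (v - a)
  filter_upwards [hS.eventually_lt_const (lt_add_of_pos_right _ (by positivity : 0 < δ / 3)),
    phi_ge_supercritical (a := v) (δ := δ / 3) hb (by linarith) (by linarith) (by positivity),
    eventually_ne_atTop 0] with n h1 h2 hn
  have h3 := phi_step hn hb (a := v) (a' := a) (by linarith) ha
  rw [← neg_sub v a, neg_mul] at h3
  linarith

theorem phi_ge_Fb {b a δ : ℝ} (hb : 0 < b) (ha : 0 ≤ a) (hδ : 0 < δ) :
    ∀ᶠ n : ℕ in atTop, Fb b (max (max 1 b) a - 1) - δ ≤ phi n b a 0 := by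
  rcases le_or_gt a (max 1 b) with h | h
  · rw [max_eq_left h]; exact phi_ge_subcritical hb ha hδ
  · rw [max_eq_right h.le]
    exact phi_ge_supercritical hb ((le_max_left _ _).trans_lt h) ((le_max_right _ _).trans_lt h) hδ

theorem tendsto_S2 {b a : ℝ} (hb : 0 < b) (ha : 0 < a) :
    Tendsto (fun n : ℕ => EE (gam (Fin n)) (aS2 (st b a 0)) / (2 * n ^ 2)) atTop
      (nhds (Fd b (max (max 1 b) a - 1))) := by
  rcases le_or_gt a (max 1 b) with h | h
  swap
  · rw [max_eq_right h.le]
    exact tendsto_S2_supercritical hb ((le_max_left _ _).trans_lt h) ((le_max_right _ _).trans_lt h)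
  rw [max_eq_left h, Fd_critical]
  have m1 : 1 ≤ max 1 b := le_max_left 1 b
  refine tendsto_of_tangent (G := fun h => Fb b (max 1 b - 1 + |h|) - Fb b (max 1 b - 1)) ha
    (by simp) ?_ ?_
  · have h1 := hasDerivAt_Fb (b := b) (w := max 1 b - 1) (by linarith)
    rw [Fd_critical, hasDerivAt_iff_isLittleO_nhds_zero] at h1
    rw [hasDerivAt_iff_isLittleO_nhds_zero]
    have ht : Tendsto (fun h : ℝ => |h|) (nhds 0) (nhds 0) := by
      have := continuous_abs.tendsto (0 : ℝ); rwa [abs_zero] at this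
    have h2 := h1.comp_tendsto ht
    have h3 : ((fun h : ℝ => h) ∘ fun h => |h|) =O[nhds 0] fun h : ℝ => h :=
      Asymptotics.isBigO_of_le _ fun x => by simp
    simpa [Function.comp_def] using h2.trans_isBigO h3
  · intro x hx δ hδ
    have hx1 := (abs_lt.1 hx).1
    have hx2 := le_abs_self x
    have hx3 := abs_nonneg x
    filter_upwards [phi_le_Fb (w := max 1 b - 1 + |x|) (a := a + x) hb (by linarith) (by linarith)
      (by linarith) (half_pos hδ), phi_ge_subcritical hb ha.le (half_pos hδ),
      eventually_ne_atTop 0] with n h1 h2 hn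
    have h3 := phi_step hn hb (a := a) (a' := a + x) (by linarith) (by linarith)
    rw [add_sub_cancel_left] at h3
    linarith

theorem EL_rescale (hn : n ≠ 0) {b a y : ℝ} (hb : 0 < b) (ha : 0 ≤ a) (hy : 0 < y) :
    EL n (st (b / y) a 0) = n / 2 * Real.log y + EL n ⟨b, a * y, 0, 0, y, b ^ 2⟩ := by
  obtain ⟨K, hK⟩ := admA_of (ν := gam (Fin n)) hn (θ := ⟨b, a * y, 0, 0, y, b ^ 2⟩)
    (mul_nonneg ha hy.le) rfl (by positivity)
  rw [EL, EL, ← EE_const (ν := gam (Fin n)) (n / 2 * Real.log y),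
    ← EE_add mom_gam (LPG.const _) hK.lpg_log]
  refine EE_congr (hK.mono fun s hs J => ?_)
  have hg : Good (pot ⟨b, a * y, 0, 0, y, b ^ 2⟩ (s, J)) := Adm.good (h := hs)
  have hy' : 0 < √y := Real.sqrt_pos.2 hy
  have h2 : √y ^ 2 = y := Real.sq_sqrt hy.le
  have h4 : √y ^ 4 = y ^ 2 := by rw [← congrArg (· ^ 2) h2]; ring
  have hp : (fun x : Vec n => pot (st (b / y) a 0) (s, J) (√y • (x + 0))) =
      pot ⟨b, a * y, 0, 0, y, b ^ 2⟩ (s, J) := by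
    funext x
    rw [add_zero, pot_smul, st]
    simp only [h2, h4, Real.sqrt_zero, zero_mul, add_zero, one_mul]
    rw [div_mul_cancel₀ _ hy.ne', div_pow, div_mul_cancel₀ _ (by positivity)]
  rw [Zf_affine _ hy' 0, hp, Real.log_mul (by positivity) hg.Zf_pos.ne', Real.log_pow,
    Real.log_sqrt hy.le, Fintype.card_fin]
  ring

theorem scaling_identity {θ : Par} {ω : Om n} (hU : Good (pot θ ω)) (he : θ.e = 0) (hf : θ.f = 0) :
    n + 2 * (θ.b * av (pot θ ω) (fun x => xw ω.2 x) + θ.a / (2 * n) * aS2 θ ω - θ.τ / 2 * aQ2 θ ω)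
      - θ.d / n * aQ4 θ ω = 0 := by
  have px : PG (fun x : Vec n => xw ω.2 x) := by unfold xw; fun_prop
  have pi2 : PG (fun x : Vec n => ip ω.1 x ^ 2) := by unfold ip; fun_prop
  have p2 : PG (fun x : Vec n => nsq x) := by unfold nsq; fun_prop
  have p4 : PG (fun x : Vec n => nsq x ^ 2) := by fun_prop
  have hav : av (pot θ ω) (fun x => θ.b * xw ω.2 x + θ.a / (2 * n) * ip ω.1 x ^ 2
      - θ.τ / 2 * nsq x) =
      θ.b * av (pot θ ω) (fun x => xw ω.2 x) + θ.a / (2 * n) * aS2 θ ω - θ.τ / 2 * aQ2 θ ω := by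
    rw [av_sub hU (by fun_prop) (by fun_prop), av_add hU (by fun_prop) (by fun_prop),
      av_const_mul, av_const_mul, av_const_mul]
    rfl
  rw [← hav]
  set X := av (pot θ ω) (fun x => θ.b * xw ω.2 x + θ.a / (2 * n) * ip ω.1 x ^ 2
      - θ.τ / 2 * nsq x) with hX
  have key : ∀ u : ℝ, n * u + (Real.exp u ^ 2 - 1) * X
      - (Real.exp u ^ 4 - 1) * (θ.d / (4 * n) * aQ4 θ ω) ≤ 0 := by
    intro u
    have hd : (fun x : Vec n => pot θ ω (Real.exp u • (x + 0)) - pot θ ω x) =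
        fun x => (Real.exp u ^ 2 - 1) * (θ.b * xw ω.2 x + θ.a / (2 * n) * ip ω.1 x ^ 2
          - θ.τ / 2 * nsq x) - (Real.exp u ^ 4 - 1) * (θ.d / (4 * n) * nsq x ^ 2) := by
      funext x
      rw [add_zero, pot_smul]
      simp only [pot, he, hf]
      ring
    have h := log_Zf_ge_affine hU (Real.exp_pos u) 0 (hU.affine (Real.exp_pos u) 0)
      (by rw [hd]; fun_prop)
    rw [hd, av_sub hU (by fun_prop) (by fun_prop), av_const_mul, av_const_mul, av_const_mul,
      Real.log_exp, Fintype.card_fin, ← hX] at h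
    rw [aQ4]
    linarith
  have hder : HasDerivAt (fun u : ℝ => n * u + (Real.exp u ^ 2 - 1) * X
      - (Real.exp u ^ 4 - 1) * (θ.d / (4 * n) * aQ4 θ ω))
      (n + 2 * X - 4 * (θ.d / (4 * n) * aQ4 θ ω)) 0 := by
    have h0 := hasDerivAt_id' (0 : ℝ)
    have h1 := Real.hasDerivAt_exp 0
    have h := ((h0.const_mul (n : ℝ)).add (((h1.fun_pow 2).sub_const 1).mul_const X)).sub
      (((h1.fun_pow 4).sub_const 1).mul_const (θ.d / (4 * n) * aQ4 θ ω))
    refine h.congr_deriv ?_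
    simp
  have hmax : IsLocalMax (fun u : ℝ => n * u + (Real.exp u ^ 2 - 1) * X
      - (Real.exp u ^ 4 - 1) * (θ.d / (4 * n) * aQ4 θ ω)) 0 :=
    Filter.Eventually.of_forall fun u => by simpa using key u
  have h := hmax.hasDerivAt_eq_zero hder
  have e : 4 * (θ.d / (4 * n) * aQ4 θ ω) = θ.d / n * aQ4 θ ω := by
    rw [← mul_assoc, mul_div_assoc', mul_div_mul_left _ _ four_ne_zero]
  linarith

theorem phi_rescale_step (hn : n ≠ 0) {b a y : ℝ} (hb : 0 < b) (ha : 0 ≤ a) (hy : 0 < y) :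
    phi n b a 0 + 1 / 2 * Real.log y
      + (y - 1) * (a * (EE (gam (Fin n)) (aS2 (st b a 0)) / (2 * n ^ 2))
        - EE (gam (Fin n)) (aQ2 (st b a 0)) / (2 * n)) ≤ phi n (b / y) a 0 := by
  obtain ⟨K, hK⟩ := admA_st (ν := gam (Fin n)) hn 0 hb ha
  obtain ⟨K', hK'⟩ := admA_of (ν := gam (Fin n)) hn (θ := ⟨b, a * y, 0, 0, y, b ^ 2⟩)
    (mul_nonneg ha hy.le) rfl (by positivity)
  have h := EL_increment_le mom_gam hn hK hK'
  have hn' : (0 : ℝ) < n := by positivity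
  change EL n (st b a 0) + _ + _ + _ + _ - _ - _ ≤ EL n ⟨b, a * y, 0, 0, y, b ^ 2⟩ at h
  rw [phi, phi, EL_rescale hn hb ha hy]
  have h2 := (div_le_div_iff_of_pos_right hn').2 (add_le_add_right h (n / 2 * Real.log y))
  refine le_trans (le_of_eq ?_) (sub_le_sub_right h2 _)
  simp only [st, Real.sqrt_zero]
  field_simp
  ring

theorem scaling_identity_mean (hn : n ≠ 0) {b a : ℝ} (hb : 0 < b) (ha : 0 ≤ a) :
    1 + a * (EE (gam (Fin n)) (aS2 (st b a 0)) / n ^ 2)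
      - b ^ 2 * (EE (gam (Fin n)) (aR2 (st b a 0)) / n ^ 2)
      - EE (gam (Fin n)) (aQ2 (st b a 0)) / n = 0 := by
  obtain ⟨K, hK⟩ := admA_st (ν := gam (Fin n)) hn 0 hb ha
  have e2 : (st b a 0).a = a := rfl
  have e3 : (st b a 0).τ = 1 := add_zero 1
  have e4 : (st b a 0).d = b ^ 2 := rfl
  have hxw : LPG (gam (Fin n)) (fun ω => av (pot (st b a 0) ω) (fun x => xw ω.2 x)) :=
    hK.lpg_av (f := fun p => xw p.1.2 p.2) (by unfold xw; fun_prop)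
  have h : EE (gam (Fin n)) (fun ω => ((((n + 2 * b * av (pot (st b a 0) ω) (fun x => xw ω.2 x))
      + a / n * aS2 (st b a 0) ω) - aQ2 (st b a 0) ω) - b ^ 2 / n * aQ4 (st b a 0) ω)) = 0 := by
    refine (EE_congr (G := fun _ => 0) (hK.mono fun s hs J => ?_)).trans (EE_const 0)
    have := scaling_identity (ω := (s, J)) (Adm.good (h := hs)) (by simp [st]) rfl
    refine Eq.trans ?_ this
    rw [e2, e3, e4, show (st b a 0).b = b from rfl]
    field_simp
    ring
  have l1 := (LPG.const (ν := gam (Fin n)) (n : ℝ)).add (hxw.const_mul (2 * b))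
  have l2 := l1.add (hK.lpg_S2.const_mul (a / n))
  have l3 := l2.sub hK.lpg_Q2
  rw [EE_sub mom_gam l3 (hK.lpg_Q4.const_mul (b ^ 2 / n)), EE_sub mom_gam l2 hK.lpg_Q2,
    EE_add mom_gam l1 (hK.lpg_S2.const_mul (a / n)),
    EE_add mom_gam (LPG.const _) (hxw.const_mul (2 * b)), EE_const_mul, EE_const_mul,
    EE_const_mul, EE_const, EE_xw mom_gam hn hK] at h
  have hn' : (0 : ℝ) < n := by positivity
  have h2 := congrArg (· / (n : ℝ)) h
  simp only [zero_div] at h2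
  refine Eq.trans ?_ h2
  rw [show (st b a 0).b = b from rfl]
  field_simp
  ring

theorem tendsto_R2 {b a : ℝ} (hb : 0 < b) (ha : 0 < a) :
    Tendsto (fun n : ℕ => EE (gam (Fin n)) (aR2 (st b a 0)) / n ^ 2) atTop
      (nhds ((max (max 1 b) a - 1) ^ 2 / b ^ 4)) := by
  set w := max (max 1 b) a - 1 with hw
  have hw0 : 0 ≤ w := sub_nonneg.2 ((le_max_left 1 b).trans (le_max_left _ _))
  have haw : a ≤ 1 + w := by have := le_max_right (max 1 b) a; linarith
  have key := tendsto_of_tangent (D := fun n : ℕ =>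
      a * (EE (gam (Fin n)) (aS2 (st b a 0)) / (2 * n ^ 2))
        - EE (gam (Fin n)) (aQ2 (st b a 0)) / (2 * n))
    (G := fun h => w ^ 2 / (4 * b ^ 2) * ((1 + h) ^ 2 - 1) - 1 / 2 * Real.log (1 + h))
    (d := w ^ 2 / (2 * b ^ 2) - 1 / 2) one_pos (by simp) ?_ ?_
  · have h2 := (key.const_mul 2).const_add 1 |>.div_const (b ^ 2)
    refine (h2.congr' ?_).trans_eq ?_
    · filter_upwards [eventually_ne_atTop 0] with n hn
      have h := scaling_identity_mean hn hb ha.le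
      have hn' : (0 : ℝ) < n := by positivity
      rw [div_eq_iff (by positivity)]
      have e1 : EE (gam (Fin n)) (aS2 (st b a 0)) / (2 * n ^ 2) =
          EE (gam (Fin n)) (aS2 (st b a 0)) / n ^ 2 / 2 := by field_simp
      have e2 : EE (gam (Fin n)) (aQ2 (st b a 0)) / (2 * n) =
          EE (gam (Fin n)) (aQ2 (st b a 0)) / n / 2 := by field_simp
      rw [e1, e2]
      linarith
    · congr 1
      field_simp
      ring
  · have h0 := (hasDerivAt_id' (0 : ℝ)).const_add 1
    have h := (((h0.fun_pow 2).sub_const 1).const_mul (w ^ 2 / (4 * b ^ 2))).sub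
      ((h0.log (by norm_num)).const_mul (1 / 2))
    refine h.congr_deriv ?_
    norm_num
    ring
  · intro x hx δ hδ
    have hy : 0 < 1 + x := by linarith [(abs_lt.1 hx).1]
    filter_upwards [phi_le_Fb (b := b / (1 + x)) (by positivity) ha.le hw0 haw (half_pos hδ),
      phi_ge_Fb hb ha.le (half_pos hδ), eventually_ne_atTop 0] with n h1 h2 hn
    have h3 := phi_rescale_step hn hb ha.le hy
    rw [add_sub_cancel_left] at h3
    rw [← hw] at h2
    have e : Fb (b / (1 + x)) w - Fb b w = w ^ 2 / (4 * b ^ 2) * ((1 + x) ^ 2 - 1) := by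
      simp only [Fb]
      field_simp
      ring
    linarith

end

section

variable {n : ℕ}

/-- The orthogonal-ensemble matrix built from standard Gaussian noise. -/
def wmat (J : Ix n → ℝ) : Matrix (Fin n) (Fin n) ℝ :=
  Matrix.of fun i j => if i ≤ j then (if i = j then √2 else 1) * J (Sum.inl (i, j))
    else (if j = i then √2 else 1) * J (Sum.inl (j, i))

theorem continuous_wmat : Continuous (wmat (n := n)) := by
  refine continuous_matrix fun i j => ?_
  simp only [wmat, Matrix.of_apply]
  split_ifs <;> fun_prop

theorem map_scaled_gam : (gam (Ix n)).map
    (fun J (p : Fin n × Fin n) => (if p.1 = p.2 then √2 else 1) * J (Sum.inl p)) =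
      Measure.pi fun p : Fin n × Fin n => gaussianReal 0 (if p.1 = p.2 then 2 else 1) := by
  refine (Measure.pi_eq fun s hs => ?_).symm
  rw [Measure.map_apply (by fun_prop) (MeasurableSet.univ_pi hs)]
  have h : (fun (J : Ix n → ℝ) (p : Fin n × Fin n) =>
      (if p.1 = p.2 then √2 else 1) * J (Sum.inl p)) ⁻¹' Set.univ.pi s =
      Set.univ.pi (Sum.elim (fun p => ((if p.1 = p.2 then √2 else 1) * ·) ⁻¹' s p)
        fun _ => Set.univ) := by
    ext J; simp
  rw [h, gam, Measure.pi_pi, Fintype.prod_sum_type]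
  simp only [Sum.elim_inl, Sum.elim_inr, measure_univ, Finset.prod_const_one, mul_one]
  refine Finset.prod_congr rfl fun p _ => ?_
  rw [← Measure.map_apply (by fun_prop) (hs p), gaussianReal_map_const_mul, mul_zero, mul_one]
  congr 2
  split_ifs with hp
  · ext; simp
  · ext; simp

theorem goe_eq_map : goe n = (gam (Ix n)).map wmat := by
  rw [goe, ← map_scaled_gam, Measure.map_map _ (by fun_prop)]
  · rfl
  · refine Continuous.measurable (continuous_matrix fun i j => ?_)
    simp only [Matrix.of_apply]
    split_ifs <;> fun_prop

theorem vecGauss_prod_goe : (vecGauss n).prod (goe n) =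
    ((gam (Fin n)).prod (gam (Ix n))).map (Prod.map id wmat) := by
  have h := Measure.map_prod_map (gam (Fin n)) (gam (Ix n)) measurable_id
    (continuous_wmat (n := n)).measurable
  rw [Measure.map_id] at h
  rw [goe_eq_map, ← h]
  rfl

theorem measurable_entry (i j : Fin n) :
    Measurable fun W : Matrix (Fin n) (Fin n) ℝ => W i j :=
  (continuous_id.matrix_elem i j).measurable

theorem measurable_weight1_obsY1 (ls a l b : ℝ) :
    Measurable fun q : (Vec n × Matrix (Fin n) (Fin n) ℝ) × Vec n =>
      weight1 l b q.2 (obsY1 ls a q.1.1 q.1.2) := by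
  have h : ∀ i j, Measurable fun q : (Vec n × Matrix (Fin n) (Fin n) ℝ) × Vec n => q.1.2 i j :=
    fun i j => (measurable_entry i j).comp (measurable_snd.comp measurable_fst)
  unfold weight1 obsY1 frob2
  refine Measurable.exp (Measurable.const_mul (Finset.measurable_sum _ fun i _ =>
    Finset.measurable_sum _ fun j _ => Measurable.pow_const ?_ 2) _)
  simp only [Matrix.sub_apply, Matrix.add_apply, Matrix.smul_apply, Matrix.vecMulVec_apply,
    smul_eq_mul]
  have := h i j
  exact Measurable.sub (by fun_prop) (Measurable.add (by fun_prop) this)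

theorem measurable_mse_integrand (ls a l b : ℝ) :
    Measurable fun p : Vec n × Matrix (Fin n) (Fin n) ℝ =>
      frob2 (a • Matrix.vecMulVec p.1 p.1 - mmis1 n l b (obsY1 ls a p.1 p.2)) := by
  have hw := measurable_weight1_obsY1 (n := n) ls a l b
  have : SigmaFinite (vecGauss n) := by unfold vecGauss; infer_instance
  unfold frob2
  simp only [Matrix.sub_apply, Matrix.smul_apply, Matrix.vecMulVec_apply, smul_eq_mul, mmis1,
    Matrix.of_apply, partitionZ1]
  have hZ : Measurable fun p : Vec n × Matrix (Fin n) (Fin n) ℝ =>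
      ∫ x, weight1 l b x (obsY1 ls a p.1 p.2) ∂vecGauss n :=
    (hw.stronglyMeasurable.integral_prod_right' (ν := vecGauss n)).measurable
  have hN : ∀ i j, Measurable fun p : Vec n × Matrix (Fin n) (Fin n) ℝ =>
      ∫ x, weight1 l b x (obsY1 ls a p.1 p.2) * (b * x i * x j) ∂vecGauss n := fun i j => by
    have hm : Measurable fun q : (Vec n × Matrix (Fin n) (Fin n) ℝ) × Vec n =>
        weight1 l b q.2 (obsY1 ls a q.1.1 q.1.2) * (b * q.2 i * q.2 j) := by fun_prop
    exact (hm.stronglyMeasurable.integral_prod_right' (ν := vecGauss n)).measurable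
  refine Finset.measurable_sum _ fun i _ => Finset.measurable_sum _ fun j _ =>
    Measurable.pow_const (Measurable.sub (by fun_prop) ((hN i j).div hZ)) 2

theorem sum_wmat (hn : n ≠ 0) (J : Ix n → ℝ) (x : Vec n) :
    ∑ i, ∑ j, x i * x j * wmat J i j = 2 * √n * xw J x := by
  have hn' : (0 : ℝ) < n := by positivity
  set g : Fin n → Fin n → ℝ := fun i j =>
    (if i = j then √2 else 1) * J (Sum.inl (i, j)) * (x i * x j) with hg
  have h1 : ∑ i, ∑ j, x i * x j * wmat J i j =
      ∑ i, ∑ j, (if i ≤ j then g i j else 0) + ∑ i, ∑ j, (if j < i then g j i else 0) := by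
    simp only [← Finset.sum_add_distrib]
    refine Finset.sum_congr rfl fun i _ => Finset.sum_congr rfl fun j _ => ?_
    simp only [wmat, Matrix.of_apply, hg]
    rcases le_or_gt i j with h | h
    · rw [if_pos h, if_pos h, if_neg h.not_gt]; ring
    · rw [if_neg h.not_ge, if_neg h.not_ge, if_pos h]; ring
  rw [h1, Finset.sum_comm (f := fun i j => if j < i then g j i else 0), xw,
    Fintype.sum_prod_type, Finset.mul_sum]
  simp only [← Finset.sum_add_distrib, Finset.mul_sum]
  refine Finset.sum_congr rfl fun i _ => Finset.sum_congr rfl fun j _ => ?_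
  have hs : √(n : ℝ) ≠ 0 := (Real.sqrt_pos.2 hn').ne'
  simp only [hg, cf]
  rcases lt_trichotomy i j with h | h | h
  · simp only [h.le, h, h.ne, if_true, if_false]; field_simp; ring
  · subst h
    simp only [le_refl, lt_irrefl, if_true, if_false, add_zero]
    rw [Real.sqrt_mul zero_le_two]
    have h2 : √(2 : ℝ) ^ 2 = 2 := Real.sq_sqrt zero_le_two
    have h3 : √(2 : ℝ) ≠ 0 := by positivity
    field_simp
    rw [h2]
    ring
  · simp [h.not_ge, h.not_gt, h.ne.symm]

/-- The Gibbs weight is the exponential of the potential up to a factor independent of `x`. -/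
theorem weight1_eq (hn : n ≠ 0) {ls l a b : ℝ} (hls : 0 < ls) (hl : 0 < l) (ha : 0 < a)
    (hb : 0 < b) (s : Vec n) (J : Ix n → ℝ) (x : Vec n) :
    weight1 l b x (obsY1 ls a s (wmat J)) =
      Real.exp (-(1 / 4) * frob2 (obsY1 ls a s (wmat J))) *
        Real.exp (pot (st (√l * b) (√l * √ls * a * b) 0) (s, J) x + 1 / 2 * nsq x) := by
  have hn' : (0 : ℝ) < n := by positivity
  have hs : √(n : ℝ) ≠ 0 := (Real.sqrt_pos.2 hn').ne'
  have hs2 : √(n : ℝ) ^ 2 = n := Real.sq_sqrt hn'.le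
  have hl2 : √l ^ 2 = l := Real.sq_sqrt hl.le
  have e1 : √(l * b ^ 2 / n) = √l * b / √n := by
    rw [Real.sqrt_div (by positivity), Real.sqrt_mul hl.le, Real.sqrt_sq hb.le]
  have e2 : √(ls * a ^ 2 / n) = √ls * a / √n := by
    rw [Real.sqrt_div (by positivity), Real.sqrt_mul hls.le, Real.sqrt_sq ha.le]
  set c := √(l * b ^ 2 / n) with hc
  set Y := obsY1 ls a s (wmat J) with hY
  have h1 : frob2 (c • Matrix.vecMulVec x x - Y) =
      c ^ 2 * nsq x ^ 2 - 2 * c * (∑ i, ∑ j, x i * x j * Y i j) + frob2 Y := by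
    have : nsq x ^ 2 = ∑ i, ∑ j, x i ^ 2 * x j ^ 2 := by
      rw [pow_two, nsq, Finset.sum_mul_sum]
    rw [this]
    simp only [frob2, Finset.mul_sum, ← Finset.sum_add_distrib, ← Finset.sum_sub_distrib]
    refine Finset.sum_congr rfl fun i _ => Finset.sum_congr rfl fun j _ => ?_
    simp only [Matrix.sub_apply, Matrix.smul_apply, Matrix.vecMulVec_apply, smul_eq_mul]
    ring
  have h2 : ∑ i, ∑ j, x i * x j * Y i j =
      √ls * a / √n * ip s x ^ 2 + 2 * √n * xw J x := by
    rw [← sum_wmat hn, pow_two, ip, Finset.sum_mul_sum]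
    simp only [Finset.mul_sum, ← Finset.sum_add_distrib]
    refine Finset.sum_congr rfl fun i _ => Finset.sum_congr rfl fun j _ => ?_
    simp only [hY, obsY1, Matrix.add_apply, Matrix.smul_apply, Matrix.vecMulVec_apply, smul_eq_mul]
    rw [e2]
    ring
  rw [weight1, ← hc, h1, h2, ← Real.exp_add, e1]
  congr 1
  simp only [pot, st, Real.sqrt_zero, add_zero]
  generalize √(n : ℝ) = r at *
  rw [← hs2]
  field_simp
  ring

theorem gibbs_eq (hn : n ≠ 0) {ls l a b : ℝ} (hls : 0 < ls) (hl : 0 < l) (ha : 0 < a)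
    (hb : 0 < b) (s : Vec n) (J : Ix n → ℝ) (i j : Fin n) :
    mmis1 n l b (obsY1 ls a s (wmat J)) i j =
      b * av (pot (st (√l * b) (√l * √ls * a * b) 0) (s, J)) (fun x => x i * x j) := by
  set U := pot (st (√l * b) (√l * √ls * a * b) 0) (s, J) with hU
  have key : ∀ f : Vec n → ℝ, ∫ x, weight1 l b x (obsY1 ls a s (wmat J)) * f x ∂vecGauss n =
      gnorm (Fin n) * Real.exp (-(1 / 4) * frob2 (obsY1 ls a s (wmat J))) *
        ∫ x, f x * Real.exp (U x) := by
    intro f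
    rw [show vecGauss n = gam (Fin n) from rfl, integral_gam, mul_assoc]
    congr 1
    rw [← integral_const_mul]
    congr 1
    funext x
    rw [weight1_eq hn hls hl ha hb, ← hU, Real.exp_add,
      show -(1 / 2) * nsq x = -(1 / 2 * nsq x) by ring, Real.exp_neg]
    field_simp
  have hZ := key fun _ => 1
  simp only [mul_one, one_mul] at hZ
  have hg := gnorm_pos (ι := Fin n)
  rw [mmis1, Matrix.of_apply, partitionZ1, hZ, key, mul_div_mul_left _ _ (by positivity), av, Zf,
    ← mul_div_assoc, ← integral_const_mul]
  simp only [mul_assoc]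

theorem mse_integrand_eq (hn : n ≠ 0) {ls l a b : ℝ} (hls : 0 < ls) (hl : 0 < l) (ha : 0 < a)
    (hb : 0 < b) (s : Vec n) (J : Ix n → ℝ)
    (hU : Good (pot (st (√l * b) (√l * √ls * a * b) 0) (s, J))) :
    frob2 (a • Matrix.vecMulVec s s - mmis1 n l b (obsY1 ls a s (wmat J))) =
      a ^ 2 * nsq s ^ 2 - 2 * a * b * aS2 (st (√l * b) (√l * √ls * a * b) 0) (s, J)
        + b ^ 2 * aR2 (st (√l * b) (√l * √ls * a * b) 0) (s, J) := by
  have h1 : nsq s ^ 2 = ∑ i, ∑ j, s i ^ 2 * s j ^ 2 := by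
    rw [pow_two, nsq, Finset.sum_mul_sum]
  have h2 : aS2 (st (√l * b) (√l * √ls * a * b) 0) (s, J) = ∑ i, ∑ j, s i * s j *
      av (pot (st (√l * b) (√l * √ls * a * b) 0) (s, J)) (fun x => x i * x j) := by
    have : (fun x : Vec n => ip s x ^ 2) = fun x => ∑ i, ∑ j, s i * s j * (x i * x j) := by
      funext x
      rw [pow_two, ip, Finset.sum_mul_sum]
      exact Finset.sum_congr rfl fun i _ => Finset.sum_congr rfl fun j _ => by ring
    rw [aS2, this, av_sum hU _ fun i => (by fun_prop)]
    refine Finset.sum_congr rfl fun i _ => ?_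
    rw [av_sum hU _ fun j => (by fun_prop)]
    exact Finset.sum_congr rfl fun j _ => av_const_mul _ _
  rw [h1, h2]
  simp only [aR2, frob2, Finset.mul_sum, ← Finset.sum_add_distrib, ← Finset.sum_sub_distrib]
  refine Finset.sum_congr rfl fun i _ => Finset.sum_congr rfl fun j _ => ?_
  rw [Matrix.sub_apply, gibbs_eq hn hls hl ha hb]
  simp only [Matrix.smul_apply, Matrix.vecMulVec_apply, smul_eq_mul]
  ring

theorem mse1_eq (hn : n ≠ 0) {ls l a b : ℝ} (hls : 0 < ls) (hl : 0 < l) (ha : 0 < a)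
    (hb : 0 < b) :
    mse1 ls l a b n = a ^ 2 * (1 + 2 / n)
      - 4 * a * b * (EE (gam (Fin n)) (aS2 (st (√l * b) (√l * √ls * a * b) 0)) / (2 * n ^ 2))
      + b ^ 2 * (EE (gam (Fin n)) (aR2 (st (√l * b) (√l * √ls * a * b) 0)) / n ^ 2) := by
  have hn' : (0 : ℝ) < n := by positivity
  obtain ⟨K, hK⟩ := admA_st (ν := gam (Fin n)) hn 0 (b := √l * b) (a := √l * √ls * a * b)
    (by positivity) (by positivity)
  have hw : Measurable (Prod.map id (wmat (n := n)) : Om n → _) :=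
    measurable_id.prodMap continuous_wmat.measurable
  have l0 : LPG (gam (Fin n)) (fun ω : Om n => a ^ 2 * nsq ω.1 ^ 2) := by
    refine PG.lpg ?_
    unfold nsq
    fun_prop
  have l1 := hK.lpg_S2.const_mul (2 * a * b)
  have hi : ∫ p, frob2 (a • Matrix.vecMulVec p.1 p.1 - mmis1 n l b (obsY1 ls a p.1 p.2))
      ∂(vecGauss n).prod (goe n) = a ^ 2 * (n ^ 2 + 2 * n)
      - 2 * a * b * EE (gam (Fin n)) (aS2 (st (√l * b) (√l * √ls * a * b) 0))
      + b ^ 2 * EE (gam (Fin n)) (aR2 (st (√l * b) (√l * √ls * a * b) 0)) := by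
    rw [vecGauss_prod_goe, integral_map hw.aemeasurable
      (measurable_mse_integrand ls a l b).aestronglyMeasurable]
    refine (EE_congr (G := fun ω => a ^ 2 * nsq ω.1 ^ 2
      - 2 * a * b * aS2 (st (√l * b) (√l * √ls * a * b) 0) ω
      + b ^ 2 * aR2 (st (√l * b) (√l * √ls * a * b) 0) ω) (hK.mono fun s hs J =>
      mse_integrand_eq hn hls hl ha hb s J (Adm.good (h := hs)))).trans ?_
    rw [EE_add mom_gam (l0.sub l1) (hK.lpg_R2.const_mul (b ^ 2)), EE_sub mom_gam l0 l1,
      EE_const_mul, EE_const_mul, EE_const_mul]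
    congr 3
    rw [EE, integral_fun_fst (f := fun s : Vec n => nsq s ^ 2), integral_nsq_sq]
    simp
  rw [mse1, hi]
  field_simp
  ring

theorem tendsto_mse1 {ls l a b : ℝ} (hls : 0 < ls) (hl : 0 < l) (ha : 0 < a) (hb : 0 < b) :
    Tendsto (fun n => mse1 ls l a b n) atTop (nhds (a ^ 2
      - 4 * a * b * Fd (√l * b) (max (max 1 (√l * b)) (√l * √ls * a * b) - 1)
      + b ^ 2 * ((max (max 1 (√l * b)) (√l * √ls * a * b) - 1) ^ 2 / (√l * b) ^ 4))) := by
  have hB : 0 < √l * b := by positivity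
  have hA : 0 < √l * √ls * a * b := by positivity
  have h0 : Tendsto (fun n : ℕ => a ^ 2 * (1 + 2 / (n : ℝ))) atTop (nhds (a ^ 2)) := by
    have := ((tendsto_const_div_atTop_nhds_zero_nat (2 : ℝ)).const_add 1).const_mul (a ^ 2)
    simpa using this
  refine ((h0.sub ((tendsto_S2 hB hA).const_mul (4 * a * b))).add
    ((tendsto_R2 hB hA).const_mul (b ^ 2))).congr' ?_
  filter_upwards [eventually_ne_atTop 0] with n hn
  exact (mse1_eq hn hls hl ha hb).symm

theorem mse_limit_eq {ls l a b : ℝ} (hls : 0 < ls) (hl : 0 < l) (ha : 0 < a) (hb : 0 < b) :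
    a ^ 2 - 4 * a * b * Fd (√l * b) (max (max 1 (√l * b)) (√l * √ls * a * b) - 1)
      + b ^ 2 * ((max (max 1 (√l * b)) (√l * √ls * a * b) - 1) ^ 2 / (√l * b) ^ 4) =
    if ls * a ^ 2 ≤ 1 ∧ 1 < l * b ^ 2 then (1 / √l - 1 / (l * b)) ^ 2 + a ^ 2
    else if 1 < ls * a ^ 2 ∧ 1 < ls * l * a ^ 2 * b ^ 2 then gGau a b ls l + a ^ 2
    else a ^ 2 := by
  obtain ⟨p, hp, rfl⟩ : ∃ p, 0 < p ∧ l = p ^ 2 :=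
    ⟨√l, Real.sqrt_pos.2 hl, (Real.sq_sqrt hl.le).symm⟩
  obtain ⟨q, hq, rfl⟩ : ∃ q, 0 < q ∧ ls = q ^ 2 :=
    ⟨√ls, Real.sqrt_pos.2 hls, (Real.sq_sqrt hls.le).symm⟩
  simp only [gGau, ← div_pow, ← mul_pow, Real.sqrt_sq (div_pos hq hp).le,
    Real.sqrt_sq (mul_pos hq hp).le, Real.sqrt_sq hp.le, Real.sqrt_sq hq.le,
    sq_le_one_iff₀ (mul_pos hq ha).le, one_lt_sq_iff₀ (mul_pos hq ha).le,
    one_lt_sq_iff₀ (mul_pos hp hb).le,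
    one_lt_sq_iff₀ (mul_pos (mul_pos (mul_pos hq hp) ha) hb).le]
  rw [show q * p * a * b = p * q * a * b by ring]
  have hAB : p * q * a * b = q * a * (p * b) := by ring
  have hB : 0 < p * b := by positivity
  split_ifs with h1 h2
  · have h3 : p * q * a * b ≤ p * b := by
      rw [hAB]; exact mul_le_of_le_one_left hB.le h1.1
    rw [max_eq_right h1.2.le, max_eq_left h3, Fd]
    field_simp
    ring
  · have h3 : p * b ≤ p * q * a * b := by
      rw [hAB]; exact le_mul_of_one_le_left hB.le h2.1.le
    rw [max_eq_right (max_le h2.2.le h3), Fd]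
    field_simp
    ring
  · have h3 : p * b ≤ 1 ∧ p * q * a * b ≤ 1 := by
      rcases le_or_gt (q * a) 1 with h | h
      · have hB1 : p * b ≤ 1 := not_lt.1 fun h' => h1 ⟨h, h'⟩
        refine ⟨hB1, ?_⟩
        rw [hAB]
        exact (mul_le_of_le_one_left hB.le h).trans hB1
      · have hA1 : p * q * a * b ≤ 1 := not_lt.1 fun h' => h2 ⟨h, h'⟩
        refine ⟨le_trans ?_ hA1, hA1⟩
        rw [hAB]
        exact le_mul_of_one_le_left hB.le h.le
    rw [max_eq_left h3.1, max_eq_left h3.2, Fd]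
    simp

end

end RankOne

/-- **Rank-one Gaussian mismatched matrix-MSE limit.** -/
theorem rank_one_gau_mse_limit (ls l a b : ℝ)
    (hls : 0 < ls) (hl : 0 < l) (ha : 0 < a) (hb : 0 < b) :
    Tendsto (fun n => mse1 ls l a b n) atTop
      (nhds
        (if ls * a ^ 2 ≤ 1 ∧ 1 < l * b ^ 2 then
          (1 / Real.sqrt l - 1 / (l * b)) ^ 2 + a ^ 2
        else if 1 < ls * a ^ 2 ∧ 1 < ls * l * a ^ 2 * b ^ 2 then
          gGau a b ls l + a ^ 2
        else a ^ 2)) := by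
  rw [← RankOne.mse_limit_eq hls hl ha hb]
  exact RankOne.tendsto_mse1 hls hl ha hb

end
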